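/- Let G be a connected reduced graph with F(G) = 3 and minimum degree δ(G) ≥ 3. If G is not supereulerian, then G contains no cycle of length 4. -/

import Mathlib

open scoped Classical

/-- A finite loopless multigraph on vertex type `V`, given by a multiset of edges. -/
structure Multigraph (V : Type) where
  edges : Multiset (Sym2 V)
  loopless : ∀ e ∈ edges, ¬ e.IsDiag

namespace Multigraph

variable {V W : Type}

/-- The degree of a vertex with respect to a multiset of edges. -/
noncomputable def degIn (E : Multiset (Sym2 V)) (v : V) : ℕ :=
  Multiset.card (E.filter fun e => v ∈ e)

/-- The degree of a vertex in a multigraph. -/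
noncomputable def deg (G : Multigraph V) (v : V) : ℕ :=
  degIn G.edges v

/-- All endpoints of the edges in `E` lie in `S`. -/
def Within (S : Set V) (E : Multiset (Sym2 V)) : Prop :=
  ∀ e ∈ E, ∀ v ∈ e, v ∈ S

/-- The graph with vertex set `S` and edge multiset `E` is connected (and spans `S`). -/
def ConnOn (S : Set V) (E : Multiset (Sym2 V)) : Prop :=
  S.Nonempty ∧ Within S E ∧
    ∀ u ∈ S, ∀ v ∈ S, Relation.ReflTransGen (fun a b => s(a, b) ∈ E) u v

/-- The graph with vertex set `S` and edge multiset `E` is collapsible: for every even subset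
`R` of `S` there is a spanning connected subgraph whose set of odd-degree vertices is `R`. -/
def CollapsiblePair (S : Set V) (E : Multiset (Sym2 V)) : Prop :=
  S.Nonempty ∧ Within S E ∧
    ∀ R : Set V, R ⊆ S → R.Finite → Even R.ncard →
      ∃ E' ≤ E, ConnOn S E' ∧ ∀ x ∈ S, (Odd (degIn E' x) ↔ x ∈ R)

/-- `(S, E)` is a subgraph of `G`. -/
def IsSubpair (G : Multigraph V) (S : Set V) (E : Multiset (Sym2 V)) : Prop :=
  E ≤ G.edges ∧ Within S E

/-- A multigraph is reduced if it has no collapsible subgraph with more than one vertex. -/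
def Reduced (G : Multigraph V) : Prop :=
  ∀ S E, G.IsSubpair S E → CollapsiblePair S E → S.ncard ≤ 1

/-- `(S, E)` is a maximal collapsible subgraph of `G`. -/
def MaxCollapsibleSub (G : Multigraph V) (S : Set V) (E : Multiset (Sym2 V)) : Prop :=
  G.IsSubpair S E ∧ CollapsiblePair S E ∧
    ∀ S' E', G.IsSubpair S' E' → CollapsiblePair S' E' → S ⊆ S' → E ≤ E' → S' = S ∧ E' = E

/-- `(S, E)` is a nontrivial maximal collapsible subgraph of `G`. -/
def NontrivMaxCollapsible (G : Multigraph V) (S : Set V) (E : Multiset (Sym2 V)) : Prop :=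
  G.MaxCollapsibleSub S E ∧ 1 < S.ncard

/-- The multiset of edges of `G` with both ends in `S`. -/
noncomputable def inducedEdges (G : Multigraph V) (S : Set V) : Multiset (Sym2 V) :=
  G.edges.filter fun e => ∀ v ∈ e, v ∈ S

/-- `S` is the vertex set of a maximal collapsible subgraph of `G`. -/
def IsMaxCollapsibleSet (G : Multigraph V) (S : Set V) : Prop :=
  CollapsiblePair S (G.inducedEdges S) ∧
    ∀ T : Set V, S ⊆ T → CollapsiblePair T (G.inducedEdges T) → T = S

/-- `G'` (on vertex type `W`) is the reduction of `G`, witnessed by the contraction map `f`: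
the fibres of `f` are exactly the (vertex sets of the) maximal collapsible subgraphs of `G`,
and the edges of `G'` are obtained by contracting each fibre to a point and deleting the
resulting loops. -/
def IsReduction (G : Multigraph V) (f : V → W) (G' : Multigraph W) : Prop :=
  Function.Surjective f ∧ (∀ w : W, G.IsMaxCollapsibleSet (f ⁻¹' {w})) ∧
    G'.edges = (G.edges.map (Sym2.map f)).filter fun e => ¬ e.IsDiag

/-- A multigraph is supereulerian if it has a spanning connected subgraph in which every
vertex has even degree. -/
def Supereulerian (G : Multigraph V) : Prop :=
  ∃ E' ≤ G.edges, ConnOn Set.univ E' ∧ ∀ x : V, Even (degIn E' x)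

/-- A multigraph is connected. -/
def Connected (G : Multigraph V) : Prop :=
  ConnOn Set.univ G.edges

/-- A multigraph is 3-edge-connected (edge connectivity at least 3): removing any at most two
edges leaves a spanning connected graph. -/
def ThreeEdgeConnected (G : Multigraph V) : Prop :=
  ∀ F : Multiset (Sym2 V), F ≤ G.edges → Multiset.card F ≤ 2 →
    ConnOn Set.univ (G.edges - F)

/-- A spanning tree: spanning connected with `|V| - 1` edges. -/
def IsSpanningTree [Fintype V] (E : Multiset (Sym2 V)) : Prop :=
  ConnOn Set.univ E ∧ Multiset.card E = Fintype.card V - 1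

/-- The edge multiset `E` contains two edge-disjoint spanning trees. -/
def HasTwoDisjointSpanningTrees [Fintype V] (E : Multiset (Sym2 V)) : Prop :=
  ∃ T₁ T₂ : Multiset (Sym2 V), T₁ + T₂ ≤ E ∧ IsSpanningTree T₁ ∧ IsSpanningTree T₂

/-- `F(G)`: the minimum number of extra (loopless) edges whose addition to `G` produces a
spanning supergraph having two edge-disjoint spanning trees. -/
noncomputable def FVal [Fintype V] (G : Multigraph V) : ℕ :=
  sInf {k : ℕ | ∃ Eadd : Multiset (Sym2 V), (∀ e ∈ Eadd, ¬ e.IsDiag) ∧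
    Multiset.card Eadd = k ∧ HasTwoDisjointSpanningTrees (G.edges + Eadd)}

/-- `σ̄₂(G)`: the minimum of `deg u + deg v` over edges `uv` of `G`. -/
noncomputable def sigma2bar (G : Multigraph V) : ℕ :=
  sInf {k : ℕ | ∃ u v : V, s(u, v) ∈ G.edges ∧ G.deg u + G.deg v = k}

/-- `G` contains a cycle of length four. -/
def HasFourCycle (G : Multigraph V) : Prop :=
  ∃ a b c d : V, a ≠ b ∧ a ≠ c ∧ a ≠ d ∧ b ≠ c ∧ b ≠ d ∧ c ≠ d ∧
    s(a, b) ∈ G.edges ∧ s(b, c) ∈ G.edges ∧ s(c, d) ∈ G.edges ∧ s(d, a) ∈ G.edges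

/-- `M` is a matching: distinct edges share no endpoint. -/
def IsMatching (M : Multiset (Sym2 V)) : Prop :=
  M.Nodup ∧ ∀ e ∈ M, ∀ f ∈ M, e ≠ f → ∀ x : V, x ∈ e → x ∉ f

/-- `{X, Y}` is a bipartition (of the full vertex set) for the edge multiset `E`:
every edge has one end in `X` and one end in `Y`. -/
def IsBipartition [Fintype V] (X Y : Finset V) (E : Multiset (Sym2 V)) : Prop :=
  Disjoint X Y ∧ X ∪ Y = Finset.univ ∧
    ∀ e ∈ E, (∃ a ∈ e, a ∈ X) ∧ (∃ b ∈ e, b ∈ Y)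

/-- The edge multiset of Catlin's π-reduction `G/π` obtained from the induced four-cycle
`u v z w`: remove the four cycle edges, identify `z` with `u` (forming `x = u`) and `w` with
`v` (forming `y = v`), and add the new edge `e_π = xy = s(u, v)`. -/
noncomputable def piEdges (G : Multigraph V) (u v z w : V) : Multiset (Sym2 V) :=
  ((G.edges - {s(u, v), s(v, z), s(z, w), s(w, u)}).map
      (Sym2.map fun a => if a = z then u else if a = w then v else a)) + {s(u, v)}

/-- `(S, E)` is the multigraph `Φ(c, t)`: a star `K_{1,t}` with centre `c` in which every
edge is doubled. -/
def IsPhi (S : Set V) (E : Multiset (Sym2 V)) (c : V) (t : ℕ) : Prop :=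
  ∃ A : Finset V, c ∉ A ∧ A.card = t ∧ S = insert c (↑A : Set V) ∧
    E = A.val.map (fun a => s(c, a)) + A.val.map (fun a => s(c, a))

/-- The multigraph associated with a simple graph. -/
noncomputable def ofSimple [Fintype V] (G : SimpleGraph V) : Multigraph V where
  edges := G.edgeSet.toFinset.val
  loopless := by
    intro e he
    have he' : e ∈ G.edgeSet := by simpa using he
    exact G.not_isDiag_of_mem_edgeSet he'

/-- Isomorphism of multigraphs. -/
def MIso {A B : Type} (G : Multigraph A) (H : Multigraph B) : Prop :=
  ∃ φ : A ≃ B, H.edges = G.edges.map (Sym2.map φ)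

end Multigraph

/-- Vertices of the Petersen graph: the 2-element subsets of a 5-element set. -/
abbrev PetersenVert : Type := {s : Finset (Fin 5) // s.card = 2}

/-- The Petersen graph (as the Kneser graph on 2-subsets of a 5-set). -/
def petersenSimple : SimpleGraph PetersenVert :=
  SimpleGraph.fromRel fun a b => Disjoint a.1 b.1

noncomputable def petersen : Multigraph PetersenVert :=
  Multigraph.ofSimple petersenSimple

/-- The graph `P₁₄`: obtained from the Petersen graph (outer cycle `0 1 2 3 4`, spokes
`i — i+5`, inner cycle `5 7 9 6 8 5`) by replacing the vertex `9` (whose neighbours were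
`4`, `7`, `6`) by a copy of `K_{2,3}` with degree-three vertices `9`, `10` and degree-two
vertices `11`, `12`, `13`, joined to `4`, `7`, `6` respectively. -/
def p14Simple : SimpleGraph (Fin 14) :=
  SimpleGraph.fromRel fun a b =>
    (a, b) ∈ ([(0, 1), (1, 2), (2, 3), (3, 4), (4, 0), (0, 5), (1, 6), (2, 7), (3, 8),
      (5, 7), (6, 8), (8, 5), (9, 11), (9, 12), (9, 13), (10, 11), (10, 12), (10, 13),
      (11, 4), (12, 7), (13, 6)] : List (Fin 14 × Fin 14))

noncomputable def p14 : Multigraph (Fin 14) :=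
  Multigraph.ofSimple p14Simple

section
open Multigraph
open scoped Classical


namespace RG
variable {V : Type}

/-- Parity of the degree. -/
noncomputable def par (E : Multiset (Sym2 V)) (x : V) : ZMod 2 := (degIn E x : ZMod 2)

/-- Reachability. -/
def Rch (E : Multiset (Sym2 V)) (a b : V) : Prop :=
  Relation.ReflTransGen (fun a b => s(a, b) ∈ E) a b

/-- Collapsibility of a vertex set inside an edge multiset. -/
def Col (E : Multiset (Sym2 V)) (S : Finset V) : Prop :=
  S.Nonempty ∧ ∀ ρ : V → ZMod 2, ∑ x ∈ S, ρ x = 0 →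
    ∃ E' ≤ E, ConnOn (S : Set V) E' ∧ ∀ x ∈ S, par E' x = ρ x

def RedE (E : Multiset (Sym2 V)) : Prop := ∀ S : Finset V, Col E S → S.card ≤ 1

def LL (E : Multiset (Sym2 V)) : Prop := ∀ e ∈ E, ¬ e.IsDiag

theorem degIn_add (A B : Multiset (Sym2 V)) (x : V) :
    degIn (A + B) x = degIn A x + degIn B x := by
  simp [degIn]

theorem degIn_mono {A B : Multiset (Sym2 V)} (h : A ≤ B) (x : V) : degIn A x ≤ degIn B x :=
  Multiset.card_le_card (Multiset.filter_le_filter _ h)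

theorem par_add (A B : Multiset (Sym2 V)) (x : V) : par (A + B) x = par A x + par B x := by
  simp [par, degIn_add]

@[simp] theorem par_zero (x : V) : par (0 : Multiset (Sym2 V)) x = 0 := by
  simp [par, degIn]

theorem par_cons (e : Sym2 V) (A : Multiset (Sym2 V)) (x : V) :
    par (e ::ₘ A) x = par {e} x + par A x := by
  rw [← Multiset.singleton_add, par_add]

theorem par_insert (e : Sym2 V) (A : Multiset (Sym2 V)) (x : V) :
    par (insert e A) x = par {e} x + par A x := par_cons e A x

theorem par_single (e : Sym2 V) (x : V) : par {e} x = if x ∈ e then 1 else 0 := by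
  unfold par degIn
  split_ifs with h
  · simp [Multiset.filter_singleton, h]
  · simp [Multiset.filter_singleton, h]

theorem par_edge {a b : V} (h : a ≠ b) (x : V) :
    par {s(a, b)} x = (if x = a then 1 else 0) + (if x = b then 1 else 0) := by
  rw [par_single]
  by_cases h1 : x = a <;> by_cases h2 : x = b <;> simp_all

theorem par_eq_zero_of_notMem {E : Multiset (Sym2 V)} {x : V} (h : ∀ e ∈ E, x ∉ e) :
    par E x = 0 := by
  have : E.filter (fun e => x ∈ e) = 0 := by
    rw [Multiset.filter_eq_nil]; exact h
  simp [par, degIn, this]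

theorem degIn_eq_zero_of_notMem {E : Multiset (Sym2 V)} {x : V} (h : ∀ e ∈ E, x ∉ e) :
    degIn E x = 0 := by
  have : E.filter (fun e => x ∈ e) = 0 := by
    rw [Multiset.filter_eq_nil]; exact h
  simp [degIn, this]

theorem Rch.symm {E : Multiset (Sym2 V)} {a b : V} (h : Rch E a b) : Rch E b a := by
  unfold Rch at *
  induction h with
  | refl => exact .refl
  | tail _ h2 ih =>
    rw [Sym2.eq_swap] at h2
    exact .head h2 ih

theorem Rch.trans {E : Multiset (Sym2 V)} {a b c : V} (h : Rch E a b) (h2 : Rch E b c) :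
    Rch E a c := Relation.ReflTransGen.trans h h2

theorem Rch.rfl' {E : Multiset (Sym2 V)} (a : V) : Rch E a a := Relation.ReflTransGen.refl

theorem Rch.edge {E : Multiset (Sym2 V)} {a b : V} (h : s(a, b) ∈ E) : Rch E a b :=
  Relation.ReflTransGen.single h

theorem Rch.mono' {E F : Multiset (Sym2 V)} (hs : E ⊆ F) {a b : V} (h : Rch E a b) :
    Rch F a b := Relation.ReflTransGen.mono (fun _ _ h => hs h) _ _ h

theorem Rch.mono {E F : Multiset (Sym2 V)} (hs : E ≤ F) {a b : V} (h : Rch E a b) :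
    Rch F a b := h.mono' (Multiset.subset_of_le hs)

theorem split_le {A B E : Multiset (Sym2 V)} (P : Sym2 V → Prop) (hA : A ≤ E) (hB : B ≤ E)
    (h1 : ∀ e ∈ A, P e) (h2 : ∀ e ∈ B, ¬ P e) : A + B ≤ E := by
  rw [Multiset.le_iff_count]
  intro e
  rw [Multiset.count_add]
  by_cases h : e ∈ A
  · have : e ∉ B := fun hb => h2 e hb (h1 e h)
    rw [Multiset.count_eq_zero_of_notMem this]
    simpa using Multiset.count_le_of_le e hA
  · rw [Multiset.count_eq_zero_of_notMem h]
    simpa using Multiset.count_le_of_le e hB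

theorem handshake {T : Finset V} {D : Multiset (Sym2 V)} (hl : LL D)
    (hw : Within (T : Set V) D) : ∑ x ∈ T, par D x = 0 := by
  induction D using Multiset.induction_on with
  | empty => simp
  | cons e D ih =>
    have h1 := ih (fun e he => hl e (Multiset.mem_cons_of_mem he))
      (fun e he => hw e (Multiset.mem_cons_of_mem he))
    simp only [par_cons, Finset.sum_add_distrib, h1, add_zero]
    have h2 := hl e (Multiset.mem_cons_self e D)
    have h3 := hw e (Multiset.mem_cons_self e D)
    induction e using Sym2.ind with
    | _ a b =>
      have hab : a ≠ b := by simpa using h2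
      have ha : a ∈ T := by simpa using h3 a (by simp)
      have hb : b ∈ T := by simpa using h3 b (by simp)
      simp only [par_edge hab, Finset.sum_add_distrib, Finset.sum_ite_eq', ha, hb, if_true]
      decide

theorem Col.mono {E F : Multiset (Sym2 V)} (h : E ≤ F) {S : Finset V} (hc : Col E S) :
    Col F S := ⟨hc.1, fun ρ hρ => by
      obtain ⟨E', h1, h2⟩ := hc.2 ρ hρ
      exact ⟨E', h1.trans h, h2⟩⟩

theorem RedE.anti {E F : Multiset (Sym2 V)} (h : E ≤ F) (hc : RedE F) : RedE E :=
  fun S hS => hc S (hS.mono h)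

theorem LL.anti {E F : Multiset (Sym2 V)} (h : E ≤ F) (hc : LL F) : LL E :=
  fun e he => hc e (Multiset.mem_of_le h he)

theorem Within.anti {S : Set V} {E F : Multiset (Sym2 V)} (h : E ≤ F) (hc : Within S F) :
    Within S E := fun e he => hc e (Multiset.mem_of_le h he)

theorem Within.mono {S T : Set V} (h : S ⊆ T) {E : Multiset (Sym2 V)} (hc : Within S E) :
    Within T E := fun e he v hv => h (hc e he v hv)

theorem z11 : (1 : ZMod 2) + 1 = 0 := by decide

theorem zmod2_cases (a : ZMod 2) : a = 0 ∨ a = 1 := by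
  revert a; decide

theorem redE_of_reduced (G : Multigraph V) (h : G.Reduced) : RedE G.edges := by
  intro S hS
  have := h (S : Set V) (G.edges.filter (fun e => ∀ v ∈ e, v ∈ S))
    ⟨Multiset.filter_le _ _, fun e he v hv => by
      have := (Multiset.mem_filter.1 he).2 v hv
      simpa using this⟩ ?_
  · simpa using this
  refine ⟨by simpa using hS.1, fun e he v hv => by
      have := (Multiset.mem_filter.1 he).2 v hv
      simpa using this, ?_⟩
  intro R hR hfin hev
  obtain ⟨E', h1, h2, h3⟩ := hS.2 (fun x => if x ∈ R then 1 else 0) (by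
    rw [Finset.sum_boole]
    have : (S.filter (· ∈ R)).card = R.ncard := by
      rw [← Set.ncard_coe_finset]; congr 1; ext x; simp
      intro hx; simpa using hR hx
    rw [this]
    exact (ZMod.natCast_eq_zero_iff_even).2 hev)
  refine ⟨E', ?_, h2, ?_⟩
  · rw [Multiset.le_filter]
    exact ⟨h1, fun e he v hv => by simpa using h2.2.1 e he v hv⟩
  · intro x hx
    have := h3 x (by simpa using hx)
    rw [← Nat.not_even_iff_odd, ← ZMod.natCast_eq_zero_iff_even]
    unfold par at this
    rw [this]
    by_cases h : x ∈ R <;> simp [h]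

theorem col_single (E : Multiset (Sym2 V)) (a : V) : Col E {a} := by
  refine ⟨by simp, fun ρ hρ => ⟨0, by simp, ⟨by simp, by intro e he; simp at he, ?_⟩, ?_⟩⟩
  · intro u hu v hv
    simp at hu hv
    subst hu; subst hv; exact .refl
  · intro x hx
    simp at hx hρ
    subst hx; simp [hρ]

/-- General attaching lemma. -/
theorem attach {E : Multiset (Sym2 V)} (hE : LL E) {S W : Finset V} (hS : Col E S)
    (hSW : Disjoint S W)
    (H : ∀ ρ : V → ZMod 2, ∃ D ≤ E, Within ((S ∪ W : Finset V) : Set V) D ∧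
      (∀ e ∈ D, ∃ w ∈ W, w ∈ e) ∧ (∀ w ∈ W, ∃ s ∈ S, Rch D w s) ∧ ∀ w ∈ W, par D w = ρ w) :
    Col E (S ∪ W) := by
  refine ⟨by obtain ⟨x, hx⟩ := hS.1; exact ⟨x, by simp [hx]⟩, fun ρ hρ => ?_⟩
  obtain ⟨D, hD, hDw, hDn, hDc, hDp⟩ := H ρ
  have hh := handshake (hE.anti hD) hDw
  rw [Finset.sum_union hSW] at hh hρ
  have e1 : ∑ x ∈ W, par D x = ∑ x ∈ W, ρ x := Finset.sum_congr rfl hDp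
  obtain ⟨E', h1, h2, h3⟩ := hS.2 (fun x => ρ x - par D x) (by
    rw [Finset.sum_sub_distrib]
    rw [e1] at hh
    have : (∑ x ∈ S, ρ x) = ∑ x ∈ S, par D x := by
      rw [← add_right_cancel_iff (a := ∑ x ∈ W, ρ x), hρ, hh]
    rw [this, sub_self])
  have hdis : ∀ x, x ∈ S → x ∈ W → False := fun x h1 h2 => Finset.disjoint_left.1 hSW h1 h2
  refine ⟨E' + D, split_le (fun e => ∀ v ∈ e, v ∈ S) h1 hD
    (fun e he v hv => by simpa using h2.2.1 e he v hv) ?_, ⟨?_, ?_, ?_⟩, ?_⟩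
  · intro e he hc
    obtain ⟨w, hw, hwe⟩ := hDn e he
    exact hdis w (hc w hwe) hw
  · obtain ⟨x, hx⟩ := hS.1; exact ⟨x, by simp [hx]⟩
  · intro e he v hv
    rcases Multiset.mem_add.1 he with he | he
    · have := h2.2.1 e he v hv
      simp at this ⊢; exact Or.inl this
    · exact hDw e he v hv
  · have key : ∀ u ∈ S ∪ W, ∃ s ∈ S, Rch (E' + D) u s := by
      intro u hu
      rcases Finset.mem_union.1 hu with hu | hu
      · exact ⟨u, hu, .rfl' u⟩
      · obtain ⟨s, hs, hr⟩ := hDc u hu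
        exact ⟨s, hs, hr.mono (by simp)⟩
    intro u hu v hv
    obtain ⟨s, hs, r1⟩ := key u (by simpa using hu)
    obtain ⟨t, ht, r2⟩ := key v (by simpa using hv)
    have r3 : Rch E' s t := h2.2.2 s (by simpa using hs) t (by simpa using ht)
    exact (r1.trans (r3.mono (by simp))).trans r2.symm
  · intro x hx
    rw [par_add]
    rcases Finset.mem_union.1 hx with hx | hx
    · rw [h3 x hx]; ring
    · rw [hDp x hx, par_eq_zero_of_notMem, zero_add]
      intro e he hxe
      exact hdis x (by simpa using h2.2.1 e he x hxe) hx

theorem ear2 {E : Multiset (Sym2 V)} (hE : LL E) {S : Finset V} (hS : Col E S) {x p p' : V}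
    (hx : x ∉ S) (hp : p ∈ S) (hp' : p' ∈ S) (hle : {s(x, p), s(x, p')} ≤ E) :
    Col E (S ∪ {x}) := by
  have hxp : x ≠ p := fun h => hx (h ▸ hp)
  have hxp' : x ≠ p' := fun h => hx (h ▸ hp')
  refine attach hE hS (by simpa using hx) fun ρ => ?_
  rcases zmod2_cases (ρ x) with h | h
  · refine ⟨{s(x, p), s(x, p')}, hle, ?_, ?_, ?_, ?_⟩
    · intro e he v hv
      simp at he
      rcases he with rfl | rfl <;> simp at hv <;> rcases hv with rfl | rfl <;> simp [*]
    · intro e he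
      simp at he
      rcases he with rfl | rfl <;> simp
    · intro w hw
      simp at hw; subst hw
      exact ⟨p, hp, .edge (by simp)⟩
    · intro w hw
      simp at hw; subst hw
      rw [h, par_insert, par_single, par_single]; simp; decide
  · refine ⟨{s(x, p)}, le_trans (by simp) hle, ?_, ?_, ?_, ?_⟩
    · intro e he v hv
      simp at he
      subst he; simp at hv; rcases hv with rfl | rfl <;> simp [*]
    · intro e he
      simp at he
      subst he; simp
    · intro w hw
      simp at hw; subst hw
      exact ⟨p, hp, .edge (by simp)⟩
    · intro w hw
      simp at hw; subst hw
      rw [h, par_single]; simp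

theorem ear3 {E : Multiset (Sym2 V)} (hE : LL E) {S : Finset V} (hS : Col E S) {x y p p' : V}
    (hx : x ∉ S) (hy : y ∉ S) (hxy : x ≠ y) (hp : p ∈ S) (hp' : p' ∈ S)
    (hle : {s(x, p), s(x, y), s(y, p')} ≤ E) :
    Col E (S ∪ {x, y}) := by
  have hxp : x ≠ p := fun h => hx (h ▸ hp)
  have hxp' : x ≠ p' := fun h => hx (h ▸ hp')
  have hyp : y ≠ p := fun h => hy (h ▸ hp)
  have hyp' : y ≠ p' := fun h => hy (h ▸ hp')
  have sub : ∀ D : Multiset (Sym2 V), D ≤ {s(x, p), s(x, y), s(y, p')} →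
      (∀ w ∈ ({x, y} : Finset V), ∃ s ∈ S, Rch D w s) →
      D ≤ E ∧ Within ((S ∪ {x, y} : Finset V) : Set V) D ∧
      (∀ e ∈ D, ∃ w ∈ ({x, y} : Finset V), w ∈ e) ∧
      (∀ w ∈ ({x, y} : Finset V), ∃ s ∈ S, Rch D w s) := by
    intro D hD hc
    refine ⟨hD.trans hle, ?_, ?_, hc⟩
    · intro e he v hv
      have he := Multiset.mem_of_le hD he
      simp at he
      rcases he with rfl | rfl | rfl <;> simp at hv <;> rcases hv with rfl | rfl <;> simp [*]
    · intro e he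
      have he := Multiset.mem_of_le hD he
      simp at he
      rcases he with rfl | rfl | rfl <;> simp
  refine attach hE hS (by simp [hx, hy]) fun ρ => ?_
  have parx : ∀ D : Multiset (Sym2 V), par D x = ρ x → par D y = ρ y →
      ∀ w ∈ ({x, y} : Finset V), par D w = ρ w := by
    intro D h1 h2 w hw
    simp at hw; rcases hw with rfl | rfl <;> assumption
  have cx : ∀ D : Multiset (Sym2 V), (∃ s ∈ S, Rch D x s) → (∃ s ∈ S, Rch D y s) →
      ∀ w ∈ ({x, y} : Finset V), ∃ s ∈ S, Rch D w s := by
    intro D h1 h2 w hw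
    simp at hw; rcases hw with rfl | rfl <;> assumption
  have mk : ∀ D : Multiset (Sym2 V), D ≤ {s(x, p), s(x, y), s(y, p')} →
      (∃ s ∈ S, Rch D x s) → (∃ s ∈ S, Rch D y s) → par D x = ρ x → par D y = ρ y →
      ∃ D ≤ E, Within ((S ∪ {x, y} : Finset V) : Set V) D ∧
      (∀ e ∈ D, ∃ w ∈ ({x, y} : Finset V), w ∈ e) ∧
      (∀ w ∈ ({x, y} : Finset V), ∃ s ∈ S, Rch D w s) ∧
      ∀ w ∈ ({x, y} : Finset V), par D w = ρ w := by
    intro D h1 h2 h3 h4 h5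
    obtain ⟨a1, a2, a3, a4⟩ := sub D h1 (cx D h2 h3)
    exact ⟨D, a1, a2, a3, a4, parx D h4 h5⟩
  rcases zmod2_cases (ρ x) with h | h <;> rcases zmod2_cases (ρ y) with h' | h'
  · refine mk {s(x, p), s(x, y), s(y, p')} le_rfl ⟨p, hp, .edge (by simp)⟩
      ⟨p', hp', .edge (by simp)⟩ ?_ ?_
    · rw [h]; simp [par_cons, par_single, z11, hxy, hxp']
    · rw [h']; simp [par_cons, par_single, z11, hxy.symm, hyp]
  · refine mk {s(x, p), s(x, y)} ?_ ⟨p, hp, .edge (by simp)⟩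
      ⟨p, hp, Rch.trans (b := x) (.edge (by simp [Sym2.eq_swap])) (.edge (by simp))⟩ ?_ ?_
    · exact Multiset.cons_le_cons _ (by simp)
    · rw [h]; simp [par_cons, par_single, z11]
    · rw [h']; simp [par_cons, par_single, z11, hxy.symm, hyp]
  · refine mk {s(x, y), s(y, p')} ?_
      ⟨p', hp', Rch.trans (b := y) (.edge (by simp)) (.edge (by simp))⟩
      ⟨p', hp', .edge (by simp)⟩ ?_ ?_
    · exact Multiset.le_cons_self _ _
    · rw [h]; simp [par_cons, par_single, z11, hxy, hxp']
    · rw [h']; simp [par_cons, par_single, z11]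
  · refine mk {s(x, p), s(y, p')} ?_ ⟨p, hp, .edge (by simp)⟩
      ⟨p', hp', .edge (by simp)⟩ ?_ ?_
    · exact Multiset.cons_le_cons _ (Multiset.le_cons_self _ _)
    · rw [h]; simp [par_cons, par_single, z11, hxy, hxp']
    · rw [h']; simp [par_cons, par_single, z11, hxy.symm, hyp]

theorem RedE.nodup {E : Multiset (Sym2 V)} (hE : LL E) (hr : RedE E) : E.Nodup := by
  rw [Multiset.nodup_iff_le]
  intro e hle
  induction e using Sym2.ind with
  | _ a b =>
    have hab : a ≠ b := by
      have := hE s(a, b) (Multiset.mem_of_le hle (by simp))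
      simpa using this
    have := hr _ (ear2 hE (col_single E b) (x := a) (p := b) (p' := b) (by simpa using hab)
      (by simp) (by simp) hle)
    rw [Finset.card_union_of_disjoint (by simpa using hab.symm)] at this
    simp at this

theorem pair_le {E : Multiset (Sym2 V)} {e f : Sym2 V} (he : e ∈ E) (hf : f ∈ E) (h : e ≠ f) :
    ({e, f} : Multiset (Sym2 V)) ≤ E := by
  rw [Multiset.le_iff_subset (by simp [h])]
  intro x hx
  simp at hx
  rcases hx with rfl | rfl <;> assumption

theorem RedE.no_triangle {E : Multiset (Sym2 V)} (hE : LL E) (hr : RedE E) {a b c : V}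
    (h1 : s(a, b) ∈ E) (h2 : s(b, c) ∈ E) (h3 : s(a, c) ∈ E) : False := by
  have hab : a ≠ b := by simpa using hE _ h1
  have hbc : b ≠ c := by simpa using hE _ h2
  have hac : a ≠ c := by simpa using hE _ h3
  have := hr _ (ear3 hE (col_single E a) (x := b) (y := c) (p := a) (p' := a)
    (by simpa using hab.symm) (by simpa using hac.symm) hbc (by simp) (by simp) (by
      rw [Multiset.le_iff_subset (by simp [hab, hbc, hac, hab.symm, hac.symm, hbc.symm])]
      intro x hx
      simp at hx
      rcases hx with rfl | rfl | rfl
      · rwa [Sym2.eq_swap]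
      · exact h2
      · rwa [Sym2.eq_swap]))
  rw [Finset.card_union_of_disjoint (by simp [hab, hac])] at this
  simp [hbc] at this

theorem Col.subset_of_within {E : Multiset (Sym2 V)} {T : Finset V} {S : Finset V}
    (h : Col E T) (hT : 2 ≤ T.card) (hw : Within (S : Set V) E) : T ⊆ S := by
  intro x hx
  obtain ⟨y, hy, hxy⟩ : ∃ y ∈ T, y ≠ x := Finset.exists_mem_ne (by omega) x
  obtain ⟨E', h1, h2, -⟩ := h.2 (fun _ => 0) (by simp)
  have := h2.2.2 x (by simpa using hx) y (by simpa using hy)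
  rcases Relation.ReflTransGen.cases_head this with h | ⟨c, hc, -⟩
  · exact absurd h.symm hxy
  · have := hw _ (Multiset.mem_of_le h1 hc) x (by simp)
    simpa using this

end RG

namespace RG
variable {V : Type}

theorem exists_map_eq {α β : Type} (g : α → β) (F : Multiset β) :
    ∀ E : Multiset α, F ≤ E.map g → ∃ E1 ≤ E, E1.map g = F := by
  induction F using Multiset.induction_on with
  | empty => intro E _; exact ⟨0, by simp, by simp⟩
  | cons e F ih =>
    intro E h
    have he : e ∈ E.map g := Multiset.mem_of_le h (by simp)
    obtain ⟨a, ha, rfl⟩ := Multiset.mem_map.1 he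
    obtain ⟨E2, rfl⟩ := Multiset.exists_cons_of_mem ha
    rw [Multiset.map_cons] at h
    obtain ⟨E1, h1, rfl⟩ := ih E2 ((Multiset.cons_le_cons_iff _).1 h)
    exact ⟨a ::ₘ E1, Multiset.cons_le_cons _ h1, by simp⟩

theorem par_map [Fintype V] (φ : V → V) (E : Multiset (Sym2 V)) (h : LL (E.map (Sym2.map φ)))
    (t : V) : par (E.map (Sym2.map φ)) t = ∑ x ∈ Finset.univ.filter (fun x => φ x = t), par E x := by
  induction E using Multiset.induction_on with
  | empty => simp
  | cons e E ih =>
    rw [Multiset.map_cons] at h ⊢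
    rw [par_cons, ih (h.anti (Multiset.le_cons_self _ _))]
    simp only [par_cons e E, Finset.sum_add_distrib]
    congr 1
    have h2 := h _ (Multiset.mem_cons_self _ _)
    induction e using Sym2.ind with
    | _ a b =>
      rw [Sym2.map_mk] at h2 ⊢
      have hab : φ a ≠ φ b := by simpa using h2
      have hab' : a ≠ b := fun h => hab (by rw [h])
      simp only [Prod.map, par_edge hab, par_edge hab', Finset.sum_add_distrib]
      rw [Finset.sum_ite_eq', Finset.sum_ite_eq']
      simp [eq_comm]

theorem rch_lift (φ : V → V) {E1 H : Multiset (Sym2 V)} (hle : E1 ≤ H)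
    (hf : ∀ x y, φ x = φ y → Rch H x y) {a b : V}
    (h : Rch (E1.map (Sym2.map φ)) (φ a) (φ b)) : Rch H a b := by
  have key : ∀ c d, Rch (E1.map (Sym2.map φ)) c d → ∀ a b, φ a = c → φ b = d → Rch H a b := by
    intro c d h
    unfold Rch at h
    induction h with
    | refl => intro a b h1 h2; exact hf a b (h1.trans h2.symm)
    | @tail c' d _ h2 ih =>
      intro a b ha hb
      obtain ⟨e, he, hem⟩ := Multiset.mem_map.1 h2
      induction e using Sym2.ind with
      | _ x y =>
        simp only [Sym2.map_mk, Sym2.eq_iff] at hem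
        rcases hem with ⟨h3, h4⟩ | ⟨h3, h4⟩
        · exact (ih a x ha h3).trans ((Rch.edge (Multiset.mem_of_le hle he)).trans
            (hf y b (h4.trans hb.symm)))
        · exact (ih a y ha h4).trans
            ((Rch.edge (Multiset.mem_of_le hle he)).symm.trans (hf x b (h3.trans hb.symm)))
  exact key _ _ h a b rfl rfl

/-- contraction map -/
noncomputable def cmap (X : Finset V) (u : V) (a : V) : V := if a ∈ X then u else a

noncomputable def contr (X : Finset V) (u : V) (E : Multiset (Sym2 V)) : Multiset (Sym2 V) :=
  (E.map (Sym2.map (cmap X u))).filter (fun e => ¬ e.IsDiag)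

theorem contr_LL (X : Finset V) (u : V) (E : Multiset (Sym2 V)) : LL (contr X u E) :=
  fun _ he => (Multiset.mem_filter.1 he).2

/-- Lemma C -/
theorem col_contr [Fintype V] {E : Multiset (Sym2 V)} (hE : LL E) {X T : Finset V} {u : V}
    (hu : u ∈ X)
    (hX : Col E X) (hT : Col (contr X u E) T) (huT : u ∈ T) (hTX : ∀ a ∈ T, a ∈ X → a = u) :
    Col E (T ∪ X) := by
  refine ⟨⟨u, by simp [hu]⟩, fun ρ hρ => ?_⟩
  set φ := cmap X u with hφ
  have φX : ∀ a ∈ X, φ a = u := fun a ha => by simp [hφ, cmap, ha]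
  have φN : ∀ a, a ∉ X → φ a = a := fun a ha => by simp [hφ, cmap, ha]
  have φu : ∀ a, φ a = u ↔ a ∈ X := by
    intro a
    by_cases h : a ∈ X
    · simp [φX a h, h]
    · simp only [φN a h, h, iff_false]; rintro rfl; exact h hu
  have hun : T ∪ X = (T.erase u) ∪ X := by
    ext a; by_cases h : a = u
    · subst h; simp [hu]
    · simp [h]
  have hdis : Disjoint (T.erase u) X := by
    rw [Finset.disjoint_left]; intro a ha hX
    rw [Finset.mem_erase] at ha
    exact ha.1 (hTX a ha.2 hX)
  rw [hun, Finset.sum_union hdis] at hρ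
  obtain ⟨F', hF, hFc, hFp⟩ := hT.2 (fun t => if t = u then ∑ x ∈ X, ρ x else ρ t) (by
    rw [← Finset.sum_erase_add _ _ huT]
    rw [if_pos rfl, ← hρ]
    congr 1
    refine Finset.sum_congr rfl fun x hx => ?_
    rw [if_neg (Finset.ne_of_mem_erase hx)])
  obtain ⟨E1, hE1, rfl⟩ := exists_map_eq _ _ _ (hF.trans (Multiset.filter_le _ _))
  have hll : LL (E1.map (Sym2.map φ)) := (contr_LL X u E).anti hF
  have pm := par_map φ E1 hll
  have pu : ∑ x ∈ X, par E1 x = ∑ x ∈ X, ρ x := by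
    have := hFp u huT
    rw [pm u] at this
    simp only [if_pos, φu] at this
    simpa using this
  have hφT : ∀ e ∈ E1, ∀ a ∈ e, φ a ∈ T := by
    intro e he a ha
    have := hFc.2.1 _ (Multiset.mem_map_of_mem _ he) (φ a) (Sym2.mem_map.2 ⟨a, ha, rfl⟩)
    simpa using this
  have hback : ∀ a, φ a ∈ T → a ∈ T ∪ X := by
    intro a ha
    by_cases h : a ∈ X
    · simp [h]
    · rw [φN a h] at ha; simp [ha]
  obtain ⟨E2, hE2, hE2c, hE2p⟩ := hX.2 (fun x => ρ x - par E1 x) (by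
    rw [Finset.sum_sub_distrib, pu, sub_self])
  have nin : ∀ e ∈ E1, ¬ ∀ v ∈ e, v ∈ X := by
    intro e he hin
    have hd := hll _ (Multiset.mem_map_of_mem _ he)
    induction e using Sym2.ind with
    | _ a b =>
      apply hd
      rw [Sym2.map_mk, φX a (hin a (by simp)), φX b (hin b (by simp))]
      simp
  have conn : ∀ a ∈ T ∪ X, ∀ b ∈ T ∪ X, Rch (E2 + E1) a b := by
    have hφin : ∀ a ∈ T ∪ X, φ a ∈ T := by
      intro a ha
      by_cases h : a ∈ X
      · rw [φX a h]; exact huT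
      · rw [φN a h]; simpa [h] using ha
    intro a ha b hb
    refine rch_lift φ (E1 := E1) (by simp) ?_ (hFc.2.2 (φ a) ?_ (φ b) ?_)
    · intro x y hxy
      by_cases hx : x ∈ X
      · have hy : y ∈ X := by rw [φX x hx] at hxy; exact (φu y).1 hxy.symm
        exact Rch.mono (E := E2) (by simp) (hE2c.2.2 x hx y hy)
      · have hy : y ∉ X := by intro hy; rw [φX y hy] at hxy; exact hx ((φu x).1 hxy)
        rw [φN x hx, φN y hy] at hxy
        subst hxy; exact .rfl' x
    · simpa using hφin a ha
    · simpa using hφin b hb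
  refine ⟨E2 + E1, split_le (fun e => ∀ v ∈ e, v ∈ X) hE2 hE1
    (fun e he v hv => by simpa using hE2c.2.1 e he v hv) nin, ⟨⟨u, by simp [hu]⟩, ?_, ?_⟩, ?_⟩
  · intro e he v hv
    rcases Multiset.mem_add.1 he with he | he
    · have := hE2c.2.1 e he v hv
      simp at this ⊢; exact Or.inr this
    · have := hback v (hφT e he v hv); exact_mod_cast this
  · intro a ha b hb
    exact conn a (by exact_mod_cast ha) b (by exact_mod_cast hb)
  · intro x hx
    rw [par_add]
    by_cases h : x ∈ X
    · rw [hE2p x h]; ring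
    · have hxT : x ∈ T := by simpa [h] using hx
      have h0 : par E2 x = 0 := par_eq_zero_of_notMem fun e he hxe =>
        h (by simpa using hE2c.2.1 e he x hxe)
      have hxu : x ≠ u := by rintro rfl; exact h hu
      have := hFp x hxT
      rw [pm x, if_neg hxu] at this
      rw [h0, zero_add, ← this]
      symm
      have : Finset.univ.filter (fun y => φ y = x) = {x} := by
        ext y
        simp only [Finset.mem_filter, Finset.mem_univ, true_and, Finset.mem_singleton]
        constructor
        · intro hy
          by_cases hyX : y ∈ X
          · rw [φX y hyX] at hy; exact absurd hy.symm hxu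
          · rw [φN y hyX] at hy; exact hy
        · rintro rfl; exact φN y h
      rw [this, Finset.sum_singleton]

/-- sets not affected by the map -/
theorem col_unaffected {E P : Multiset (Sym2 V)} {φ : V → V} {T : Finset V}
    (hP : ∀ F ≤ P, Within (T : Set V) F → F ≤ E.map (Sym2.map φ))
    (hφ : ∀ a, φ a ∈ T → φ a = a) (hT : Col P T) : Col E T := by
  refine ⟨hT.1, fun ρ hρ => ?_⟩
  obtain ⟨F', hF, hFc, hFp⟩ := hT.2 ρ hρ
  obtain ⟨E1, hE1, rfl⟩ := exists_map_eq _ _ _ (hP F' hF hFc.2.1)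
  have : E1.map (Sym2.map φ) = E1 := by
    conv_rhs => rw [← Multiset.map_id E1]
    refine Multiset.map_congr rfl fun e he => ?_
    have h := hFc.2.1 _ (Multiset.mem_map_of_mem (Sym2.map φ) he)
    induction e using Sym2.ind with
    | _ a b =>
      have h1 := hφ a (by simpa using h (φ a) (by simp))
      have h2 := hφ b (by simpa using h (φ b) (by simp))
      simp [h1, h2]
  rw [this] at hFc hFp
  exact ⟨E1, hE1, hFc, hFp⟩

end RG

namespace RG
variable {V : Type}

theorem rch_lift' (φ : V → V) {F H : Multiset (Sym2 V)}
    (hs : ∀ c d, s(c, d) ∈ F → ∃ x y, φ x = c ∧ φ y = d ∧ Rch H x y)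
    (hf : ∀ x y, φ x = φ y → Rch H x y) {a b : V}
    (h : Rch F (φ a) (φ b)) : Rch H a b := by
  have key : ∀ c d, Rch F c d → ∀ a b, φ a = c → φ b = d → Rch H a b := by
    intro c d h
    unfold Rch at h
    induction h with
    | refl => intro a b h1 h2; exact hf a b (h1.trans h2.symm)
    | @tail c' d _ h2 ih =>
      intro a b ha hb
      obtain ⟨x, y, h3, h4, h5⟩ := hs _ _ h2
      exact (ih a x ha h3).trans (h5.trans (hf y b (h4.trans hb.symm)))
  exact key _ _ h a b rfl rfl

theorem map_step (φ : V → V) {E1 : Multiset (Sym2 V)} {c d : V}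
    (h : s(c, d) ∈ E1.map (Sym2.map φ)) : ∃ x y, φ x = c ∧ φ y = d ∧ s(x, y) ∈ E1 := by
  obtain ⟨e, he, hem⟩ := Multiset.mem_map.1 h
  induction e using Sym2.ind with
  | _ x y =>
    simp only [Sym2.map_mk, Sym2.eq_iff] at hem
    rcases hem with ⟨h3, h4⟩ | ⟨h3, h4⟩
    · exact ⟨x, y, h3, h4, he⟩
    · exact ⟨y, x, h4, h3, by rwa [Sym2.eq_swap]⟩

def C4 (u v z w : V) : Multiset (Sym2 V) := {s(u, v), s(v, z), s(z, w), s(w, u)}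

noncomputable def pmap (u v z w : V) (a : V) : V := if a = z then u else if a = w then v else a

noncomputable def piE (u v z w : V) (E : Multiset (Sym2 V)) : Multiset (Sym2 V) :=
  s(u, v) ::ₘ ((E - C4 u v z w).map (Sym2.map (pmap u v z w)))

/-- the four vertices are distinct -/
def D4 (u v z w : V) : Prop := u ≠ v ∧ u ≠ z ∧ u ≠ w ∧ v ≠ z ∧ v ≠ w ∧ z ≠ w

theorem c4le {u v z w : V} {D : Multiset (Sym2 V)} (h : D.Nodup) (h2 : ∀ e ∈ D, e ∈ C4 u v z w) :
    D ≤ C4 u v z w := (Multiset.le_iff_subset h).2 (fun _ he => h2 _ he)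

theorem sub1 {u v z w : V} (hd : D4 u v z w) (ε : V → ZMod 2) (h1 : ε u + ε z = 1)
    (h2 : ε v + ε w = 1) : ∃ C' ≤ C4 u v z w, Rch C' u v ∧ Rch C' u z ∧ Rch C' v w ∧
      par C' u = ε u ∧ par C' v = ε v ∧ par C' z = ε z ∧ par C' w = ε w := by
  obtain ⟨d1, d2, d3, d4, d5, d6⟩ := hd
  have e1 : ∀ a b : V, ∀ C : Multiset (Sym2 V), s(a, b) ∈ C → Rch C b a := fun a b C h =>
    (Rch.edge h).symm
  have zz : ∀ a b : ZMod 2, a + b = 1 → (a = 0 ∧ b = 1) ∨ (a = 1 ∧ b = 0) := by decide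
  rcases zz _ _ h1 with ⟨hu, hz⟩ | ⟨hu, hz⟩ <;> rcases zz _ _ h2 with ⟨hv, hw⟩ | ⟨hv, hw⟩
  · -- odd z w : remove zw
    refine ⟨{s(u, v), s(v, z), s(w, u)}, ?_, .edge (by simp),
      Rch.trans (b := v) (.edge (by simp)) (.edge (by simp)),
      Rch.trans (b := u) (e1 _ _ _ (by simp)) (e1 _ _ _ (by simp)), ?_, ?_, ?_, ?_⟩
    · exact c4le (by simp [d1, d2, d3, d4, d5, d6, d1.symm, d2.symm, d3.symm, d4.symm, d5.symm, d6.symm]) (by simp [C4])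
    all_goals simp [par_cons, par_single, z11, *, d1.symm, d2.symm, d3.symm, d4.symm, d5.symm, d6.symm]
  · -- odd z v
    refine ⟨{s(u, v), s(z, w), s(w, u)}, ?_, .edge (by simp),
      Rch.trans (b := w) (e1 _ _ _ (by simp)) (e1 _ _ _ (by simp)),
      Rch.trans (b := u) (e1 _ _ _ (by simp)) (e1 _ _ _ (by simp)), ?_, ?_, ?_, ?_⟩
    · exact c4le (by simp [d1, d2, d3, d4, d5, d6, d1.symm, d2.symm, d3.symm, d4.symm, d5.symm, d6.symm]) (by simp [C4])
    all_goals simp [par_cons, par_single, z11, *, d1.symm, d2.symm, d3.symm, d4.symm, d5.symm, d6.symm]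
  · -- odd u w
    refine ⟨{s(u, v), s(v, z), s(z, w)}, ?_, .edge (by simp),
      Rch.trans (b := v) (.edge (by simp)) (.edge (by simp)),
      Rch.trans (b := z) (.edge (by simp)) (.edge (by simp)), ?_, ?_, ?_, ?_⟩
    · exact c4le (by simp [d1, d2, d3, d4, d5, d6, d1.symm, d2.symm, d3.symm, d4.symm, d5.symm, d6.symm]) (by simp [C4])
    all_goals simp [par_cons, par_single, z11, *, d1.symm, d2.symm, d3.symm, d4.symm, d5.symm, d6.symm]
  · -- odd u v
    refine ⟨{s(v, z), s(z, w), s(w, u)}, ?_, 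
      Rch.trans (b := w) (e1 _ _ _ (by simp)) (Rch.trans (b := z) (e1 _ _ _ (by simp)) (e1 _ _ _ (by simp))),
      Rch.trans (b := w) (e1 _ _ _ (by simp)) (e1 _ _ _ (by simp)),
      Rch.trans (b := z) (.edge (by simp)) (.edge (by simp)), ?_, ?_, ?_, ?_⟩
    · exact c4le (by simp [d1, d2, d3, d4, d5, d6, d1.symm, d2.symm, d3.symm, d4.symm, d5.symm, d6.symm]) (by simp [C4])
    all_goals simp [par_cons, par_single, z11, *, d1.symm, d2.symm, d3.symm, d4.symm, d5.symm, d6.symm]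

theorem sub2 {u v z w : V} (hd : D4 u v z w) (ε : V → ZMod 2) (h1 : ε u = ε z)
    (h2 : ε v = ε w) (E1 : Multiset (Sym2 V))
    (hp : Rch E1 u v ∨ Rch E1 u w ∨ Rch E1 z v ∨ Rch E1 z w) :
    ∃ C' ≤ C4 u v z w, Rch (E1 + C') u z ∧ Rch (E1 + C') v w ∧
      par C' u = ε u ∧ par C' v = ε v ∧ par C' z = ε z ∧ par C' w = ε w := by
  obtain ⟨d1, d2, d3, d4, d5, d6⟩ := hd
  have ed : ∀ a b : V, ∀ C : Multiset (Sym2 V), s(a, b) ∈ C → Rch (E1 + C) a b :=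
    fun a b C h => Rch.edge (by simp [h])
  have e1 : ∀ a b : V, ∀ C : Multiset (Sym2 V), s(a, b) ∈ C → Rch (E1 + C) b a := fun a b C h =>
    (Rch.edge (by simp [h])).symm
  have hC : ∀ C, Rch (E1 + C) u v ∨ Rch (E1 + C) u w ∨ Rch (E1 + C) z v ∨ Rch (E1 + C) z w := by
    intro C
    rcases hp with h | h | h | h
    · exact Or.inl (h.mono (Multiset.le_add_right _ _))
    · exact Or.inr (Or.inl (h.mono (Multiset.le_add_right _ _)))
    · exact Or.inr (Or.inr (Or.inl (h.mono (Multiset.le_add_right _ _))))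
    · exact Or.inr (Or.inr (Or.inr (h.mono (Multiset.le_add_right _ _))))
  rcases zmod2_cases (ε u) with hu | hu <;> rcases zmod2_cases (ε v) with hv | hv <;>
    (have hz := hu; have hw := hv; rw [h1] at hz; rw [h2] at hw)
  · refine ⟨_, le_rfl, Rch.trans (b := v) (ed _ _ _ (by simp [C4])) (ed _ _ _ (by simp [C4])),
      Rch.trans (b := z) (ed _ _ _ (by simp [C4])) (ed _ _ _ (by simp [C4])), ?_, ?_, ?_, ?_⟩
    all_goals simp [C4, par_cons, par_single, z11, *, d1.symm, d2.symm, d3.symm, d4.symm, d5.symm, d6.symm]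
  · -- odd v w : add v p z.. path v-p̄-w
    have hh : (Rch E1 u v ∨ Rch E1 u w) ∨ (Rch E1 z v ∨ Rch E1 z w) := by tauto
    rcases hh with hh | hh
    · refine ⟨{s(v, z), s(z, w)}, ?_, ?_, Rch.trans (b := z) (ed _ _ _ (by simp)) (ed _ _ _ (by simp)), ?_, ?_, ?_, ?_⟩
      · exact c4le (by simp [d1, d2, d3, d4, d5, d6, d1.symm, d2.symm, d3.symm, d4.symm, d5.symm, d6.symm]) (by simp [C4])
      · rcases hh with h | h
        · exact Rch.trans (b := v) (h.mono (Multiset.le_add_right _ _)) (ed _ _ _ (by simp))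
        · exact Rch.trans (b := w) (h.mono (Multiset.le_add_right _ _)) (e1 _ _ _ (by simp))
      all_goals simp [C4, par_cons, par_single, z11, *, d1.symm, d2.symm, d3.symm, d4.symm, d5.symm, d6.symm]
    · refine ⟨{s(u, v), s(w, u)}, ?_, ?_, Rch.trans (b := u) (e1 _ _ _ (by simp)) (e1 _ _ _ (by simp)), ?_, ?_, ?_, ?_⟩
      · exact c4le (by simp [d1, d2, d3, d4, d5, d6, d1.symm, d2.symm, d3.symm, d4.symm, d5.symm, d6.symm]) (by simp [C4])
      · rcases hh with h | h
        · exact Rch.trans (b := v) (ed _ _ _ (by simp)) (h.mono (Multiset.le_add_right _ _)).symm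
        · exact Rch.trans (b := w) (e1 _ _ _ (by simp)) (h.mono (Multiset.le_add_right _ _)).symm
      all_goals simp [C4, par_cons, par_single, z11, *, d1.symm, d2.symm, d3.symm, d4.symm, d5.symm, d6.symm]
  · -- odd u z
    have hh : (Rch E1 u v ∨ Rch E1 z v) ∨ (Rch E1 u w ∨ Rch E1 z w) := by tauto
    rcases hh with hh | hh
    · refine ⟨{s(z, w), s(w, u)}, ?_, Rch.trans (b := w) (e1 _ _ _ (by simp)) (e1 _ _ _ (by simp)), ?_, ?_, ?_, ?_, ?_⟩
      · exact c4le (by simp [d1, d2, d3, d4, d5, d6, d1.symm, d2.symm, d3.symm, d4.symm, d5.symm, d6.symm]) (by simp [C4])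
      · rcases hh with h | h
        · exact Rch.trans (b := u) (h.mono (Multiset.le_add_right _ _)).symm (e1 _ _ _ (by simp))
        · exact Rch.trans (b := z) (h.mono (Multiset.le_add_right _ _)).symm (ed _ _ _ (by simp))
      all_goals simp [C4, par_cons, par_single, z11, *, d1.symm, d2.symm, d3.symm, d4.symm, d5.symm, d6.symm]
    · refine ⟨{s(u, v), s(v, z)}, ?_, Rch.trans (b := v) (ed _ _ _ (by simp)) (ed _ _ _ (by simp)), ?_, ?_, ?_, ?_, ?_⟩
      · exact c4le (by simp [d1, d2, d3, d4, d5, d6, d1.symm, d2.symm, d3.symm, d4.symm, d5.symm, d6.symm]) (by simp [C4])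
      · rcases hh with h | h
        · exact Rch.trans (b := u) (e1 _ _ _ (by simp)) (h.mono (Multiset.le_add_right _ _))
        · exact Rch.trans (b := z) (ed _ _ _ (by simp)) (h.mono (Multiset.le_add_right _ _))
      all_goals simp [C4, par_cons, par_single, z11, *, d1.symm, d2.symm, d3.symm, d4.symm, d5.symm, d6.symm]
  · have hh : (Rch E1 u v ∨ Rch E1 z w) ∨ (Rch E1 u w ∨ Rch E1 z v) := by tauto
    rcases hh with hh | hh
    · -- add v z , w u
      refine ⟨{s(v, z), s(w, u)}, ?_, ?_, ?_, ?_, ?_, ?_, ?_⟩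
      · exact c4le (by simp [d1, d2, d3, d4, d5, d6, d1.symm, d2.symm, d3.symm, d4.symm, d5.symm, d6.symm]) (by simp [C4])
      · rcases hh with h | h
        · exact Rch.trans (b := v) (h.mono (Multiset.le_add_right _ _)) (ed _ _ _ (by simp))
        · exact Rch.trans (b := w) (e1 _ _ _ (by simp)) (h.mono (Multiset.le_add_right _ _)).symm
      · rcases hh with h | h
        · exact Rch.trans (b := u) (h.mono (Multiset.le_add_right _ _)).symm (e1 _ _ _ (by simp))
        · exact Rch.trans (b := z) (ed _ _ _ (by simp)) (h.mono (Multiset.le_add_right _ _))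
      all_goals simp [C4, par_cons, par_single, z11, *, d1.symm, d2.symm, d3.symm, d4.symm, d5.symm, d6.symm]
    · -- add u v, z w
      refine ⟨{s(u, v), s(z, w)}, ?_, ?_, ?_, ?_, ?_, ?_, ?_⟩
      · exact c4le (by simp [d1, d2, d3, d4, d5, d6, d1.symm, d2.symm, d3.symm, d4.symm, d5.symm, d6.symm]) (by simp [C4])
      · rcases hh with h | h
        · exact Rch.trans (b := w) (h.mono (Multiset.le_add_right _ _)) (e1 _ _ _ (by simp))
        · exact Rch.trans (b := v) (ed _ _ _ (by simp)) (h.mono (Multiset.le_add_right _ _)).symm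
      · rcases hh with h | h
        · exact Rch.trans (b := u) (e1 _ _ _ (by simp)) (h.mono (Multiset.le_add_right _ _))
        · exact Rch.trans (b := z) (h.mono (Multiset.le_add_right _ _)).symm (ed _ _ _ (by simp))
      all_goals simp [C4, par_cons, par_single, z11, *, d1.symm, d2.symm, d3.symm, d4.symm, d5.symm, d6.symm]

theorem col_pi [Fintype V] {E : Multiset (Sym2 V)} (hE : LL E) {u v z w : V} (hd : D4 u v z w)
    (hC : C4 u v z w ≤ E) (huz : s(u, z) ∉ E) (hvw : s(v, w) ∉ E) {T : Finset V}
    (hT : Col (piE u v z w E) T) (hu : u ∈ T) (hv : v ∈ T) (hz : z ∉ T) (hw : w ∉ T) :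
    Col E (T ∪ {z, w}) := by
  refine ⟨⟨u, by simp [hu]⟩, fun ρ hρ => ?_⟩
  have d := hd
  obtain ⟨d1, d2, d3, d4, d5, d6⟩ := d
  set φ := pmap u v z w with hφ
  have φz : φ z = u := by simp [hφ, pmap]
  have φw : φ w = v := by simp [hφ, pmap, d6.symm]
  have φN : ∀ a, a ≠ z → a ≠ w → φ a = a := fun a h1 h2 => by simp [hφ, pmap, h1, h2]
  have φu : φ u = u := φN u d2 d3
  have φv : φ v = v := φN v d4 d5
  have fu : ∀ a, φ a = u → a = u ∨ a = z := by
    intro a h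
    by_cases h1 : a = z
    · exact Or.inr h1
    · by_cases h2 : a = w
      · subst h2; rw [φw] at h; exact absurd h.symm d1
      · rw [φN a h1 h2] at h; exact Or.inl h
  have fv : ∀ a, φ a = v → a = v ∨ a = w := by
    intro a h
    by_cases h1 : a = z
    · subst h1; rw [φz] at h; exact absurd h d1
    · by_cases h2 : a = w
      · exact Or.inr h2
      · rw [φN a h1 h2] at h; exact Or.inl h
  have fo : ∀ a t, φ a = t → t ≠ u → t ≠ v → a = t := by
    intro a t h h1 h2
    by_cases h3 : a = z
    · subst h3; rw [φz] at h; exact absurd h.symm h1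
    · by_cases h4 : a = w
      · subst h4; rw [φw] at h; exact absurd h.symm h2
      · rw [φN a h3 h4] at h; exact h
  set C := C4 u v z w with hCdef
  set E0 := E - C with hE0
  have hE0C : E0 + C = E := Multiset.sub_add_cancel hC
  have hE0E : E0 ≤ E := by rw [← hE0C]; simp
  have hll0 : LL (E0.map (Sym2.map φ)) := by
    intro e he hdiag
    obtain ⟨f, hf, rfl⟩ := Multiset.mem_map.1 he
    have hfE := Multiset.mem_of_le hE0E hf
    have hfl := hE f hfE
    induction f using Sym2.ind with
    | _ a b =>
      have hab : a ≠ b := by simpa using hfl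
      have hφab : φ a = φ b := by simpa using hdiag
      by_cases h1 : φ b = u
      · rcases fu b h1 with rfl | rfl <;> rcases fu a (hφab.trans h1) with rfl | rfl
        · exact hab rfl
        · exact huz (by rwa [Sym2.eq_swap])
        · exact huz hfE
        · exact hab rfl
      · by_cases h2 : φ b = v
        · rcases fv b h2 with rfl | rfl <;> rcases fv a (hφab.trans h2) with rfl | rfl
          · exact hab rfl
          · exact hvw (by rwa [Sym2.eq_swap])
          · exact hvw hfE
          · exact hab rfl
        · exact hab ((fo a _ hφab h1 h2).trans (fo b _ rfl h1 h2).symm)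
  -- finishing lemma
  have finish : ∀ (E1 C' F : Multiset (Sym2 V)), E1 ≤ E0 → C' ≤ C → ConnOn (T : Set V) F →
      E1.map (Sym2.map φ) ≤ F →
      (∀ c d', s(c, d') ∈ F → s(c, d') ∈ E1.map (Sym2.map φ) ∨
        (s(c, d') = s(u, v) ∧ Rch (E1 + C') u v)) →
      Rch (E1 + C') u z → Rch (E1 + C') v w →
      par C' u = ρ u - par E1 u → par C' v = ρ v - par E1 v →
      par C' z = ρ z - par E1 z → par C' w = ρ w - par E1 w →
      (∀ x ∈ T, x ≠ u → x ≠ v → par E1 x = ρ x) →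
      ∃ E' ≤ E, ConnOn ((T ∪ {z, w} : Finset V) : Set V) E' ∧
        ∀ x ∈ T ∪ {z, w}, par E' x = ρ x := by
    intro E1 C' F hE1 hC' hFc hEF hstep ruz rvw pu pv pz pw po
    have memT : ∀ a, φ a ∈ T → a ∈ T ∪ {z, w} := by
      intro a ha
      by_cases h1 : a = z
      · simp [h1]
      · by_cases h2 : a = w
        · simp [h2]
        · rw [φN a h1 h2] at ha; simp [ha]
    have memT' : ∀ a ∈ T ∪ {z, w}, φ a ∈ T := by
      intro a ha
      by_cases h1 : a = z
      · rw [h1, φz]; exact hu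
      · by_cases h2 : a = w
        · rw [h2, φw]; exact hv
        · rw [φN a h1 h2]; simpa [h1, h2] using ha
    refine ⟨E1 + C', ?_, ⟨⟨u, by simp [hu]⟩, ?_, ?_⟩, ?_⟩
    · rw [← hE0C]; exact add_le_add hE1 hC'
    · intro e he x hx
      rcases Multiset.mem_add.1 he with he | he
      · have := hFc.2.1 _ (Multiset.mem_of_le hEF (Multiset.mem_map_of_mem _ he)) (φ x)
          (Sym2.mem_map.2 ⟨x, hx, rfl⟩)
        have := memT x (by exact_mod_cast this)
        exact_mod_cast this
      · have := Multiset.mem_of_le hC' he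
        simp only [hCdef, C4, Multiset.insert_eq_cons, Multiset.mem_cons, Multiset.mem_singleton] at this
        rcases this with rfl | rfl | rfl | rfl <;> simp at hx <;> rcases hx with rfl | rfl <;>
          simp [*]
    · intro a ha b hb
      refine rch_lift' φ (F := F) ?_ ?_ (hFc.2.2 _ ?_ _ ?_)
      · intro c d' hcd
        rcases hstep c d' hcd with h | ⟨h, h'⟩
        · obtain ⟨x, y, h1, h2, h3⟩ := map_step φ h
          exact ⟨x, y, h1, h2, Rch.edge (by simp [h3])⟩
        · rw [Sym2.eq_iff] at h
          rcases h with ⟨rfl, rfl⟩ | ⟨rfl, rfl⟩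
          · exact ⟨_, _, φu, φv, h'⟩
          · exact ⟨_, _, φv, φu, h'.symm⟩
      · intro x y hxy
        by_cases h1 : φ y = u
        · rcases fu y h1 with rfl | rfl <;> rcases fu x (hxy.trans h1) with rfl | rfl
          · exact .rfl' _
          · exact ruz.symm
          · exact ruz
          · exact .rfl' _
        · by_cases h2 : φ y = v
          · rcases fv y h2 with rfl | rfl <;> rcases fv x (hxy.trans h2) with rfl | rfl
            · exact .rfl' _
            · exact rvw.symm
            · exact rvw
            · exact .rfl' _
          · rw [(fo x _ hxy h1 h2).trans (fo y _ rfl h1 h2).symm]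
            exact .rfl' _
      · exact_mod_cast memT' a (by exact_mod_cast ha)
      · exact_mod_cast memT' b (by exact_mod_cast hb)
    · intro x hx
      rw [par_add]
      by_cases h1 : x = u
      · subst h1; rw [pu]; ring
      by_cases h2 : x = v
      · subst h2; rw [pv]; ring
      by_cases h3 : x = z
      · subst h3; rw [pz]; ring
      by_cases h4 : x = w
      · subst h4; rw [pw]; ring
      have hxT : x ∈ T := by simpa [h3, h4] using hx
      rw [po x hxT h1 h2, par_eq_zero_of_notMem, add_zero]
      intro e he hxe
      have := Multiset.mem_of_le hC' he
      simp only [hCdef, C4, Multiset.insert_eq_cons, Multiset.mem_cons, Multiset.mem_singleton] at this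
      rcases this with rfl | rfl | rfl | rfl <;> rw [Sym2.mem_iff] at hxe <;> tauto
  -- fibre sums
  have pm : ∀ E1 ≤ E0, par (E1.map (Sym2.map φ)) u = par E1 u + par E1 z ∧
      par (E1.map (Sym2.map φ)) v = par E1 v + par E1 w ∧
      ∀ x, x ≠ u → x ≠ v → x ≠ z → x ≠ w → par (E1.map (Sym2.map φ)) x = par E1 x := by
    intro E1 hE1
    have h := par_map φ E1 (hll0.anti (Multiset.map_le_map hE1))
    refine ⟨?_, ?_, ?_⟩
    · rw [h u]
      have : Finset.univ.filter (fun x => φ x = u) = {u, z} := by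
        ext a; simp only [Finset.mem_filter, Finset.mem_univ, true_and, Finset.mem_insert,
          Finset.mem_singleton]
        exact ⟨fu a, by rintro (rfl | rfl) <;> assumption⟩
      rw [this, Finset.sum_pair d2]
    · rw [h v]
      have : Finset.univ.filter (fun x => φ x = v) = {v, w} := by
        ext a; simp only [Finset.mem_filter, Finset.mem_univ, true_and, Finset.mem_insert,
          Finset.mem_singleton]
        exact ⟨fv a, by rintro (rfl | rfl) <;> assumption⟩
      rw [this, Finset.sum_pair d5]
    · intro x h1 h2 h3 h4
      rw [h x]
      have : Finset.univ.filter (fun y => φ y = x) = {x} := by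
        ext a; simp only [Finset.mem_filter, Finset.mem_univ, true_and,
          Finset.mem_singleton]
        exact ⟨fun h => fo a x h h1 h2, by rintro rfl; exact φN a h3 h4⟩
      rw [this, Finset.sum_singleton]
  -- obtain the edge set
  have hdisj : Disjoint T {z, w} := by simp [hz, hw]
  rw [Finset.sum_union hdisj, Finset.sum_pair d6] at hρ
  obtain ⟨F', hF, hFc, hFp⟩ := hT.2
    (fun t => ρ t + (if t = u then ρ z else 0) + (if t = v then ρ w else 0)) (by
      simp only [Finset.sum_add_distrib, Finset.sum_ite_eq', hu, hv, if_true]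
      rw [← hρ]; ring)
  have hFu := hFp u hu
  have hFv := hFp v hv
  simp only [d1, d1.symm, if_true, if_false, add_zero] at hFu hFv
  have zz : ∀ a b c d : ZMod 2, a + b = c + d → c - a = d - b := by decide
  have zz1 : ∀ a b c d : ZMod 2, 1 + (a + b) = c + d → c - a + (d - b) = 1 := by decide
  unfold piE at hF
  by_cases hmem : s(u, v) ∈ F'
  · obtain ⟨F'', rfl⟩ := Multiset.exists_cons_of_mem hmem
    rw [Multiset.cons_le_cons_iff] at hF
    obtain ⟨E1, hE1, rfl⟩ := exists_map_eq _ _ _ hF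
    obtain ⟨p1, p2, p3⟩ := pm E1 hE1
    simp only [par_cons] at hFu hFv hFp
    rw [p1] at hFu; rw [p2] at hFv
    simp [par_single] at hFu hFv
    obtain ⟨C', hC', r1, r2, r3, q1, q2, q3, q4⟩ := sub1 hd (fun x => ρ x - par E1 x)
      (zz1 _ _ _ _ hFu) (zz1 _ _ _ _ hFv)
    refine finish E1 C' _ hE1 hC' hFc (Multiset.le_cons_self _ _) ?_ (r2.mono (by simp))
      (r3.mono (by simp)) q1 q2 q3 q4 ?_
    · intro c d' hcd
      rcases Multiset.mem_cons.1 hcd with h | h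
      · exact Or.inr ⟨h, r1.mono (by simp)⟩
      · exact Or.inl h
    · intro x hx h1 h2
      have := hFp x hx
      rw [p3 x h1 h2 (fun h => hz (h ▸ hx)) (fun h => hw (h ▸ hx))] at this
      simpa [par_single, h1, h2] using this
  · rw [Multiset.le_cons_of_notMem hmem] at hF
    obtain ⟨E1, hE1, rfl⟩ := exists_map_eq _ _ _ hF
    obtain ⟨p1, p2, p3⟩ := pm E1 hE1
    rw [p1] at hFu; rw [p2] at hFv
    have conn : Rch E1 u v ∨ Rch E1 u w ∨ Rch E1 z v ∨ Rch E1 z w := by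
      by_contra hcon
      push Not at hcon
      have key : ∀ t, Rch (E1.map (Sym2.map φ)) u t → ∃ x, (Rch E1 u x ∨ Rch E1 z x) ∧ φ x = t := by
        intro t ht
        unfold Rch at ht
        induction ht with
        | refl => exact ⟨u, Or.inl (.rfl' u), φu⟩
        | @tail c d' _ h2 ih =>
          obtain ⟨x, hx, hxc⟩ := ih
          obtain ⟨a, b, h3, h4, h5⟩ := map_step φ h2
          refine ⟨b, ?_, h4⟩
          by_cases hc1 : c = u
          · rcases fu a (h3.trans hc1) with rfl | rfl
            · exact Or.inl (.edge h5)
            · exact Or.inr (.edge h5)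
          by_cases hc2 : c = v
          · rcases fv x (hxc.trans hc2) with rfl | rfl <;> tauto
          have : a = x := (fo a c h3 hc1 hc2).trans (fo x c hxc hc1 hc2).symm
          subst this
          rcases hx with hx | hx
          · exact Or.inl (hx.trans (.edge h5))
          · exact Or.inr (hx.trans (.edge h5))
      obtain ⟨x, hx, hxv⟩ := key v (hFc.2.2 u hu v hv)
      rcases fv x hxv with rfl | rfl <;> tauto
    obtain ⟨C', hC', r2, r3, q1, q2, q3, q4⟩ := sub2 hd (fun x => ρ x - par E1 x)
      (zz _ _ _ _ hFu) (zz _ _ _ _ hFv) E1 conn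
    refine finish E1 C' _ hE1 hC' hFc le_rfl (fun _ _ h => Or.inl h) r2 r3 q1 q2 q3 q4 ?_
    intro x hx h1 h2
    have := hFp x hx
    rw [p3 x h1 h2 (fun h => hz (h ▸ hx)) (fun h => hw (h ▸ hx))] at this
    simpa [h1, h2] using this

end RG

namespace RG
variable {V : Type}

theorem piE_LL {E : Multiset (Sym2 V)} (hE : LL E) {u v z w : V} (hd : D4 u v z w)
    (huz : s(u, z) ∉ E) (hvw : s(v, w) ∉ E) : LL (piE u v z w E) := by
  obtain ⟨d1, d2, d3, d4, d5, d6⟩ := hd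
  intro e he
  unfold piE at he
  rcases Multiset.mem_cons.1 he with rfl | he
  · simpa using d1
  obtain ⟨f, hf, rfl⟩ := Multiset.mem_map.1 he
  have hfE := Multiset.mem_of_le (Multiset.sub_le_self _ _) hf
  have hfl := hE f hfE
  induction f using Sym2.ind with
  | _ a b =>
    have hab : a ≠ b := by simpa using hfl
    rw [Sym2.map_mk]
    simp only [Sym2.isDiag_iff_proj_eq]
    simp only [pmap]
    have hfE' : s(b, a) ∈ E := by rwa [Sym2.eq_swap]
    split_ifs with h1 h2 h3 h4 h5 h6 h7 h8
    · exact fun _ => hab (h1.trans h2.symm)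
    · exact d1
    · rintro rfl; subst h1; exact huz hfE'
    · exact fun h => d1 h.symm
    · exact fun _ => hab (h4.trans h6.symm)
    · rintro rfl; subst h4; exact hvw hfE'
    · rintro rfl; subst h7; exact huz hfE
    · rintro rfl; subst h8; exact hvw hfE
    · exact hab

theorem k33e [Fintype V] {E : Multiset (Sym2 V)} (hE : LL E) (hr : RedE E) {a b x p q l : V}
    (hab : a ≠ b) (hxa : x ≠ a) (hxb : x ≠ b) (hpq : p ≠ q) (hpl : p ≠ l) (hql : q ≠ l)
    (hxl : x ≠ l)
    (h1 : s(a, p) ∈ E) (h2 : s(a, q) ∈ E) (h3 : s(a, l) ∈ E)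
    (h4 : s(b, p) ∈ E) (h5 : s(b, q) ∈ E) (h6 : s(b, l) ∈ E)
    (h7 : s(x, p) ∈ E) (h8 : s(x, q) ∈ E) : False := by
  have ne : ∀ c d : V, s(c, d) ∈ E → c ≠ d := fun c d h => by simpa using hE _ h
  have n1 := ne _ _ h1
  have n2 := ne _ _ h2
  have n3 := ne _ _ h3
  have n4 := ne _ _ h4
  have n5 := ne _ _ h5
  have n6 := ne _ _ h6
  have n7 := ne _ _ h7
  have n8 := ne _ _ h8
  have hnd := hr.nodup hE
  have sw : ∀ {c d : V}, s(c, d) ∈ E → s(d, c) ∈ E := fun h => by rwa [Sym2.eq_swap]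
  have hd : D4 a p b l := ⟨n1, hab, n3, n4.symm, hpl, n6⟩
  have huz : s(a, b) ∉ E := fun h => hr.no_triangle hE h h4 h1
  have hvw : s(p, l) ∉ E := fun h => hr.no_triangle hE h1 h h3
  have hle : ({s(a, q), s(b, q), s(x, p), s(x, q)} : Multiset (Sym2 V)) + C4 a p b l ≤ E := by
    rw [Multiset.le_iff_subset]
    · intro e he
      simp [C4] at he
      have := sw h4
      have := sw h3
      rcases he with rfl | rfl | rfl | rfl | rfl | rfl | rfl | rfl <;> assumption
    · simp [C4, hab, hxa, hxb, hpq, hpl, hql, hxl, n1, n2, n3, n4, n5, n6, n7, n8, hab.symm,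
        hxa.symm, hxb.symm, hpq.symm, hpl.symm, hql.symm, hxl.symm, n1.symm, n2.symm, n3.symm,
        n4.symm, n5.symm, n6.symm, n7.symm, n8.symm]
  have hC : C4 a p b l ≤ E := le_trans (Multiset.le_add_left _ _) hle
  have hLL := piE_LL hE hd huz hvw
  have hsub : ({s(a, p), s(a, q), s(a, q), s(x, p), s(x, q)} : Multiset (Sym2 V)) ≤ piE a p b l E := by
    unfold piE
    refine Multiset.cons_le_cons _ ?_
    have := Multiset.map_le_map (f := Sym2.map (pmap a p b l)) (le_tsub_of_add_le_right hle)
    refine le_trans (le_of_eq ?_) this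
    simp [pmap, hab, hxa, hxb, hpq, hpl, hql, hxl, n1, n2, n3, n4, n5, n6, n7, n8, hab.symm,
        hxa.symm, hxb.symm, hpq.symm, hpl.symm, hql.symm, hxl.symm, n1.symm, n2.symm, n3.symm,
        n4.symm, n5.symm, n6.symm, n7.symm, n8.symm]
  have c1 := ear2 hLL (col_single _ a) (x := q) (p := a) (p' := a) (by simpa using n2.symm)
    (by simp) (by simp) (le_trans (by
      rw [Sym2.eq_swap (a := q)]
      refine le_trans ?_ (Multiset.le_cons_self _ _)
      exact Multiset.cons_le_cons _ (Multiset.cons_le_cons _ (Multiset.zero_le _))) hsub)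
  have c2 := ear3 hLL c1 (x := p) (y := x) (p := a) (p' := q) (by simp [n1.symm, hpq])
    (by simp [hxa, n8]) n7.symm (by simp) (by simp) (le_trans (by
      rw [Sym2.eq_swap (a := p), Sym2.eq_swap (a := p)]
      refine Multiset.cons_le_cons _ ?_
      refine le_trans ?_ (Multiset.le_cons_self _ _)
      exact Multiset.le_cons_self _ _) hsub)
  have c3 := hr _ (col_pi hE hd hC huz hvw c2 (by simp) (by simp)
    (by simp [hab.symm, n5, n4, hxb.symm]) (by simp [n3.symm, hql.symm, hpl.symm, hxl.symm]))
  have : 1 < (({a} ∪ {q} ∪ {p, x} ∪ {b, l} : Finset V)).card :=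
    Finset.one_lt_card.2 ⟨a, by simp, b, by simp, hab⟩
  omega

def IsK2 (S : Finset V) (E : Multiset (Sym2 V)) (a b : V) : Prop :=
  a ∈ S ∧ b ∈ S ∧ a ≠ b ∧ E.Nodup ∧
    ∀ e, e ∈ E ↔ ∃ x ∈ S, x ≠ a ∧ x ≠ b ∧ (e = s(a, x) ∨ e = s(b, x))

def IsK2t (S : Finset V) (E : Multiset (Sym2 V)) : Prop := ∃ a b, IsK2 S E a b

theorem IsK2.symm {S : Finset V} {E : Multiset (Sym2 V)} {a b : V} (h : IsK2 S E a b) :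
    IsK2 S E b a := by
  obtain ⟨h1, h2, h3, h4, h5⟩ := h
  refine ⟨h2, h1, h3.symm, h4, fun e => (h5 e).trans ?_⟩
  constructor <;> rintro ⟨x, hx, ha, hb, h⟩ <;> exact ⟨x, hx, hb, ha, h.symm⟩

theorem IsK2.leaf {S : Finset V} {E : Multiset (Sym2 V)} {a b x : V} (h : IsK2 S E a b)
    (ha : x ≠ a) (hb : x ≠ b) : degIn E x ≤ 2 := by
  obtain ⟨h1, h2, h3, h4, h5⟩ := h
  unfold degIn
  have : E.filter (fun e => x ∈ e) ≤ {s(a, x), s(b, x)} := by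
    rw [Multiset.le_iff_subset (h4.filter _)]
    intro e he
    rw [Multiset.mem_filter] at he
    obtain ⟨y, hy, hya, hyb, hh⟩ := (h5 e).1 he.1
    rcases hh with rfl | rfl
    · have := he.2; simp [ha] at this; subst this; simp
    · have := he.2; simp [hb] at this; subst this; simp
  exact (Multiset.card_le_card this).trans (by simp)

theorem IsK2.center {S : Finset V} {E : Multiset (Sym2 V)} {a b : V} (h : IsK2 S E a b) :
    degIn E a + 2 ≤ S.card := by
  obtain ⟨h1, h2, h3, h4, h5⟩ := h
  unfold degIn
  have : E.filter (fun e => a ∈ e) ≤ (((S.erase a).erase b).val.map (fun x => s(a, x))) := by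
    rw [Multiset.le_iff_subset (h4.filter _)]
    intro e he
    rw [Multiset.mem_filter] at he
    obtain ⟨y, hy, hya, hyb, hh⟩ := (h5 e).1 he.1
    rw [Multiset.mem_map]
    rcases hh with rfl | rfl
    · exact ⟨y, (show y ∈ (S.erase a).erase b by simp [hy, hya, hyb]), rfl⟩
    · have := he.2; simp [h3, hya.symm] at this
  have := Multiset.card_le_card this
  rw [Multiset.card_map, Finset.card_val, Finset.card_erase_of_mem (by simp [h2, h3.symm]),
    Finset.card_erase_of_mem h1] at this
  have : 2 ≤ S.card := Finset.one_lt_card.2 ⟨a, h1, b, h2, h3⟩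
  omega

theorem IsK2t.card_le {S : Finset V} {E : Multiset (Sym2 V)} (h : IsK2t S E) :
    E.card + 4 ≤ 2 * S.card := by
  obtain ⟨a, b, h1, h2, h3, h4, h5⟩ := h
  have : E ≤ (((S.erase a).erase b).val.map (fun x => s(a, x))) +
      (((S.erase a).erase b).val.map (fun x => s(b, x))) := by
    rw [Multiset.le_iff_subset h4]
    intro e he
    obtain ⟨y, hy, hya, hyb, hh⟩ := (h5 e).1 he
    rw [Multiset.mem_add, Multiset.mem_map, Multiset.mem_map]
    rcases hh with rfl | rfl
    · exact Or.inl ⟨y, (show y ∈ (S.erase a).erase b by simp [hy, hya, hyb]), rfl⟩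
    · exact Or.inr ⟨y, (show y ∈ (S.erase a).erase b by simp [hy, hya, hyb]), rfl⟩
  have := Multiset.card_le_card this
  rw [Multiset.card_add, Multiset.card_map, Multiset.card_map, Finset.card_val,
    Finset.card_erase_of_mem (by simp [h2, h3.symm]),
    Finset.card_erase_of_mem h1] at this
  have : 2 ≤ S.card := Finset.one_lt_card.2 ⟨a, h1, b, h2, h3⟩
  omega

theorem IsK2t.low {S : Finset V} {E : Multiset (Sym2 V)} (h : IsK2t S E) (hS : 3 ≤ S.card)
    (u v : V) : ∃ x ∈ S, x ≠ u ∧ x ≠ v ∧ degIn E x ≤ 2 := by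
  obtain ⟨a, b, h⟩ := h
  by_cases hex : ∃ x ∈ S, x ≠ u ∧ x ≠ v ∧ x ≠ a ∧ x ≠ b
  · obtain ⟨x, h1, h2, h3, h4, h5⟩ := hex
    exact ⟨x, h1, h2, h3, h.leaf h4 h5⟩
  push Not at hex
  have hsub : S ⊆ {u, v, a, b} := by
    intro x hx
    by_contra hc
    simp only [Finset.mem_insert, Finset.mem_singleton, not_or] at hc
    exact hc.2.2.2 (hex x hx hc.1 hc.2.1 hc.2.2.1)
  have h4 : S.card ≤ 4 := (Finset.card_le_card hsub).trans Finset.card_le_four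
  obtain ⟨x, hx⟩ : ∃ x, x ∈ S \ {u, v} := by
    apply Finset.card_pos.1
    have := Finset.le_card_sdiff {u, v} S
    have := Finset.card_le_two (a := u) (b := v)
    omega
  simp at hx
  refine ⟨x, hx.1, hx.2.1, hx.2.2, ?_⟩
  by_cases ha : x = a
  · subst ha; have := h.center; omega
  by_cases hb : x = b
  · subst hb; have := h.symm.center; omega
  exact h.leaf ha hb

end RG

namespace RG
variable {V : Type}

theorem k2_max {S : Finset V} {E E' : Multiset (Sym2 V)} (h : IsK2t S E') (hle : E' ≤ E)
    (hE : LL E) (hr : RedE E) (hS : 3 ≤ S.card) (hw : Within (S : Set V) E) : E = E' := by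
  obtain ⟨a, b, h1, h2, h3, h4, h5⟩ := h
  have hnd := hr.nodup hE
  symm
  apply Multiset.eq_of_le_of_card_le hle
  apply Multiset.card_le_card
  rw [Multiset.le_iff_subset hnd]
  intro e he
  have sub := Multiset.subset_of_le hle
  obtain ⟨l, hl⟩ : ∃ x, x ∈ S \ {a, b} := by
    apply Finset.card_pos.1
    have := Finset.le_card_sdiff {a, b} S
    have := Finset.card_le_two (a := a) (b := b)
    omega
  simp at hl
  have la : ∀ y ∈ S, y ≠ a → y ≠ b → s(a, y) ∈ E ∧ s(b, y) ∈ E := fun y hy ha hb =>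
    ⟨sub ((h5 _).2 ⟨y, hy, ha, hb, Or.inl rfl⟩), sub ((h5 _).2 ⟨y, hy, ha, hb, Or.inr rfl⟩)⟩
  have hll := la l hl.1 hl.2.1 hl.2.2
  induction e using Sym2.ind with
  | _ p q =>
    have hp : p ∈ S := by simpa using hw _ he p (by simp)
    have hq : q ∈ S := by simpa using hw _ he q (by simp)
    have hpq : p ≠ q := by simpa using hE _ he
    have hab : s(a, b) ∉ E := fun h => hr.no_triangle hE h hll.2 hll.1
    rw [h5]
    by_cases pa : p = a
    · subst pa
      by_cases qb : q = b
      · subst qb; exact absurd he hab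
      · exact ⟨q, hq, hpq.symm, qb, Or.inl rfl⟩
    by_cases pb : p = b
    · subst pb
      by_cases qa : q = a
      · subst qa; rw [Sym2.eq_swap] at he; exact absurd he hab
      · exact ⟨q, hq, qa, hpq.symm, Or.inr rfl⟩
    by_cases qa : q = a
    · subst qa; exact ⟨p, hp, pa, pb, Or.inl Sym2.eq_swap⟩
    by_cases qb : q = b
    · subst qb; exact ⟨p, hp, pa, pb, Or.inr Sym2.eq_swap⟩
    exact (hr.no_triangle hE (la p hp pa pb).1 he (la q hq qa qb).1).elim

theorem k2_extend [Fintype V] {S : Finset V} {E : Multiset (Sym2 V)} {x : V}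
    (h : IsK2t S (E.filter (fun e => x ∉ e))) (hx : x ∉ S)
    (hE : LL E) (hr : RedE E) (hS : 3 ≤ S.card)
    (hw : Within ((insert x S : Finset V) : Set V) E)
    (hdeg : degIn E x = 2) : IsK2t (insert x S) E := by
  obtain ⟨a, b, h1, h2, h3, h4, h5⟩ := h
  have hnd := hr.nodup hE
  have sw : ∀ {c d : V}, s(c, d) ∈ E → s(d, c) ∈ E := fun h => by rwa [Sym2.eq_swap]
  -- neighbours
  unfold degIn at hdeg
  obtain ⟨e, f, hef⟩ := Multiset.card_eq_two.1 hdeg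
  have hndf : (E.filter (fun e => x ∈ e)).Nodup := hnd.filter _
  rw [hef] at hndf
  have hefne : e ≠ f := by
    rintro rfl; simp at hndf
  have hmem : ∀ g, (g ∈ E ∧ x ∈ g) ↔ g = e ∨ g = f := by
    intro g
    have := Multiset.mem_filter (p := fun e => x ∈ e) (s := E) (a := g)
    rw [hef] at this; simpa using this.symm
  obtain ⟨p, rfl⟩ : ∃ p, e = s(x, p) := Sym2.mem_iff_exists.1 ((hmem e).2 (Or.inl rfl)).2
  obtain ⟨q, rfl⟩ : ∃ p, f = s(x, p) := Sym2.mem_iff_exists.1 ((hmem f).2 (Or.inr rfl)).2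
  have hpq : p ≠ q := by rintro rfl; exact hefne rfl
  have hpE := ((hmem _).2 (Or.inl rfl)).1
  have hqE := ((hmem _).2 (Or.inr rfl)).1
  have hxp : x ≠ p := by simpa using hE _ hpE
  have hxq : x ≠ q := by simpa using hE _ hqE
  have hp : p ∈ S := by
    have : p ∈ insert x S := by exact_mod_cast hw _ hpE p (by simp)
    simpa [hxp.symm] using this
  have hq : q ∈ S := by
    have : q ∈ insert x S := by exact_mod_cast hw _ hqE q (by simp)
    simpa [hxq.symm] using this
  have hchar : ∀ g, g ∈ E ↔ (∃ y ∈ S, y ≠ a ∧ y ≠ b ∧ (g = s(a, y) ∨ g = s(b, y))) ∨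
      g = s(x, p) ∨ g = s(x, q) := by
    intro g
    rw [← h5, ← hmem, Multiset.mem_filter]
    tauto
  have la : ∀ y ∈ S, y ≠ a → y ≠ b → s(a, y) ∈ E ∧ s(b, y) ∈ E := fun y hy ha hb =>
    ⟨(hchar _).2 (Or.inl ⟨y, hy, ha, hb, Or.inl rfl⟩), (hchar _).2 (Or.inl ⟨y, hy, ha, hb, Or.inr rfl⟩)⟩
  have hxa : x ≠ a := fun h => hx (h ▸ h1)
  have hxb : x ≠ b := fun h => hx (h ▸ h2)
  -- center + leaf impossible
  have mixed : ∀ y ∈ S, y ≠ a → y ≠ b → s(x, y) ∈ E → s(x, a) ∉ E ∧ s(x, b) ∉ E := by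
    intro y hy ha hb hxy
    exact ⟨fun h => hr.no_triangle hE h (la y hy ha hb).1 hxy,
      fun h => hr.no_triangle hE h (la y hy ha hb).2 hxy⟩
  have both : (p = a ∧ q = b) ∨ (p = b ∧ q = a) → IsK2t (insert x S) E := by
    intro hh
    refine ⟨a, b, by simp [h1], by simp [h2], h3, hnd, fun g => (hchar g).trans ?_⟩
    constructor
    · rintro (⟨y, hy, ha, hb, h⟩ | h)
      · exact ⟨y, by simp [hy], ha, hb, h⟩
      · refine ⟨x, by simp, hxa, hxb, ?_⟩
        rw [Sym2.eq_swap (a := a), Sym2.eq_swap (a := b)]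
        rcases hh with ⟨rfl, rfl⟩ | ⟨rfl, rfl⟩
        · exact h
        · exact h.symm
    · rintro ⟨y, hy, ha, hb, h⟩
      rcases Finset.mem_insert.1 hy with rfl | hy
      · right
        rw [Sym2.eq_swap (a := a), Sym2.eq_swap (a := b)] at h
        rcases hh with ⟨rfl, rfl⟩ | ⟨rfl, rfl⟩
        · exact h
        · exact h.symm
      · exact Or.inl ⟨y, hy, ha, hb, h⟩
  by_cases pa : p = a
  · by_cases qb : q = b
    · exact both (Or.inl ⟨pa, qb⟩)
    · exact absurd (pa ▸ hpE) (mixed q hq (fun h => hpq (pa.trans h.symm)) qb hqE).1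
  by_cases pb : p = b
  · by_cases qa : q = a
    · exact both (Or.inr ⟨pb, qa⟩)
    · exact absurd (pb ▸ hpE) (mixed q hq qa (fun h => hpq (pb.trans h.symm)) hqE).2
  by_cases qa : q = a
  · exact absurd (qa ▸ hqE) (mixed p hp pa pb hpE).1
  by_cases qb : q = b
  · exact absurd (qb ▸ hqE) (mixed p hp pa pb hpE).2
  -- both leaves
  by_cases hl : ∃ l ∈ S, l ≠ a ∧ l ≠ b ∧ l ≠ p ∧ l ≠ q
  · obtain ⟨l, hl, l1, l2, l3, l4⟩ := hl
    have hxl : x ≠ l := fun h => hx (h ▸ hl)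
    exact (k33e hE hr h3 hxa hxb hpq l3.symm l4.symm hxl (la p hp pa pb).1 (la q hq qa qb).1
      (la l hl l1 l2).1 (la p hp pa pb).2 (la q hq qa qb).2 (la l hl l1 l2).2 hpE hqE).elim
  push Not at hl
  refine ⟨p, q, by simp [hp], by simp [hq], hpq, hnd, fun g => ?_⟩
  constructor
  · intro hg
    rcases (hchar g).1 hg with ⟨y, hy, ha, hb, h⟩ | h
    · have hy' : y = p ∨ y = q := by
        by_contra hc; push Not at hc; exact hc.2 (hl y hy ha hb hc.1)
      rcases h with rfl | rfl
      · refine ⟨a, by simp [h1], fun h => pa h.symm, fun h => qa h.symm, ?_⟩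
        rcases hy' with rfl | rfl
        · exact Or.inl Sym2.eq_swap
        · exact Or.inr Sym2.eq_swap
      · refine ⟨b, by simp [h2], fun h => pb h.symm, fun h => qb h.symm, ?_⟩
        rcases hy' with rfl | rfl
        · exact Or.inl Sym2.eq_swap
        · exact Or.inr Sym2.eq_swap
    · refine ⟨x, by simp, hxp, hxq, ?_⟩
      rw [Sym2.eq_swap (a := p), Sym2.eq_swap (a := q)]
      exact h
  · rintro ⟨y, hy, yp, yq, h⟩
    rcases Finset.mem_insert.1 hy with rfl | hy
    · rcases h with rfl | rfl
      · exact sw hpE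
      · exact sw hqE
    · have : y = a ∨ y = b := by
        by_contra hc; push Not at hc; exact yq (hl y hy hc.1 hc.2 yp)
      rcases this with rfl | rfl
      · rcases h with rfl | rfl
        · exact sw (la p hp pa pb).1
        · exact sw (la q hq qa qb).1
      · rcases h with rfl | rfl
        · exact sw (la p hp pa pb).2
        · exact sw (la q hq qa qb).2

theorem k2_three {S : Finset V} {E : Multiset (Sym2 V)} (hE : LL E) (hr : RedE E)
    (hS : S.card = 3) (hw : Within (S : Set V) E) (hc : 2 ≤ E.card) : IsK2t S E := by
  obtain ⟨x, y, z, hxy, hxz, hyz, rfl⟩ := Finset.card_eq_three.1 hS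
  have hnd := hr.nodup hE
  have key : ∀ a b c : V, a ≠ b → a ≠ c → b ≠ c → ({a, b, c} : Finset V) = {x, y, z} →
      s(a, b) ∉ E → IsK2t {x, y, z} E := by
    intro a b c hab hac hbc hs hn
    rw [← hs] at hw ⊢
    have hle : E ≤ {s(a, c), s(b, c)} := by
      rw [Multiset.le_iff_subset hnd]
      intro e he
      have h1 := hw e he
      have h2 := hE e he
      induction e using Sym2.ind with
      | _ p q =>
        have hp := h1 p (by simp)
        have hq := h1 q (by simp)
        simp at hp hq h2
        have he' : s(q, p) ∈ E := by rwa [Sym2.eq_swap]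
        simp only [Multiset.insert_eq_cons, Multiset.mem_cons, Multiset.mem_singleton, Sym2.eq_iff]
        rcases hp with rfl | rfl | rfl <;> rcases hq with rfl | rfl | rfl <;> tauto
    have heq : E = {s(a, c), s(b, c)} := Multiset.eq_of_le_of_card_le hle (by simpa using hc)
    refine ⟨a, b, by simp, by simp, hab, hnd, fun e => ?_⟩
    rw [heq]
    simp only [Multiset.insert_eq_cons, Multiset.mem_cons, Multiset.mem_singleton]
    constructor
    · intro h; exact ⟨c, by simp, hac.symm, hbc.symm, h⟩
    · rintro ⟨d, hd, h1, h2, h3⟩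
      simp [h1, h2] at hd; subst hd; exact h3
  by_cases h1 : s(x, y) ∈ E
  · by_cases h2 : s(y, z) ∈ E
    · by_cases h3 : s(x, z) ∈ E
      · exact (hr.no_triangle hE h1 h2 h3).elim
      · exact key x z y hxz hxy hyz.symm (by ext; simp; tauto) h3
    · exact key y z x hyz hxy.symm hxz.symm (by ext; simp; tauto) h2
  · exact key x y z hxy hxz hyz rfl h1

end RG

namespace RG
variable {V : Type}

noncomputable def ind (E : Multiset (Sym2 V)) (L : Finset V) : Multiset (Sym2 V) :=
  E.filter (fun e => ∀ v ∈ e, v ∈ L)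

theorem ind_le (E : Multiset (Sym2 V)) (L : Finset V) : ind E L ≤ E := Multiset.filter_le _ _

theorem ind_within (E : Multiset (Sym2 V)) (L : Finset V) : Within (L : Set V) (ind E L) := by
  intro e he v hv
  exact_mod_cast (Multiset.mem_filter.1 he).2 v hv

def HA (V : Type) (n : ℕ) : Prop :=
  ∀ (S : Finset V) (E : Multiset (Sym2 V)), S.card < n → Within (S : Set V) E → LL E → RedE E →
    3 ≤ S.card → 2 * S.card ≤ E.card + 4 → IsK2t S E

theorem HA.ind_bound {n : ℕ} (h : HA V n) {E : Multiset (Sym2 V)} (hE : LL E) (hr : RedE E)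
    {L : Finset V} (h1 : L.card < n) (h3 : 3 ≤ L.card) : (ind E L).card + 4 ≤ 2 * L.card := by
  by_contra hc
  have := (h L (ind E L) h1 (ind_within E L) (hE.anti (ind_le E L)) (hr.anti (ind_le E L)) h3
    (by omega)).card_le
  omega

theorem card_filter_map_le {α β : Type} (f : α → β) (s : Multiset α) (p : β → Prop) (q : α → Prop)
    [DecidablePred p] [DecidablePred q]
    (h : ∀ e ∈ s, p (f e) → q e) : ((s.map f).filter p).card ≤ (s.filter q).card := by
  rw [Multiset.filter_map, Multiset.card_map]
  induction s using Multiset.induction_on with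
  | empty => simp
  | cons a s ih =>
    have ih := ih (fun e he => h e (Multiset.mem_cons_of_mem he))
    simp only [Function.comp_def] at ih
    have ha := h a (by simp)
    by_cases h1 : p (f a)
    · simp [Multiset.filter_cons, h1, ha h1]; omega
    · by_cases h2 : q a
      · simp [Multiset.filter_cons, h1, h2]; omega
      · simp [Multiset.filter_cons, h1, h2]; omega

theorem le_card_filter_map {α β : Type} (f : α → β) (s : Multiset α) (p : β → Prop) (q : α → Prop)
    [DecidablePred p] [DecidablePred q]
    (h : ∀ e ∈ s, q e → p (f e)) : (s.filter q).card ≤ ((s.map f).filter p).card := by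
  rw [Multiset.filter_map, Multiset.card_map]
  induction s using Multiset.induction_on with
  | empty => simp
  | cons a s ih =>
    have ih := ih (fun e he => h e (Multiset.mem_cons_of_mem he))
    simp only [Function.comp_def] at ih
    have ha := h a (by simp)
    by_cases h1 : p (f a)
    · by_cases h2 : q a
      · simp [Multiset.filter_cons, h1, h2]; omega
      · simp [Multiset.filter_cons, h1, h2]; omega
    · have : ¬ q a := fun h' => h1 (ha h')
      simp [Multiset.filter_cons, h1, this]; omega

theorem card_contr {P : Multiset (Sym2 V)} (hP : LL P) {X : Finset V} {u : V} (hu : u ∈ X) :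
    P.card ≤ (contr X u P).card + (ind P X).card := by
  unfold contr ind
  have : P.card = (P.filter (fun e => ∀ v ∈ e, v ∈ X)).card
      + (P.filter (fun e => ¬ ∀ v ∈ e, v ∈ X)).card := by
    rw [← Multiset.card_add, Multiset.filter_add_not]
  have h2 := le_card_filter_map (Sym2.map (cmap X u)) P (fun e => ¬ e.IsDiag)
    (fun e => ¬ ∀ v ∈ e, v ∈ X) (by
      intro e he
      have hne := hP e he
      induction e using Sym2.ind with
      | _ a b =>
        simp only [Sym2.map_mk, Sym2.isDiag_iff_proj_eq, Sym2.mem_iff, cmap] at hne ⊢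
        intro h h'
        apply h
        by_cases ha : a ∈ X <;> by_cases hb : b ∈ X <;> simp [ha, hb] at h'
        · rintro v (rfl | rfl) <;> assumption
        · exact absurd (h' ▸ hu) hb
        · exact absurd (h' ▸ hu) ha
        · exact absurd h' hne)
  omega

theorem contr_deg {P : Multiset (Sym2 V)} (hP : LL P) {X : Finset V} {u x : V} (hu : u ∈ X)
    (hx : x ∉ X) : degIn P x ≤ degIn (contr X u P) x := by
  unfold contr degIn
  rw [Multiset.filter_filter]
  apply le_card_filter_map
  intro e he hxe
  have hne := hP e he
  induction e using Sym2.ind with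
  | _ a b =>
    simp only [Sym2.map_mk, Sym2.isDiag_iff_proj_eq, Sym2.mem_iff, cmap] at hne hxe ⊢
    rcases hxe with rfl | rfl
    · simp only [hx, if_false, true_or, true_and]
      split_ifs with h
      · rintro rfl; exact hx hu
      · exact hne
    · simp only [hx, if_false, or_true, true_and]
      split_ifs with h
      · rintro rfl; exact hx hu
      · exact hne

theorem contr_within {P : Multiset (Sym2 V)} {S X : Finset V} {u : V}
    (h : Within (S : Set V) P) : Within ((insert u (S \ X) : Finset V) : Set V) (contr X u P) := by
  intro e he v hv
  obtain ⟨f, hf, rfl⟩ := Multiset.mem_map.1 (Multiset.mem_filter.1 he).1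
  obtain ⟨a, ha, rfl⟩ := Sym2.mem_map.1 hv
  have := h f hf a ha
  simp only [Finset.coe_insert, Set.mem_insert_iff, Finset.mem_coe, Finset.mem_sdiff, cmap] at *
  split_ifs with h1
  · simp
  · right; exact ⟨this, h1⟩

theorem ind_contr {P : Multiset (Sym2 V)} {X Y : Finset V} {u : V} (hu : u ∉ Y) :
    (ind (contr X u P) Y).card ≤ (ind P Y).card := by
  unfold contr ind
  rw [Multiset.filter_filter]
  apply card_filter_map_le
  intro e he h v hv
  have := h.1 _ (Sym2.mem_map.2 ⟨v, hv, rfl⟩)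
  unfold cmap at this
  split_ifs at this with h1
  · exact absurd this hu
  · exact this

theorem ind_pi {E : Multiset (Sym2 V)} {u v z w : V} {X : Finset V} (hv : v ∉ X) :
    (ind (piE u v z w E) X).card ≤ (ind E (insert z X)).card := by
  unfold piE ind
  rw [Multiset.filter_cons_of_neg _ (by simp [hv])]
  refine (card_filter_map_le _ _ _ (fun e => ∀ v ∈ e, v ∈ insert z X) ?_).trans
    (Multiset.card_le_card (Multiset.filter_le_filter _ (Multiset.sub_le_self _ _)))
  intro e he h v hv
  have := h _ (Sym2.mem_map.2 ⟨v, hv, rfl⟩)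
  unfold pmap at this
  split_ifs at this with h1 h2
  · simp [h1]
  · contradiction
  · simp [this]

theorem ind_pi' {E : Multiset (Sym2 V)} {u v z w : V} {X : Finset V} (hv : u ∉ X) :
    (ind (piE u v z w E) X).card ≤ (ind E (insert w X)).card := by
  unfold piE ind
  rw [Multiset.filter_cons_of_neg _ (by simp [hv])]
  refine (card_filter_map_le _ _ _ (fun e => ∀ v ∈ e, v ∈ insert w X) ?_).trans
    (Multiset.card_le_card (Multiset.filter_le_filter _ (Multiset.sub_le_self _ _)))
  intro e he h v hv
  have := h _ (Sym2.mem_map.2 ⟨v, hv, rfl⟩)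
  unfold pmap at this
  split_ifs at this with h1 h2
  · contradiction
  · simp [h2]
  · simp [this]

theorem pi_deg {E : Multiset (Sym2 V)} {u v z w x : V} (hC : C4 u v z w ≤ E) (h1 : x ≠ u)
    (h2 : x ≠ v) (h3 : x ≠ z) (h4 : x ≠ w) : degIn E x ≤ degIn (piE u v z w E) x := by
  have : degIn E x = degIn (E - C4 u v z w) x := by
    conv_lhs => rw [← Multiset.sub_add_cancel hC]
    rw [degIn_add, degIn_eq_zero_of_notMem (E := C4 u v z w)]
    · simp
    · intro e he
      simp [C4] at he
      rcases he with rfl | rfl | rfl | rfl <;> simp [h1, h2, h3, h4]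
  rw [this]
  refine le_trans ?_ (degIn_mono (Multiset.le_cons_self _ _) x)
  unfold degIn
  apply le_card_filter_map
  intro e he hx
  exact Sym2.mem_map.2 ⟨x, hx, by simp [pmap, h3, h4]⟩

theorem pi_within {E : Multiset (Sym2 V)} {S : Finset V} {u v z w : V} (hd : D4 u v z w)
    (hu : u ∈ S) (hv : v ∈ S) (h : Within (S : Set V) E) :
    Within ((S \ {z, w} : Finset V) : Set V) (piE u v z w E) := by
  obtain ⟨d1, d2, d3, d4, d5, d6⟩ := hd
  intro e he x hx
  rcases Multiset.mem_cons.1 he with rfl | he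
  · simp at hx
    rcases hx with rfl | rfl <;> simp [hu, hv, d2, d3, d4, d5]
  obtain ⟨f, hf, rfl⟩ := Multiset.mem_map.1 he
  obtain ⟨a, ha, rfl⟩ := Sym2.mem_map.1 hx
  have := h f (Multiset.mem_of_le (Multiset.sub_le_self _ _) hf) a ha
  unfold pmap
  split_ifs with h1 h2
  · simp [hu, d2, d3]
  · simp [hv, d4, d5]
  · simp at this; simp [this, h1, h2]

theorem card_pi {E : Multiset (Sym2 V)} {u v z w : V} (hC : C4 u v z w ≤ E) :
    (piE u v z w E).card + 3 = E.card := by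
  have := Multiset.card_le_card hC
  have h2 : (C4 u v z w).card = 4 := by simp [C4]
  simp [piE, Multiset.card_sub hC]
  omega

end RG

namespace RG
variable {V : Type}

theorem mem_ind {E : Multiset (Sym2 V)} {L : Finset V} {e : Sym2 V} :
    e ∈ ind E L ↔ e ∈ E ∧ ∀ v ∈ e, v ∈ L := Multiset.mem_filter

theorem pair_bound {n : ℕ} (h : HA V n) {E : Multiset (Sym2 V)} (hE : LL E) (hr : RedE E)
    {A : Finset V} {u z : V} (hA : A.card < n) (hu : u ∈ A) (hz : z ∈ A) (huz : u ≠ z)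
    (hs : s(u, z) ∉ E) : (A = {u, z} ∧ ind E A = 0) ∨ (3 ≤ A.card ∧ (ind E A).card + 4 ≤ 2 * A.card) := by
  have hsub : ({u, z} : Finset V) ⊆ A := by
    intro x hx; simp at hx; rcases hx with rfl | rfl <;> assumption
  have hc2 : ({u, z} : Finset V).card = 2 := Finset.card_pair huz
  by_cases h3 : 3 ≤ A.card
  · exact Or.inr ⟨h3, h.ind_bound hE hr hA h3⟩
  · have hAe : A = {u, z} := (Finset.eq_of_subset_of_card_le hsub (by omega)).symm
    refine Or.inl ⟨hAe, ?_⟩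
    rw [hAe]
    apply Multiset.eq_zero_of_forall_notMem
    intro e he
    obtain ⟨he1, he2⟩ := Multiset.mem_filter.1 he
    have hne := hE e he1
    induction e using Sym2.ind with
    | _ a b =>
      have ha := he2 a (by simp)
      have hb := he2 b (by simp)
      simp at ha hb hne
      rcases ha with rfl | rfl <;> rcases hb with rfl | rfl
      · exact hne rfl
      · exact hs he1
      · exact hs (by rwa [Sym2.eq_swap] at he1)
      · exact hne rfl

theorem pair_bound' {n : ℕ} (h : HA V n) {E : Multiset (Sym2 V)} (hE : LL E) (hr : RedE E)
    {A : Finset V} {u z : V} (hA : A.card < n) (hu : u ∈ A) (hz : z ∈ A) (huz : u ≠ z)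
    (hs : s(u, z) ∉ E) : (ind E A).card + 4 ≤ 2 * A.card := by
  rcases pair_bound h hE hr hA hu hz huz hs with ⟨h1, h2⟩ | h
  · rw [h2, h1, Finset.card_pair huz]; simp
  · exact h.2

theorem finA {n : ℕ} (h : HA V n) {E : Multiset (Sym2 V)} (hE : LL E) (hr : RedE E)
    {A : Finset V} {u z : V} (hA : A.card < n) (hu : u ∈ A) (hz : z ∈ A) (huz : u ≠ z)
    (hs : s(u, z) ∉ E) (C : Multiset (Sym2 V))
    (hd : ∀ x ∈ A, degIn E x ≤ degIn (ind E A) x + degIn C x)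
    (hC : degIn C u ≤ 2) (hC0 : ∀ x ∈ A, x ≠ u → x ≠ z → degIn C x = 0)
    (hδ : ∀ x ∈ A, 3 ≤ degIn E x) : (ind E A).card + 5 ≤ 2 * A.card := by
  rcases pair_bound h hE hr hA hu hz huz hs with ⟨h1, h2⟩ | ⟨h3, h4⟩
  · have := hd u hu
    have h5 := hδ u hu
    rw [h2] at this
    simp [degIn] at this h5 hC
    omega
  · by_contra hcon
    have hk := h A (ind E A) hA (ind_within E A) (hE.anti (ind_le E A)) (hr.anti (ind_le E A)) h3
      (by omega)
    obtain ⟨x, hx, hxu, hxz, hx2⟩ := hk.low h3 u z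
    have := hd x hx
    have h5 := hδ x hx
    have := hC0 x hx hxu hxz
    omega

theorem lemPi [Fintype V] {E : Multiset (Sym2 V)} {S : Finset V} (hw : Within (S : Set V) E)
    (hE : LL E) (hr : RedE E) (hδ : ∀ x ∈ S, 3 ≤ degIn E x) (hcard : 2 * S.card ≤ E.card + 5)
    {u v z w : V} (hd : D4 u v z w) (hC : C4 u v z w ≤ E) (hA : HA V S.card) : False := by
  have hd' := hd
  obtain ⟨d1, d2, d3, d4, d5, d6⟩ := hd'
  have c1 : s(u, v) ∈ E := Multiset.mem_of_le hC (by simp [C4])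
  have c2 : s(v, z) ∈ E := Multiset.mem_of_le hC (by simp [C4])
  have c3 : s(z, w) ∈ E := Multiset.mem_of_le hC (by simp [C4])
  have c4 : s(w, u) ∈ E := Multiset.mem_of_le hC (by simp [C4])
  have huz : s(u, z) ∉ E := fun h => hr.no_triangle hE c1 c2 h
  have hvw : s(v, w) ∉ E := fun h => hr.no_triangle hE c2 c3 h
  have uS : u ∈ S := by exact_mod_cast hw _ c1 u (by simp)
  have vS : v ∈ S := by exact_mod_cast hw _ c1 v (by simp)
  have zS : z ∈ S := by exact_mod_cast hw _ c2 z (by simp)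
  have wS : w ∈ S := by exact_mod_cast hw _ c3 w (by simp)
  set P := piE u v z w E with hPdef
  set S' := S \ {z, w} with hS'
  have hPw : Within (S' : Set V) P := pi_within hd uS vS hw
  have hPL : LL P := piE_LL hE hd huz hvw
  have hPc : P.card + 3 = E.card := card_pi hC
  have hS'c : S'.card + 2 = S.card := by
    have h1 : ({z, w} : Finset V).card = 2 := Finset.card_pair d6
    have h2 : ({z, w} : Finset V) ⊆ S := by
      intro x hx; simp at hx; rcases hx with rfl | rfl <;> assumption
    have : S'.card + ({z, w} : Finset V).card = S.card := by
      rw [hS']; convert Finset.card_sdiff_add_card_eq_card h2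
    omega
  have uS' : u ∈ S' := by simp [hS', uS, d2, d3]
  have vS' : v ∈ S' := by simp [hS', vS, d4, d5]
  have zS' : z ∉ S' := by simp [hS']
  have wS' : w ∉ S' := by simp [hS']
  have no_both : ∀ T, Col P T → u ∈ T → v ∈ T → False := by
    intro T hT hu hv
    have h2 : 2 ≤ T.card := by
      have : ({u, v} : Finset V) ⊆ T := by
        intro x hx; simp at hx; rcases hx with rfl | rfl <;> assumption
      have h3 := Finset.card_le_card this
      rwa [Finset.card_pair d1] at h3
    have hTS := hT.subset_of_within h2 hPw
    have := hr _ (col_pi hE hd hC huz hvw hT hu hv (fun h => zS' (hTS h)) (fun h => wS' (hTS h)))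
    have := Finset.card_le_card (Finset.subset_union_left : T ⊆ T ∪ {z, w})
    omega
  obtain ⟨X, hXm, hXmax⟩ := Finset.exists_max_image
    (Finset.univ.filter (fun X => Col P X ∧ u ∈ X ∧ v ∉ X)) Finset.card
    ⟨{u}, by simpa [d1.symm] using col_single P u⟩
  obtain ⟨hXc, hXu, hXv⟩ : Col P X ∧ u ∈ X ∧ v ∉ X := by simpa using hXm
  have hXmax : ∀ T, Col P T → u ∈ T → v ∉ T → T.card ≤ X.card := fun T h1 h2 h3 =>
    hXmax T (by simp [h1, h2, h3])
  have sub1 : ∀ (T : Finset V) (a : V) (Q : Multiset (Sym2 V)) (R : Finset V), Col Q T → a ∈ T →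
      a ∈ R → Within (R : Set V) Q → T ⊆ R := by
    intro T a Q R hT ha haR hQ
    by_cases h2 : 2 ≤ T.card
    · exact hT.subset_of_within h2 hQ
    · have : T = {a} := (Finset.eq_of_subset_of_card_le (by simpa using ha) (by simp; omega)).symm
      rw [this]; simpa using haR
  have hXS : X ⊆ S' := sub1 X u P S' hXc hXu uS' hPw
  set P1 := contr X u P with hP1
  set S1 := insert u (S' \ X) with hS1
  have hP1L : LL P1 := contr_LL _ _ _
  have hP1w : Within (S1 : Set V) P1 := contr_within hPw
  have uS1 : u ∈ S1 := by simp [hS1]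
  have vS1 : v ∈ S1 := by simp [hS1, vS', hXv]
  obtain ⟨Y, hYm, hYmax⟩ := Finset.exists_max_image
    (Finset.univ.filter (fun X => Col P1 X ∧ v ∈ X ∧ u ∉ X)) Finset.card
    ⟨{v}, by simpa [d1] using col_single P1 v⟩
  obtain ⟨hYc, hYv, hYu⟩ : Col P1 Y ∧ v ∈ Y ∧ u ∉ Y := by simpa using hYm
  have hYmax : ∀ T, Col P1 T → v ∈ T → u ∉ T → T.card ≤ Y.card := fun T h1 h2 h3 =>
    hYmax T (by simp [h1, h2, h3])
  have hYS : Y ⊆ S1 := sub1 Y v P1 S1 hYc hYv vS1 hP1w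
  set P2 := contr Y v P1 with hP2
  set S2 := insert v (S1 \ Y) with hS2
  have hP2L : LL P2 := contr_LL _ _ _
  have hP2w : Within (S2 : Set V) P2 := contr_within hP1w
  have hred : RedE P2 := by
    intro T hT
    by_contra hcard
    have hTS : T ⊆ S2 := hT.subset_of_within (by omega) hP2w
    by_cases hvT : v ∈ T
    · have hc : Col P1 (T ∪ Y) := col_contr hP1L hYv hYc hT hvT (by
        intro a ha haY
        have := hTS ha
        simp [hS2, haY] at this
        exact this)
      have hTY : T ∪ Y ⊆ S1 := sub1 _ v P1 S1 hc (by simp [hvT]) vS1 hP1w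
      by_cases huT : u ∈ T
      · have := col_contr hPL hXu hXc hc (by simp [huT]) (by
          intro a ha haX
          have := hTY ha
          simp [hS1, haX] at this
          exact this)
        exact no_both _ this (by simp [huT]) (by simp [hvT])
      · have h1 := hYmax _ hc (by simp [hvT]) (by simp [huT, hYu])
        have h2 := Finset.eq_of_subset_of_card_le (Finset.subset_union_right : Y ⊆ T ∪ Y) h1
        have h3 : T ⊆ {v} := by
          intro a ha
          have h4 : a ∈ Y := by rw [h2]; simp [ha]
          have := hTS ha
          simp [hS2, h4] at this
          simpa using this
        have := Finset.card_le_card h3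
        simp at this
        omega
    · have hc : Col P1 T := by
        refine col_unaffected (φ := cmap Y v) (P := P2) ?_ ?_ hT
        · intro F hF _
          exact hF.trans (Multiset.filter_le _ _)
        · intro a ha
          unfold cmap at ha ⊢
          split_ifs at ha ⊢ with h
          · exact absurd ha hvT
          · rfl
      by_cases huT : u ∈ T
      · have hTS1 : T ⊆ S1 := sub1 _ u P1 S1 hc huT uS1 hP1w
        have hTX : ∀ a ∈ T, a ∈ X → a = u := by
          intro a ha haX
          have := hTS1 ha
          simp [hS1, haX] at this
          exact this
        have h1 := hXmax _ (col_contr hPL hXu hXc hc huT hTX) (by simp [huT]) (by simp [hvT, hXv])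
        have h2 := Finset.eq_of_subset_of_card_le (Finset.subset_union_right : X ⊆ T ∪ X) h1
        have h3 : T ⊆ {u} := by
          intro a ha
          have h4 : a ∈ X := by rw [h2]; simp [ha]
          simpa using hTX a ha h4
        have := Finset.card_le_card h3
        simp at this
        omega
      · have hc2 : Col P T := by
          refine col_unaffected (φ := cmap X u) (P := P1) ?_ ?_ hc
          · intro F hF _
            exact hF.trans (Multiset.filter_le _ _)
          · intro a ha
            unfold cmap at ha ⊢
            split_ifs at ha ⊢ with h
            · exact absurd ha huT
            · rfl
        have hc3 : Col (E - C4 u v z w) T := by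
          refine col_unaffected (φ := pmap u v z w) (P := P) ?_ ?_ hc2
          · intro F hF hFw
            rw [hPdef, piE] at hF
            refine (Multiset.le_cons_of_notMem ?_).1 hF
            intro hmem
            exact huT (by exact_mod_cast hFw _ hmem u (by simp))
          · intro a ha
            unfold pmap at ha ⊢
            split_ifs at ha ⊢ with h h'
            · exact absurd ha huT
            · exact absurd ha hvT
            · rfl
        have := hr T (hc3.mono (Multiset.sub_le_self _ _))
        omega
  -- counting
  have hS1c : S1.card + X.card = S'.card + 1 := by
    have h1 : u ∉ S' \ X := by simp [hXu]
    rw [hS1, Finset.card_insert_of_notMem h1]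
    have := Finset.card_sdiff_add_card_eq_card hXS
    omega
  have hS2c : S2.card + Y.card = S1.card + 1 := by
    have h1 : v ∉ S1 \ Y := by simp [hYv]
    rw [hS2, Finset.card_insert_of_notMem h1]
    have := Finset.card_sdiff_add_card_eq_card hYS
    omega
  have hYS' : Y ⊆ S' := by
    intro a ha
    have := hYS ha
    simp only [hS1, Finset.mem_insert, Finset.mem_sdiff] at this
    rcases this with rfl | h
    · exact uS'
    · exact h.1
  have hXY : ∀ a ∈ X, a ∉ Y := by
    intro a ha haY
    have := hYS haY
    simp only [hS1, Finset.mem_insert, Finset.mem_sdiff] at this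
    rcases this with rfl | h
    · exact hYu haY
    · exact h.2 ha
  have zX : z ∉ X := fun h => zS' (hXS h)
  have wX : w ∉ X := fun h => wS' (hXS h)
  have zY : z ∉ Y := fun h => zS' (hYS' h)
  have wY : w ∉ Y := fun h => wS' (hYS' h)
  set A := insert z X with hAdef
  set B := insert w Y with hBdef
  have hAc : A.card = X.card + 1 := Finset.card_insert_of_notMem zX
  have hBc : B.card = Y.card + 1 := Finset.card_insert_of_notMem wY
  have uA : u ∈ A := by simp [hAdef, hXu]
  have zA : z ∈ A := by simp [hAdef]
  have vA : v ∉ A := by simp [hAdef, hXv, d4]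
  have wA : w ∉ A := by simp [hAdef, wX, d6.symm]
  have vB : v ∈ B := by simp [hBdef, hYv]
  have wB : w ∈ B := by simp [hBdef]
  have uB : u ∉ B := by simp [hBdef, hYu, d3]
  have zB : z ∉ B := by simp [hBdef, zY, d6]
  have hAB : ∀ a ∈ A, a ∉ B := by
    intro a ha
    simp only [hAdef, Finset.mem_insert] at ha
    rcases ha with rfl | ha
    · exact zB
    · simp only [hBdef, Finset.mem_insert, not_or]
      exact ⟨by rintro rfl; exact wX ha, hXY a ha⟩
  have hAS : A ⊆ S := by
    intro a ha
    simp only [hAdef, Finset.mem_insert] at ha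
    rcases ha with rfl | ha
    · exact zS
    · exact (Finset.mem_sdiff.1 (hXS ha)).1
  have hBS : B ⊆ S := by
    intro a ha
    simp only [hBdef, Finset.mem_insert] at ha
    rcases ha with rfl | ha
    · exact wS
    · exact (Finset.mem_sdiff.1 (hYS' ha)).1
  have hAlt : A.card < S.card := Finset.card_lt_card ⟨hAS, fun h => vA (h vS)⟩
  have hBlt : B.card < S.card := Finset.card_lt_card ⟨hBS, fun h => uB (h uS)⟩
  have eA := pair_bound' hA hE hr hAlt uA zA d2 huz
  have eB := pair_bound' hA hE hr hBlt vB wB d5 hvw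
  have k1 := card_contr hPL hXu
  have k2 := card_contr hP1L hYv
  have k3 : (ind P X).card ≤ (ind E A).card := ind_pi hXv
  have k4 : (ind P1 Y).card ≤ (ind E B).card := (ind_contr hYu).trans (ind_pi' hYu)
  rw [← hP1] at k1
  rw [← hP2] at k2
  have uS2 : u ∈ S2 := by simp [hS2, uS1, hYu]
  have vS2 : v ∈ S2 := by simp [hS2]
  by_cases h3 : 3 ≤ S2.card
  · have hX1 : 1 ≤ X.card := Finset.card_pos.2 ⟨u, hXu⟩
    have hY1 : 1 ≤ Y.card := Finset.card_pos.2 ⟨v, hYv⟩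
    have hk := hA S2 P2 (by omega) hP2w hP2L hred h3 (by omega)
    obtain ⟨x, hx, hxu, hxv, hx2⟩ := hk.low h3 u v
    have hx' : x ∈ S' ∧ x ∉ X ∧ x ∉ Y := by
      simp only [hS2, hS1, Finset.mem_insert, Finset.mem_sdiff, hxu, hxv, false_or] at hx
      exact ⟨hx.1.1, hx.1.2, hx.2⟩
    obtain ⟨q1, q2, q3⟩ := hx'
    have t1 := contr_deg hPL hXu q2
    have t2 := contr_deg hP1L hYv q3
    have t3 := pi_deg hC hxu hxv (fun h => zS' (h ▸ q1)) (fun h => wS' (h ▸ q1))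
    have t4 := hδ x (Finset.mem_sdiff.1 q1).1
    rw [← hPdef] at t3
    rw [← hP1] at t1
    rw [← hP2] at t2
    omega
  · have hS2e : S2 = {u, v} := by
      refine (Finset.eq_of_subset_of_card_le ?_ ?_).symm
      · intro x hx; simp at hx; rcases hx with rfl | rfl <;> assumption
      · rw [Finset.card_pair d1]; omega
    have hS22 : S2.card = 2 := by rw [hS2e, Finset.card_pair d1]
    have hP2c : P2.card ≤ 1 := by
      have hle : P2 ≤ {s(u, v)} := by
        rw [Multiset.le_iff_subset (hred.nodup hP2L)]
        intro e he
        have hne := hP2L e he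
        have hwi := hP2w e he
        rw [hS2e] at hwi
        induction e using Sym2.ind with
        | _ a b =>
          have ha := hwi a (by simp)
          have hb := hwi b (by simp)
          simp at ha hb hne
          rcases ha with rfl | rfl <;> rcases hb with rfl | rfl
          · exact absurd rfl hne
          · simp
          · simp [Sym2.eq_swap]
          · exact absurd rfl hne
      simpa using Multiset.card_le_card hle
    have hsum : ind E A + ind E B ≤ E := by
      refine split_le (fun e => ∀ a ∈ e, a ∈ A) (ind_le _ _) (ind_le _ _)
        (fun e he => (mem_ind.1 he).2) ?_
      intro e he hcon
      have := (mem_ind.1 he).2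
      induction e using Sym2.ind with
      | _ a b => exact hAB a (hcon a (by simp)) (this a (by simp))
    have hsum2 : C4 u v z w + (ind E A + ind E B) ≤ E := by
      refine split_le (fun e => e ∈ C4 u v z w) hC hsum (fun e he => he) ?_
      intro e he hcon
      simp only [C4, Multiset.insert_eq_cons, Multiset.mem_cons, Multiset.mem_singleton] at hcon
      rcases Multiset.mem_add.1 he with he | he
      · have := (mem_ind.1 he).2
        rcases hcon with rfl | rfl | rfl | rfl
        · exact vA (this v (by simp))
        · exact vA (this v (by simp))
        · exact wA (this w (by simp))
        · exact wA (this w (by simp))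
      · have := (mem_ind.1 he).2
        rcases hcon with rfl | rfl | rfl | rfl
        · exact uB (this u (by simp))
        · exact zB (this z (by simp))
        · exact zB (this z (by simp))
        · exact uB (this u (by simp))
    have hC4c : (C4 u v z w).card = 4 := by simp [C4]
    have hEq : C4 u v z w + (ind E A + ind E B) = E := by
      refine Multiset.eq_of_le_of_card_le hsum2 ?_
      simp only [Multiset.card_add]
      omega
    have hEc := congrArg Multiset.card hEq
    simp only [Multiset.card_add] at hEc
    have hdegA : ∀ x, x ∉ A → degIn (ind E A) x = 0 := fun x hx =>
      degIn_eq_zero_of_notMem (fun e he hxe => hx ((mem_ind.1 he).2 x hxe))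
    have hdegB : ∀ x, x ∉ B → degIn (ind E B) x = 0 := fun x hx =>
      degIn_eq_zero_of_notMem (fun e he hxe => hx ((mem_ind.1 he).2 x hxe))
    have hdE : ∀ x, degIn E x = degIn (C4 u v z w) x + (degIn (ind E A) x + degIn (ind E B) x) := by
      intro x
      conv_lhs => rw [← hEq]
      rw [degIn_add, degIn_add]
    have hC0 : ∀ x, x ≠ u → x ≠ v → x ≠ z → x ≠ w → degIn (C4 u v z w) x = 0 := by
      intro x h1 h2 h3 h4
      apply degIn_eq_zero_of_notMem
      intro e he
      simp [C4] at he
      rcases he with rfl | rfl | rfl | rfl <;> simp [h1, h2, h3, h4]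
    have f1 := finA hA hE hr hAlt uA zA d2 huz (C4 u v z w)
      (by intro x hx; have := hdE x; have := hdegB x (hAB x hx); omega)
      (by simp [degIn, C4, Multiset.filter_cons, Multiset.filter_singleton, d1, d2, d3])
      (by intro x hx h1 h2; exact hC0 x h1 (fun h => vA (h ▸ hx)) h2 (fun h => wA (h ▸ hx)))
      (fun x hx => hδ x (hAS hx))
    have f2 := finA hA hE hr hBlt vB wB d5 hvw (C4 u v z w)
      (by intro x hx; have := hdE x; have := hdegA x (fun h => hAB x h hx); omega)
      (by simp [degIn, C4, Multiset.filter_cons, Multiset.filter_singleton, d1.symm, d4, d5])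
      (by intro x hx h1 h2; exact hC0 x (fun h => uB (h ▸ hx)) h1 (fun h => zB (h ▸ hx)) h2)
      (fun x hx => hδ x (hBS hx))
    omega

end RG

namespace RG
variable {V : Type}

/-- potentials constant along the edges of `A` -/
def KK (A : Finset (Sym2 V)) : Submodule (ZMod 2) (V → ZMod 2) where
  carrier := {g | ∀ a b, s(a, b) ∈ A → g a = g b}
  add_mem' := by
    intro f g hf hg a b h
    simp [hf a b h, hg a b h]
  zero_mem' := by intro a b h; rfl
  smul_mem' := by
    intro c f hf a b h
    simp [hf a b h]

theorem mem_KK {A : Finset (Sym2 V)} {g : V → ZMod 2} :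
    g ∈ KK A ↔ ∀ a b, s(a, b) ∈ A → g a = g b := Iff.rfl

noncomputable def kk (A : Finset (Sym2 V)) : ℕ := Module.finrank (ZMod 2) (KK A)

theorem KK_anti {A B : Finset (Sym2 V)} (h : A ⊆ B) : KK B ≤ KK A :=
  fun _ hg a b hab => hg a b (h hab)

variable [Fintype V]

theorem kk_le_of {A B : Finset (Sym2 V)} (h : KK B ≤ KK A) : kk B ≤ kk A :=
  Submodule.finrank_mono h

theorem kk_anti {A B : Finset (Sym2 V)} (h : A ⊆ B) : kk B ≤ kk A := kk_le_of (KK_anti h)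

theorem kk_empty : kk (∅ : Finset (Sym2 V)) = Fintype.card V := by
  have : KK (∅ : Finset (Sym2 V)) = ⊤ := by
    rw [eq_top_iff]; intro g _ a b h; simp at h
  rw [kk, this, finrank_top, Module.finrank_pi]

theorem kk_submod (A B : Finset (Sym2 V)) : kk A + kk B ≤ kk (A ∪ B) + kk (A ∩ B) := by
  have h1 := Submodule.finrank_sup_add_finrank_inf_eq (KK A) (KK B)
  have h2 : KK A ⊓ KK B ≤ KK (A ∪ B) := by
    rintro g ⟨ha, hb⟩ a b h
    rcases Finset.mem_union.1 h with h | h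
    · exact ha a b h
    · exact hb a b h
  have h3 : KK A ⊔ KK B ≤ KK (A ∩ B) :=
    sup_le (KK_anti Finset.inter_subset_left) (KK_anti Finset.inter_subset_right)
  have h4 := Submodule.finrank_mono h2
  have h5 := Submodule.finrank_mono h3
  unfold kk
  omega

theorem kk_single (e : Sym2 V) : Fintype.card V ≤ kk {e} + 1 := by
  induction e using Sym2.ind with
  | _ a b =>
    let f : (V → ZMod 2) →ₗ[ZMod 2] ZMod 2 :=
      LinearMap.proj (R := ZMod 2) (φ := fun _ : V => ZMod 2) a - LinearMap.proj b
    have h1 := LinearMap.finrank_range_add_finrank_ker f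
    have h2 : LinearMap.ker f ≤ KK {s(a, b)} := by
      intro g hg c d hcd
      have hg : g a = g b := by
        have : g a - g b = 0 := by simpa [f] using hg
        exact sub_eq_zero.1 this
      simp only [Finset.mem_singleton, Sym2.eq_iff] at hcd
      rcases hcd with ⟨rfl, rfl⟩ | ⟨rfl, rfl⟩
      · exact hg
      · exact hg.symm
    have h3 := Submodule.finrank_mono h2
    have h4 : Module.finrank (ZMod 2) (LinearMap.range f) ≤ 1 := by
      have := Submodule.finrank_le (LinearMap.range f)
      simpa using this
    rw [Module.finrank_pi] at h1
    unfold kk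
    omega

theorem kk_card (A : Finset (Sym2 V)) : Fintype.card V ≤ kk A + A.card := by
  induction A using Finset.induction_on with
  | empty => simp [kk_empty]
  | insert e A he ih =>
    rw [Finset.card_insert_of_notMem he]
    have h1 := kk_submod {e} A
    have h2 := kk_single e
    have h3 : kk ({e} ∩ A) ≤ Fintype.card V := by
      rw [← kk_empty]; exact kk_anti (by simp)
    rw [← Finset.insert_eq] at h1
    omega

/-- upper bound for the corank -/
theorem kk_le_card {A : Finset (Sym2 V)} (Z : Finset V)
    (h : ∀ g ∈ KK A, (∀ z ∈ Z, g z = 0) → g = 0) : kk A ≤ Z.card := by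
  let f : KK A →ₗ[ZMod 2] (Z → ZMod 2) :=
    { toFun := fun g z => g.1 z
      map_add' := by intros; rfl
      map_smul' := by intros; rfl }
  have hf : Function.Injective f := by
    rw [injective_iff_map_eq_zero]
    intro g hg
    apply Subtype.ext
    refine h g.1 g.2 fun z hz => ?_
    exact congrFun hg ⟨z, hz⟩
  have := LinearMap.finrank_le_finrank_of_injective hf
  rw [Module.finrank_pi, Fintype.card_coe] at this
  exact this

theorem matroid_union (U : Finset (Sym2 V)) : ∀ I1 I2 : Finset (Sym2 V), Disjoint U I1 →
    Disjoint U I2 →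
    (∀ A ⊆ U, A.card + I1.card + I2.card + kk (A ∪ I1) + kk (A ∪ I2) ≤ 2 * Fintype.card V) →
    ∃ U1 U2, U1 ∪ U2 = U ∧ Disjoint U1 U2 ∧ (I1 ∪ U1).card + kk (I1 ∪ U1) ≤ Fintype.card V ∧
      (I2 ∪ U2).card + kk (I2 ∪ U2) ≤ Fintype.card V := by
  induction U using Finset.induction_on with
  | empty =>
    intro I1 I2 _ _ h
    have h0 := h ∅ (by simp)
    have h1 := kk_card I1
    have h2 := kk_card I2
    simp at h0
    exact ⟨∅, ∅, by simp, by simp, by simp; omega, by simp; omega⟩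
  | insert e U he ih =>
    intro I1 I2 hd1 hd2 h
    rw [Finset.disjoint_insert_left] at hd1 hd2
    by_cases c1 : ∀ A ⊆ U, A.card + (insert e I1).card + I2.card + kk (A ∪ insert e I1) + kk (A ∪ I2)
        ≤ 2 * Fintype.card V
    · obtain ⟨U1, U2, h1, h2, h3, h4⟩ := ih (insert e I1) I2
        (by rw [Finset.disjoint_insert_right]; exact ⟨he, hd1.2⟩) hd2.2 c1
      have e2 : e ∉ U2 := fun hh => he (by rw [← h1]; simp [hh])
      refine ⟨insert e U1, U2, by rw [Finset.insert_union, h1], ?_, ?_, h4⟩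
      · rw [Finset.disjoint_insert_left]; exact ⟨e2, h2⟩
      · rwa [Finset.union_insert, ← Finset.insert_union]
    by_cases c2 : ∀ A ⊆ U, A.card + I1.card + (insert e I2).card + kk (A ∪ I1) + kk (A ∪ insert e I2)
        ≤ 2 * Fintype.card V
    · obtain ⟨U1, U2, h1, h2, h3, h4⟩ := ih I1 (insert e I2) hd1.2
        (by rw [Finset.disjoint_insert_right]; exact ⟨he, hd2.2⟩) c2
      have e2 : e ∉ U1 := fun hh => he (by rw [← h1]; simp [hh])
      refine ⟨U1, insert e U2, by rw [Finset.union_insert, h1], ?_, h3, ?_⟩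
      · rw [Finset.disjoint_insert_right]; exact ⟨e2, h2⟩
      · rwa [Finset.union_insert, ← Finset.insert_union]
    exfalso
    push Not at c1 c2
    obtain ⟨A, hA, c1⟩ := c1
    obtain ⟨B, hB, c2⟩ := c2
    rw [Finset.card_insert_of_notMem hd1.1] at c1
    rw [Finset.card_insert_of_notMem hd2.1] at c2
    have eA : e ∉ A := fun hh => he (hA hh)
    have eB : e ∉ B := fun hh => he (hB hh)
    have s1 := kk_submod (A ∪ insert e I1) (B ∪ I1)
    have s2 := kk_submod (A ∪ I2) (B ∪ insert e I2)
    have t1 := h (insert e (A ∪ B)) (Finset.insert_subset_insert _ (Finset.union_subset hA hB))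
    have t2 := h (A ∩ B) (Finset.inter_subset_left.trans (hA.trans (Finset.subset_insert _ _)))
    have eAB : e ∉ A ∪ B := by simp [eA, eB]
    rw [Finset.card_insert_of_notMem eAB] at t1
    have hc := Finset.card_union_add_card_inter A B
    have q1 : (A ∪ insert e I1) ∪ (B ∪ I1) = insert e (A ∪ B) ∪ I1 := by ext x; simp; tauto
    have q2 : (A ∪ I2) ∪ (B ∪ insert e I2) = insert e (A ∪ B) ∪ I2 := by ext x; simp; tauto
    have q3 : kk ((A ∪ insert e I1) ∩ (B ∪ I1)) ≤ kk ((A ∩ B) ∪ I1) :=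
      kk_anti (by intro x; simp; tauto)
    have q4 : kk ((A ∪ I2) ∩ (B ∪ insert e I2)) ≤ kk ((A ∩ B) ∪ I2) :=
      kk_anti (by intro x; simp; tauto)
    rw [q1] at s1
    rw [q2] at s2
    omega

/-- lower bound for the corank from two stars -/
theorem kk_two {T : Finset (Sym2 V)} {C D : Finset V} {a b : V} (ha : a ∈ C) (hb : b ∈ D)
    (hT : ∀ x y, s(x, y) ∈ T → (x ∈ C ∧ y ∈ C) ∨ (x ∈ D ∧ y ∈ D)) :
    Fintype.card V + 2 ≤ kk T + C.card + D.card := by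
  have h1 := kk_card ((C.erase a).image (fun y => s(a, y)) ∪ (D.erase b).image (fun y => s(b, y)))
  have h2 : kk ((C.erase a).image (fun y => s(a, y)) ∪ (D.erase b).image (fun y => s(b, y))) ≤ kk T := by
    apply kk_le_of
    intro g hg
    have hC : ∀ y ∈ C, g a = g y := by
      intro y hy
      by_cases hya : y = a
      · rw [hya]
      · exact hg a y (by simp only [Finset.mem_union, Finset.mem_image]; exact Or.inl ⟨y, by simp [hya, hy], rfl⟩)
    have hD : ∀ y ∈ D, g b = g y := by
      intro y hy
      by_cases hya : y = b
      · rw [hya]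
      · exact hg b y (by simp only [Finset.mem_union, Finset.mem_image]; exact Or.inr ⟨y, by simp [hya, hy], rfl⟩)
    intro x y hxy
    rcases hT x y hxy with ⟨h, h'⟩ | ⟨h, h'⟩
    · rw [← hC x h, ← hC y h']
    · rw [← hD x h, ← hD y h']
  have h3 := Finset.card_union_le ((C.erase a).image (fun y => s(a, y))) ((D.erase b).image (fun y => s(b, y)))
  have h4 : ((C.erase a).image (fun y => s(a, y))).card ≤ (C.erase a).card := Finset.card_image_le
  have h5 : ((D.erase b).image (fun y => s(b, y))).card ≤ (D.erase b).card := Finset.card_image_le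
  have h6 := Finset.card_erase_add_one ha
  have h7 := Finset.card_erase_add_one hb
  omega

theorem kk_one {T : Finset (Sym2 V)} {C : Finset V} (hC : C.Nonempty)
    (hT : ∀ x y, s(x, y) ∈ T → x ∈ C ∧ y ∈ C) :
    Fintype.card V + 1 ≤ kk T + C.card := by
  obtain ⟨a, ha⟩ := hC
  have := kk_two (T := T) (C := C) (D := {a}) ha (Finset.mem_singleton_self a)
    (fun x y h => Or.inl (hT x y h))
  simp at this
  omega

theorem kk_conn {T : Finset (Sym2 V)} {C : Finset V}
    (hT : ∀ x y, s(x, y) ∈ T → x ∈ C ∧ y ∈ C) (hk : kk T + C.card ≤ Fintype.card V + 1) :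
    ∀ a ∈ C, ∀ b ∈ C, Rch T.val a b := by
  intro a ha b hb
  by_contra hab
  have := kk_two (T := T) (C := C.filter (fun x => Rch T.val a x))
    (D := C.filter (fun x => ¬ Rch T.val a x)) (a := a) (b := b) (by simp [ha, Rch.rfl'])
    (by simp [hb, hab]) (by
      intro x y hxy
      obtain ⟨hx, hy⟩ := hT x y hxy
      have he : Rch T.val x y := Rch.edge hxy
      by_cases h : Rch T.val a x
      · left; simp [hx, hy, h, h.trans he]
      · right
        have : ¬ Rch T.val a y := fun h' => h (h'.trans he.symm)
        simp [hx, hy, h, this])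
  have h2 := Finset.card_filter_add_card_filter_not (s := C) (fun x => Rch T.val a x)
  omega

end RG

namespace RG
variable {V : Type}

/-- indicator in `ZMod 2` -/
noncomputable def dl (a x : V) : ZMod 2 := if x = a then 1 else 0

theorem zz (a : ZMod 2) : a + a = 0 := by revert a; decide

theorem par_sum (J : Finset (Sym2 V)) (x : V) :
    par J.val x = ∑ e ∈ J, if x ∈ e then (1 : ZMod 2) else 0 := by
  induction J using Finset.induction_on with
  | empty => simp
  | insert e J he ih =>
    rw [Finset.sum_insert he, Finset.insert_val_of_notMem he, par_cons, ih, par_single]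

theorem par_symm (J L : Finset (Sym2 V)) (x : V) :
    par (symmDiff J L).val x = par J.val x + par L.val x := by
  rw [par_sum, par_sum, par_sum]
  have h1 : symmDiff J L = (J \ L) ∪ (L \ J) := rfl
  rw [h1, Finset.sum_union (by
    rw [Finset.disjoint_left]; intro a; simp; tauto)]
  rw [← Finset.sum_inter_add_sum_sdiff J L, ← Finset.sum_inter_add_sum_sdiff L J, Finset.inter_comm L J]
  have := zz (∑ e ∈ J ∩ L, if x ∈ e then (1 : ZMod 2) else 0)
  linear_combination -this

theorem par_dl {a b : V} (h : a ≠ b) (x : V) : par ({s(a, b)} : Finset (Sym2 V)).val x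
    = dl a x + dl b x := by
  have := par_edge h x
  simpa [dl] using this

theorem symm_sub {J L T : Finset (Sym2 V)} (h1 : J ⊆ T) (h2 : L ⊆ T) : symmDiff J L ⊆ T := by
  intro x hx
  rcases Finset.mem_symmDiff.1 hx with h | h
  · exact h1 h.1
  · exact h2 h.1

theorem join_path {T : Finset (Sym2 V)} (hT : LL T.val) {a b : V} (h : Rch T.val a b) :
    ∃ J ⊆ T, ∀ x, par J.val x = dl a x + dl b x := by
  unfold Rch at h
  induction h with
  | refl => exact ⟨∅, by simp, fun x => by simp [zz]⟩
  | tail _ h2 ih =>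
    rename_i c d _
    obtain ⟨J, hJ, hp⟩ := ih
    have hne : c ≠ d := by simpa using hT _ h2
    refine ⟨symmDiff J {s(c, d)}, symm_sub hJ (by simpa using h2), fun x => ?_⟩
    rw [par_symm, hp, par_dl hne]
    linear_combination zz (dl c x)

theorem join {T : Finset (Sym2 V)} (hT : LL T.val) {N : Finset V}
    (hc : ∀ a ∈ N, ∀ b ∈ N, Rch T.val a b) {D : V → ZMod 2} (hD : ∀ x, x ∉ N → D x = 0)
    (hs : ∑ x ∈ N, D x = 0) : ∃ J ⊆ T, ∀ x, par J.val x = D x := by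
  rcases N.eq_empty_or_nonempty with rfl | ⟨n, hn⟩
  · exact ⟨∅, by simp, fun x => by simp [hD x (by simp)]⟩
  have key : ∀ M ⊆ N, ∃ J ⊆ T, ∀ x, par J.val x = ∑ a ∈ M, D a * (dl a x + dl n x) := by
    intro M
    induction M using Finset.induction_on with
    | empty => intro _; exact ⟨∅, by simp, fun x => by simp⟩
    | insert a M ha ih =>
      intro hM
      obtain ⟨J, hJ, hp⟩ := ih ((Finset.subset_insert _ _).trans hM)
      rcases zmod2_cases (D a) with h | h
      · exact ⟨J, hJ, fun x => by rw [Finset.sum_insert ha, h, hp]; simp⟩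
      · obtain ⟨L, hL, hq⟩ := join_path hT (hc a (hM (by simp)) n hn)
        exact ⟨symmDiff L J, symm_sub hL hJ, fun x => by
          rw [Finset.sum_insert ha, h, par_symm, hp, hq]; simp⟩
  obtain ⟨J, hJ, hp⟩ := key N (Finset.Subset.refl _)
  refine ⟨J, hJ, fun x => ?_⟩
  rw [hp]
  simp only [mul_add, Finset.sum_add_distrib]
  rw [← Finset.sum_mul, hs]
  by_cases hx : x ∈ N
  · simp [dl, hx]
  · simp [dl, hx, hD x hx]

theorem walk_par {G : SimpleGraph V} {a b : V} (p : G.Walk a b) (x : V) :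
    par (p.edges : Multiset (Sym2 V)) x = dl a x + dl b x := by
  induction p with
  | nil => simp [zz]
  | cons h p ih =>
    rename_i u v w
    rw [SimpleGraph.Walk.edges_cons, ← Multiset.cons_coe, par_cons, ih, par_edge h.ne]
    show dl u x + dl v x + _ = _
    linear_combination zz (dl v x)

theorem tripod {T : Finset (Sym2 V)} (hT : LL T.val) {p1 p2 p3 : V}
    (h12 : Rch T.val p1 p2) (h31 : Rch T.val p3 p1) :
    ∃ c, ∃ L1 ⊆ T, ∃ L2 ⊆ T, ∃ L3 ⊆ T, Disjoint L1 L2 ∧ Disjoint L1 L3 ∧ Disjoint L2 L3 ∧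
      (∀ x, par L1.val x = dl p1 x + dl c x) ∧ (∀ x, par L2.val x = dl p2 x + dl c x) ∧
      (∀ x, par L3.val x = dl p3 x + dl c x) := by
  let G : SimpleGraph V := SimpleGraph.fromEdgeSet (T : Set (Sym2 V))
  have hadj : ∀ a b, s(a, b) ∈ T.val → G.Adj a b := by
    intro a b h
    refine (SimpleGraph.fromEdgeSet_adj _).2 ⟨by simpa using h, by simpa using hT _ h⟩
  have hr : ∀ a b, Rch T.val a b → G.Reachable a b := by
    intro a b h
    unfold Rch at h
    induction h with
    | refl => exact SimpleGraph.Reachable.refl _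
    | tail _ h2 ih => exact ih.trans (hadj _ _ h2).reachable
  obtain ⟨p, hp⟩ := (hr _ _ h12).exists_isPath
  have hsub : ∀ (a b : V) (q : G.Walk a b), q.edges.toFinset ⊆ T := by
    intro a b q e he
    have h1 := q.edges_subset_edgeSet (List.mem_toFinset.1 he)
    rw [SimpleGraph.edgeSet_fromEdgeSet] at h1
    exact_mod_cast h1.1
  have h3 : ∃ c ∈ p.support, ∃ L ⊆ T, Disjoint p.edges.toFinset L ∧
      ∀ x, par L.val x = dl p3 x + dl c x := by
    clear h12
    unfold Rch at h31
    induction h31 using Relation.ReflTransGen.head_induction_on with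
    | refl => exact ⟨p1, by simp, ∅, by simp, by simp, fun x => by simp [zz]⟩
    | head h h' ih =>
      rename_i a b
      obtain ⟨c, hc, L, hL, hdis, hpar⟩ := ih
      by_cases ha : a ∈ p.support
      · exact ⟨a, ha, ∅, by simp, by simp, fun x => by simp [zz]⟩
      · have hne : a ≠ b := by simpa using hT _ h
        have he : s(a, b) ∉ p.edges := fun h1 => ha (p.fst_mem_support_of_mem_edges h1)
        refine ⟨c, hc, symmDiff {s(a, b)} L, symm_sub (by simpa using h) hL, ?_, fun x => ?_⟩
        · rw [Finset.disjoint_left] at hdis ⊢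
          intro e h1 h2
          rcases Finset.mem_symmDiff.1 h2 with h2 | h2
          · have : e = s(a, b) := by simpa using h2.1
            rw [this] at h1
            exact he (List.mem_toFinset.1 h1)
          · exact hdis h1 h2.1
        · rw [par_symm, par_dl hne, hpar]
          linear_combination zz (dl b x)
  obtain ⟨c, hc, L3, hL3, hdis, hpar3⟩ := h3
  have hnd : p.edges.Nodup := hp.isTrail.edges_nodup
  have hspec := congrArg SimpleGraph.Walk.edges (p.take_spec hc)
  rw [SimpleGraph.Walk.edges_append] at hspec
  rw [← hspec, List.nodup_append] at hnd
  have hval : ∀ l : List (Sym2 V), l.Nodup → l.toFinset.val = (l : Multiset (Sym2 V)) := by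
    intro l hl
    rw [List.toFinset_val, List.dedup_eq_self.2 hl]
  rw [Finset.disjoint_left] at hdis
  refine ⟨c, (p.takeUntil c hc).edges.toFinset, hsub _ _ _, (p.dropUntil c hc).edges.toFinset,
    hsub _ _ _, L3, hL3, ?_, ?_, ?_, ?_, ?_, hpar3⟩
  · rw [Finset.disjoint_left]
    intro e h1 h2
    exact hnd.2.2 e (List.mem_toFinset.1 h1) e (List.mem_toFinset.1 h2) rfl
  · rw [Finset.disjoint_left]
    intro e h1 h2
    refine hdis (a := e) ?_ h2
    rw [List.mem_toFinset] at h1 ⊢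
    rw [← hspec]; simp [h1]
  · rw [Finset.disjoint_left]
    intro e h1 h2
    refine hdis (a := e) ?_ h2
    rw [List.mem_toFinset] at h1 ⊢
    rw [← hspec]; simp [h1]
  · intro x
    rw [hval _ hnd.1, walk_par]
  · intro x
    rw [hval _ hnd.2.1, walk_par, add_comm]

end RG

namespace RG
variable {V : Type}

theorem sum_slack {ι : Type} {R : Finset ι} {f h : ι → ℕ} {r0 : ι} {d : ℕ}
    (hle : ∀ r ∈ R, f r ≤ h r) (h0 : r0 ∈ R) (hd : f r0 + d ≤ h r0) :
    ∑ r ∈ R, f r + d ≤ ∑ r ∈ R, h r := by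
  rw [← Finset.add_sum_erase R f h0, ← Finset.add_sum_erase R h h0]
  have := Finset.sum_le_sum (s := R.erase r0) (f := f) (g := h)
    (fun r hr => hle r (Finset.mem_of_mem_erase hr))
  omega

noncomputable def st (a : V) (X : Finset V) : Finset (Sym2 V) := X.image (fun y => s(a, y))

theorem mem_st {a : V} {X : Finset V} {e : Sym2 V} : e ∈ st a X ↔ ∃ y ∈ X, s(a, y) = e := by
  simp [st]

noncomputable def fes (E : Finset (Sym2 V)) (C : Finset V) : Finset (Sym2 V) :=
  E.filter (fun e => ∀ a ∈ e, a ∈ C)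

theorem mem_fes {E : Finset (Sym2 V)} {C : Finset V} {e : Sym2 V} :
    e ∈ fes E C ↔ e ∈ E ∧ ∀ a ∈ e, a ∈ C := Finset.mem_filter

noncomputable def fe (E : Finset (Sym2 V)) (C : Finset V) : ℕ := (fes E C).card

noncomputable def tt (Q : Finset V) (Nb : V → Finset V) (C : Finset V) : ℕ :=
  ∑ q ∈ Q, (C ∩ Nb q).card

noncomputable def II (v : V) (X Q : Finset V) (Nb : V → Finset V) : Finset (Sym2 V) :=
  st v X ∪ Q.biUnion (fun q => st q (Nb q))

theorem card_II (v : V) (X Q : Finset V) (Nb : V → Finset V) :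
    (II v X Q Nb).card ≤ X.card + ∑ q ∈ Q, (Nb q).card := by
  unfold II
  refine (Finset.card_union_le _ _).trans ?_
  have h1 : (st v X).card ≤ X.card := Finset.card_image_le
  have h2 : (Q.biUnion (fun q => st q (Nb q))).card ≤ ∑ q ∈ Q, (Nb q).card :=
    Finset.card_biUnion_le.trans (Finset.sum_le_sum (fun q _ => Finset.card_image_le))
  omega

theorem KK_rch {A : Finset (Sym2 V)} {g : V → ZMod 2} (hg : g ∈ KK A) {a b : V}
    (h : Rch A.val a b) : g a = g b := by
  unfold Rch at h
  induction h with
  | refl => rfl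
  | tail _ h2 ih => exact ih.trans (hg _ _ h2)

theorem forest_II [Fintype V] {N X Q : Finset V} {v : V} {Nb : V → Finset V}
    (hX : X ⊆ N) (hNb : ∀ q ∈ Q, Nb q ⊆ N) (hvN : v ∉ N) (hvQ : v ∉ Q) (hQN : Disjoint N Q)
    (hdisj : ∀ q ∈ Q, ∀ q' ∈ Q, q ≠ q' → Disjoint (Nb q) (Nb q'))
    (hXq : ∀ q ∈ Q, (X ∩ Nb q).card ≤ 1) :
    X.card + ∑ q ∈ Q, (Nb q).card + kk (II v X Q Nb) ≤ Fintype.card V := by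
  set M := X ∪ Q.biUnion (fun q => Nb q \ X) with hM
  set Q0 := Q.filter (fun q => X ∩ Nb q = ∅) with hQ0
  set Z := insert v (((Finset.univ \ insert v (N ∪ Q)) ∪ (N \ M)) ∪ Q0) with hZ
  have hk : kk (II v X Q Nb) ≤ Z.card := by
    apply kk_le_card
    intro g hg hz
    have gv : g v = 0 := hz v (by simp [hZ])
    have gX : ∀ x ∈ X, g x = 0 := by
      intro x hx
      rw [← gv]
      exact (hg v x (by simp only [II, Finset.mem_union, mem_st]; exact Or.inl ⟨x, hx, rfl⟩)).symm
    have gq : ∀ q ∈ Q, ∀ y ∈ Nb q, g q = g y := by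
      intro q hq y hy
      refine hg q y ?_
      simp only [II, Finset.mem_union, Finset.mem_biUnion, mem_st]
      exact Or.inr ⟨q, hq, y, hy, rfl⟩
    have gQ : ∀ q ∈ Q, g q = 0 := by
      intro q hq
      by_cases h : X ∩ Nb q = ∅
      · exact hz q (by simp [hZ, hQ0, hq, h])
      · obtain ⟨y, hy⟩ := Finset.nonempty_iff_ne_empty.2 h
        rw [Finset.mem_inter] at hy
        rw [gq q hq y hy.2, gX y hy.1]
    funext x
    by_cases hx1 : x ∈ insert v (N ∪ Q)
    · simp only [Finset.mem_insert, Finset.mem_union] at hx1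
      rcases hx1 with rfl | hx | hx
      · exact gv
      · by_cases hxM : x ∈ M
        · simp only [hM, Finset.mem_union, Finset.mem_biUnion, Finset.mem_sdiff] at hxM
          rcases hxM with h | ⟨q, hq, h, _⟩
          · exact gX x h
          · show g x = 0
            rw [← gq q hq x h, gQ q hq]
        · exact hz x (by simp [hZ, hx, hxM])
      · exact gQ x hx
    · exact hz x (by
        simp only [hZ, Finset.mem_insert, Finset.mem_union, Finset.mem_sdiff, Finset.mem_univ, true_and] at hx1 ⊢
        tauto)
  have hMN : M ⊆ N := by
    intro x hx
    simp only [hM, Finset.mem_union, Finset.mem_biUnion, Finset.mem_sdiff] at hx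
    rcases hx with h | ⟨q, hq, h, _⟩
    · exact hX h
    · exact hNb q hq h
  have hMc : M.card = X.card + ∑ q ∈ Q, (Nb q \ X).card := by
    rw [hM, Finset.card_union_of_disjoint, Finset.card_biUnion]
    · intro q hq q' hq' hne
      exact (hdisj q hq q' hq' hne).mono Finset.sdiff_subset Finset.sdiff_subset
    · rw [Finset.disjoint_left]
      intro x hx hx'
      simp only [Finset.mem_biUnion, Finset.mem_sdiff] at hx'
      obtain ⟨q, _, _, h⟩ := hx'
      exact h hx
  have hsum : ∑ q ∈ Q, (Nb q).card + Q0.card ≤ ∑ q ∈ Q, (Nb q \ X).card + Q.card := by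
    rw [hQ0, Finset.card_filter, Finset.card_eq_sum_ones, ← Finset.sum_add_distrib,
      ← Finset.sum_add_distrib]
    refine Finset.sum_le_sum fun q hq => ?_
    have h1 := Finset.card_sdiff_add_card_inter (Nb q) X
    have h2 := hXq q hq
    rw [Finset.inter_comm] at h2
    by_cases h : X ∩ Nb q = ∅
    · have h' : Nb q ∩ X = ∅ := by rw [Finset.inter_comm]; exact h
      rw [h'] at h1
      simp at h1
      rw [if_pos h]; omega
    · rw [if_neg h]; omega
  have hSc : (insert v (N ∪ Q)).card = N.card + Q.card + 1 := by
    rw [Finset.card_insert_of_notMem (by simp [hvN, hvQ]), Finset.card_union_of_disjoint hQN]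
  have hZc : Z.card + (insert v (N ∪ Q)).card + M.card ≤ 1 + Fintype.card V + N.card + Q0.card := by
    have a1 := Finset.card_insert_le v (((Finset.univ \ insert v (N ∪ Q)) ∪ (N \ M)) ∪ Q0)
    have a2 := Finset.card_union_le ((Finset.univ \ insert v (N ∪ Q)) ∪ (N \ M)) Q0
    have a3 := Finset.card_union_le (Finset.univ \ insert v (N ∪ Q)) (N \ M)
    have a4 := Finset.card_sdiff_add_card_eq_card (Finset.subset_univ (insert v (N ∪ Q)))
    have a5 := Finset.card_sdiff_add_card_eq_card hMN
    rw [Finset.card_univ] at a4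
    rw [← hZ] at a1
    omega
  omega

theorem cond [Fintype V] {N X Q : Finset V} {v : V} {Nb : V → Finset V} {EN : Finset (Sym2 V)}
    (hEN : ∀ e ∈ EN, ∀ a ∈ e, a ∈ N) (hX : X ⊆ N) (hX3 : X.card = 3)
    (hNb : ∀ q ∈ Q, Nb q ⊆ N) (hvN : v ∉ N) (hvQ : v ∉ Q) (hQN : Disjoint N Q)
    (hdisj : ∀ q ∈ Q, ∀ q' ∈ Q, q ≠ q' → Disjoint (Nb q) (Nb q'))
    (hXq : ∀ q ∈ Q, (X ∩ Nb q).card ≤ 1) (hQ2 : Q.card ≤ 2)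
    (ha : ∀ C ⊆ N, C.Nonempty → C.card ≤ 2 → fe EN C + 1 ≤ C.card)
    (hb : ∀ C ⊆ N, C.Nonempty → fe EN C + tt Q Nb C + 1 + (if tt Q Nb C = 0 then 1 else 0) ≤ 2 * C.card)
    (hc : ∀ C ⊆ N, 3 ≤ C.card →
      (∀ q ∈ Q, ∀ q' ∈ Q, q ≠ q' → (C ∩ Nb q).Nonempty → (C ∩ Nb q').Nonempty → False) →
      fe EN C + tt Q Nb C + 1 + (if tt Q Nb C = 0 then 1 else 0) + 2 ≤ 2 * C.card)
    (hd : ∀ C ⊆ N, ∀ q ∈ Q, ∀ q' ∈ Q, q ≠ q' → (C ∩ Nb q).Nonempty → (C ∩ Nb q').Nonempty →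
      fe EN C + tt Q Nb C + 1 + (if tt Q Nb C = 0 then 1 else 0) + 1 ≤ 2 * C.card)
    {A : Finset (Sym2 V)} (hA : A ⊆ EN) :
    A.card + (II v X Q Nb).card + kk (A ∪ II v X Q Nb) + kk A ≤ 2 * Fintype.card V := by
  have hI := card_II v X Q Nb
  let sd : Setoid V := ⟨Rch A.val, ⟨fun a => Rch.rfl' a, fun h => h.symm, fun h h' => h.trans h'⟩⟩
  obtain ⟨cl, hcl1, hcl2⟩ : ∃ cl : V → V, (∀ a, Rch A.val (cl a) a) ∧
      ∀ a b, Rch A.val a b → cl a = cl b := by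
    refine ⟨fun a => (Quotient.mk sd a).out, fun a => ?_, fun a b h => ?_⟩
    · exact Quotient.exact (s := sd) (Quotient.out_eq (Quotient.mk sd a))
    · have : Quotient.mk sd a = Quotient.mk sd b := Quotient.sound h
      simp only [this]
  have hstay : ∀ a b, Rch A.val a b → a ∈ N → b ∈ N := by
    intro a b h haN
    unfold Rch at h
    induction h with
    | refl => exact haN
    | tail _ h2 ih => exact hEN _ (hA h2) _ (by simp)
  set R := N.image cl with hR
  set C : V → Finset V := fun r => N.filter (fun a => cl a = r) with hC
  have hCN : ∀ r, C r ⊆ N := fun r => Finset.filter_subset _ _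
  have hCne : ∀ r ∈ R, (C r).Nonempty := by
    intro r hr
    obtain ⟨a, ha, rfl⟩ := Finset.mem_image.1 hr
    exact ⟨a, by simp [hC, ha]⟩
  have hNc : N.card = ∑ r ∈ R, (C r).card := Finset.card_eq_sum_card_image cl N
  have hAc : A.card ≤ ∑ r ∈ R, fe EN (C r) := by
    have hsub : A ⊆ R.biUnion (fun r => fes EN (C r)) := by
      intro e he
      have heN := hEN e (hA he)
      have heA := he
      induction e using Sym2.ind with
      | _ a b =>
        have haN := heN a (by simp)
        have hbN := heN b (by simp)
        simp only [Finset.mem_biUnion, mem_fes]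
        refine ⟨cl a, Finset.mem_image_of_mem _ haN, hA he, ?_⟩
        intro c hc
        simp only [Sym2.mem_iff] at hc
        rcases hc with rfl | rfl
        · simp [hC, haN]
        · simp only [hC, Finset.mem_filter]
          exact ⟨hbN, (hcl2 _ _ (Rch.edge heA)).symm⟩
    exact (Finset.card_le_card hsub).trans Finset.card_biUnion_le
  have hk1 : kk A + N.card ≤ Fintype.card V + R.card := by
    have h1 : kk A ≤ ((Finset.univ \ N) ∪ R).card := by
      apply kk_le_card
      intro g hg hz
      funext x
      by_cases hx : x ∈ N
      · show g x = 0
        rw [← KK_rch hg (hcl1 x)]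
        exact hz _ (Finset.mem_union_right _ (Finset.mem_image_of_mem _ hx))
      · exact hz x (by simp [hx])
    have h2 := Finset.card_union_le (Finset.univ \ N) R
    have h3 := Finset.card_sdiff_add_card_eq_card (Finset.subset_univ N)
    rw [Finset.card_univ] at h3
    omega
  by_cases hsmall : ∀ r ∈ R, (C r).card ≤ 2
  · have h1 : ∑ r ∈ R, fe EN (C r) + R.card ≤ N.card := by
      rw [hNc, Finset.card_eq_sum_ones, ← Finset.sum_add_distrib]
      exact Finset.sum_le_sum fun r hr => ha _ (hCN r) (hCne r hr) (hsmall r hr)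
    have h2 := forest_II hX hNb hvN hvQ hQN hdisj hXq
    have h3 : kk (A ∪ II v X Q Nb) ≤ kk (II v X Q Nb) := kk_anti Finset.subset_union_right
    omega
  push Not at hsmall
  obtain ⟨r0, hr0, hr03⟩ := hsmall
  have hNbsum : ∑ q ∈ Q, (Nb q).card ≤ ∑ r ∈ R, tt Q Nb (C r) := by
    unfold tt
    rw [Finset.sum_comm]
    refine Finset.sum_le_sum fun q hq => ?_
    have hsub : Nb q ⊆ R.biUnion (fun r => C r ∩ Nb q) := by
      intro y hy
      have hyN := hNb q hq hy
      simp only [Finset.mem_biUnion, Finset.mem_inter]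
      exact ⟨cl y, Finset.mem_image_of_mem _ hyN, by simp [hC, hyN], hy⟩
    exact (Finset.card_le_card hsub).trans Finset.card_biUnion_le
  have hSc : (insert v (N ∪ Q)).card = N.card + Q.card + 1 := by
    rw [Finset.card_insert_of_notMem (by simp [hvN, hvQ]), Finset.card_union_of_disjoint hQN]
  have main : ∀ Q' ⊆ Q, (∀ g ∈ KK (A ∪ II v X Q Nb), (∀ q ∈ Q', g q = 0) → ∀ q ∈ Q, g q = 0) →
      ∑ r ∈ R, (fe EN (C r) + tt Q Nb (C r) + 1 + (if tt Q Nb (C r) = 0 then 1 else 0)) + 2 + Q'.card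
        ≤ 2 * N.card + Q.card →
      A.card + (II v X Q Nb).card + kk (A ∪ II v X Q Nb) + kk A ≤ 2 * Fintype.card V := by
    intro Q' hQ' hg0 hslack
    set R0 := R.filter (fun r => tt Q Nb (C r) = 0) with hR0
    have hk2 : kk (A ∪ II v X Q Nb) ≤ (((Finset.univ \ insert v (N ∪ Q)) ∪ R0) ∪ Q').card := by
      apply kk_le_card
      intro g hg hz
      have gA : g ∈ KK A := KK_anti Finset.subset_union_left hg
      have gI : g ∈ KK (II v X Q Nb) := KK_anti Finset.subset_union_right hg
      have gQ := hg0 g hg (fun q hq => hz q (Finset.mem_union_right _ hq))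
      have gq : ∀ q ∈ Q, ∀ y ∈ Nb q, g y = 0 := by
        intro q hq y hy
        rw [← gQ q hq]
        refine (gI q y ?_).symm
        simp only [II, Finset.mem_union, Finset.mem_biUnion, mem_st]
        exact Or.inr ⟨q, hq, y, hy, rfl⟩
      have gN : ∀ x ∈ N, g x = 0 := by
        intro x hx
        rw [← KK_rch gA (hcl1 x)]
        have hr : cl x ∈ R := Finset.mem_image_of_mem _ hx
        by_cases h0 : tt Q Nb (C (cl x)) = 0
        · exact hz _ (by
            refine Finset.mem_union_left _ (Finset.mem_union_right _ ?_)
            rw [hR0, Finset.mem_filter]; exact ⟨hr, h0⟩)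
        · unfold tt at h0
          obtain ⟨q, hq, hne⟩ := Finset.exists_ne_zero_of_sum_ne_zero h0
          obtain ⟨y, hy⟩ := Finset.card_ne_zero.1 hne
          rw [Finset.mem_inter] at hy
          have hcy : cl y = cl x := (Finset.mem_filter.1 hy.1).2
          rw [← hcy, KK_rch gA (hcl1 y)]
          exact gq q hq y hy.2
      funext x
      by_cases hx1 : x ∈ insert v (N ∪ Q)
      · simp only [Finset.mem_insert, Finset.mem_union] at hx1
        rcases hx1 with rfl | hx | hx
        · obtain ⟨y, hy⟩ : X.Nonempty := Finset.card_pos.1 (by omega)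
          show g x = 0
          rw [← gN y (hX hy)]
          exact gI x y (by simp only [II, Finset.mem_union, mem_st]; exact Or.inl ⟨y, hy, rfl⟩)
        · exact gN x hx
        · exact gQ x hx
      · refine hz x (Finset.mem_union_left _ (Finset.mem_union_left _ ?_))
        rw [Finset.mem_sdiff]; exact ⟨Finset.mem_univ _, hx1⟩
    have a2 := Finset.card_union_le ((Finset.univ \ insert v (N ∪ Q)) ∪ R0) Q'
    have a3 := Finset.card_union_le (Finset.univ \ insert v (N ∪ Q)) R0
    have a4 := Finset.card_sdiff_add_card_eq_card (Finset.subset_univ (insert v (N ∪ Q)))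
    rw [Finset.card_univ] at a4
    have hR0c : R0.card = ∑ r ∈ R, (if tt Q Nb (C r) = 0 then 1 else 0) := by
      rw [hR0, Finset.card_filter]
    have hRc : R.card = ∑ r ∈ R, 1 := Finset.card_eq_sum_ones R
    rw [Finset.sum_add_distrib, Finset.sum_add_distrib, Finset.sum_add_distrib, ← hRc, ← hR0c] at hslack
    omega
  have h2N : ∑ r ∈ R, 2 * (C r).card = 2 * N.card := by rw [hNc, Finset.mul_sum]
  by_cases hex : ∃ r ∈ R, ∃ q ∈ Q, ∃ q' ∈ Q, q ≠ q' ∧ (C r ∩ Nb q).Nonempty ∧ (C r ∩ Nb q').Nonempty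
  · obtain ⟨r, hr, q, hq, q', hq', hne, h1, h2⟩ := hex
    have hsl := sum_slack (R := R) (h := fun r => 2 * (C r).card)
      (fun r hr => hb (C r) (hCN r) (hCne r hr)) hr (hd (C r) (hCN r) q hq q' hq' hne h1 h2)
    have hQe : Q = {q, q'} := by
      refine (Finset.eq_of_subset_of_card_le ?_ ?_).symm
      · intro x hx; simp at hx; rcases hx with rfl | rfl <;> assumption
      · rw [Finset.card_pair hne]; omega
    refine main {q} (by simpa using hq) ?_ ?_
    · intro g hg hz p hp
      have gA : g ∈ KK A := KK_anti Finset.subset_union_left hg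
      have gI : g ∈ KK (II v X Q Nb) := KK_anti Finset.subset_union_right hg
      have gq : g q = 0 := hz q (by simp)
      have gst : ∀ q ∈ Q, ∀ y ∈ Nb q, g q = g y := by
        intro q hq y hy
        refine gI q y ?_
        simp only [II, Finset.mem_union, Finset.mem_biUnion, mem_st]
        exact Or.inr ⟨q, hq, y, hy, rfl⟩
      have hp' : p = q ∨ p = q' := by rw [hQe] at hp; simpa using hp
      rcases hp' with rfl | rfl
      · exact gq
      · obtain ⟨y, hy⟩ := h1
        obtain ⟨y', hy'⟩ := h2
        rw [Finset.mem_inter] at hy hy'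
        rw [gst _ hq' y' hy'.2, ← KK_rch gA (hcl1 y'), (Finset.mem_filter.1 hy'.1).2,
          ← (Finset.mem_filter.1 hy.1).2, KK_rch gA (hcl1 y), ← gst q hq y hy.2, gq]
    · have : Q.card = 2 := by rw [hQe, Finset.card_pair hne]
      simp only [Finset.card_singleton]
      omega
  · push Not at hex
    have hsl := sum_slack (R := R) (h := fun r => 2 * (C r).card)
      (fun r hr => hb (C r) (hCN r) (hCne r hr)) hr0 (hc (C r0) (hCN r0) hr03 (by
        intro q hq q' hq' hne h1 h2
        have := hex r0 hr0 q hq q' hq' hne h1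
        rw [this] at h2
        simp at h2))
    refine main Q (Finset.Subset.refl _) (fun g _ h => h) ?_
    omega

end RG

namespace RG
variable {V : Type}

theorem par_filter_eq (L : Multiset (Sym2 V)) (P : Sym2 V → Prop) [DecidablePred P] {x : V}
    (h : ∀ e ∈ L, x ∈ e → P e) : par (L.filter P) x = par L x := by
  unfold par degIn
  congr 2
  rw [Multiset.filter_filter]
  refine Multiset.filter_congr fun e he => ?_
  exact ⟨fun h' => h'.1, fun h' => ⟨h', h e he h'⟩⟩

theorem no_cross {L : Finset (Sym2 V)} (hL : LL L.val) {U : Finset V}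
    (h : ∀ a b, s(a, b) ∈ L → a ∈ U → b ∈ U) : ∑ x ∈ U, par L.val x = 0 := by
  have hw : Within (U : Set V) (ind L.val U) := ind_within _ _
  have h1 := handshake (hL.anti (ind_le L.val U)) hw
  rw [← h1]
  refine Finset.sum_congr rfl fun x hx => ?_
  symm
  unfold ind
  apply par_filter_eq
  intro e he hxe
  induction e using Sym2.ind with
  | _ a b =>
    have he' : s(a, b) ∈ L := he
    simp only [Sym2.mem_iff] at hxe ⊢
    rcases hxe with rfl | rfl
    · have := h x b he' hx
      rintro y (rfl | rfl) <;> assumption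
    · have := h x a (by rwa [Sym2.eq_swap]) hx
      rintro y (rfl | rfl) <;> assumption

theorem tripod' {T : Finset (Sym2 V)} (hT : LL T.val) (p : Fin 3 → V)
    (h : ∀ i j, Rch T.val (p i) (p j)) :
    ∃ c, ∃ L : Fin 3 → Finset (Sym2 V), (∀ i, L i ⊆ T) ∧ (∀ i j, i ≠ j → Disjoint (L i) (L j)) ∧
      ∀ i x, par (L i).val x = dl (p i) x + dl c x := by
  obtain ⟨c, L1, h1, L2, h2, L3, h3, h12, h13, h23, q1, q2, q3⟩ :=
    tripod hT (h 0 1) (h 2 0)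
  refine ⟨c, ![L1, L2, L3], ?_, ?_, ?_⟩
  · intro i; fin_cases i <;> simpa
  · intro i j hij
    fin_cases i <;> fin_cases j <;> simp at hij ⊢ <;> first | assumption | (apply Disjoint.symm; assumption)
  · intro i; fin_cases i <;> simpa

theorem solve [Fintype V] {T1 T2 : Finset (Sym2 V)} {S N : Finset V} {v : V} {p : Fin 3 → V}
    (hL1 : LL T1.val) (hL2 : LL T2.val) (hdis : Disjoint T1 T2)
    (hw2 : ∀ e ∈ T2, ∀ a ∈ e, a ∈ N)
    (hc1 : ∀ a ∈ S, ∀ b ∈ S, Rch T1.val a b) (hc2 : ∀ a ∈ N, ∀ b ∈ N, Rch T2.val a b)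
    (hNS : N ⊆ S) (hvS : v ∈ S) (hvN : v ∉ N) (hp : ∀ y, s(v, y) ∈ T1 ↔ ∃ i, y = p i)
    (hpi : Function.Injective p) (hpN : ∀ i, p i ∈ N)
    {D : V → ZMod 2} (hD : ∀ x, x ∉ N → x ≠ v → D x = 0) (hs : D v + ∑ x ∈ N, D x = 0) :
    ∃ H ⊆ T1 ∪ T2, (∀ a ∈ S, ∀ b ∈ S, Rch H.val a b) ∧ ∀ x, par H.val x = par T1.val x + D x := by
  rcases zmod2_cases (D v) with h0 | h1
  · obtain ⟨J, hJ, hpar⟩ := join (D := D) hL2 hc2 (fun x hx => by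
      by_cases hxv : x = v
      · rw [hxv, h0]
      · exact hD x hx hxv) (by simpa [h0] using hs)
    have hdJ : Disjoint T1 J := hdis.mono_right hJ
    refine ⟨symmDiff T1 J, symm_sub Finset.subset_union_left (hJ.trans Finset.subset_union_right),
      ?_, fun x => by rw [par_symm, hpar]⟩
    intro a ha b hb
    refine (hc1 a ha b hb).mono' ?_
    intro e he
    exact Finset.mem_symmDiff.2 (Or.inl ⟨he, Finset.disjoint_left.1 hdJ he⟩)
  · obtain ⟨c, L, hLT, hLd, hLp⟩ := tripod' hL2 p (fun i j => hc2 _ (hpN i) _ (hpN j))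
    have hcN : c ∈ N := by
      by_contra hcN
      have h2 := hLp 0 c
      rw [par_eq_zero_of_notMem (fun e he hce => hcN (hw2 e (hLT 0 he) c hce))] at h2
      have h3 : c ≠ p 0 := fun h => hcN (h ▸ hpN 0)
      simp [dl, h3] at h2
    obtain ⟨J0, hJ0, hJp⟩ := join (D := fun x => (if x ∈ N then D x else 0) + dl c x) hL2 hc2
      (fun x hx => by
        have : x ≠ c := fun h => hx (h ▸ hcN)
        simp [hx, dl, this]) (by
        rw [Finset.sum_add_distrib, Finset.sum_congr rfl (fun x hx => if_pos hx)]
        have h2 : ∑ x ∈ N, dl c x = 1 := by simp [dl, hcN]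
        rw [h2]
        rw [h1] at hs
        linear_combination hs)
    set T0 := T1.filter (fun e => v ∉ e) with hT0
    set J : Fin 3 → Finset (Sym2 V) := fun i => symmDiff J0 (L i) with hJdef
    have hJT : ∀ i, J i ⊆ T2 := fun i => symm_sub hJ0 (hLT i)
    set H : Fin 3 → Finset (Sym2 V) := fun i => symmDiff (symmDiff T1 {s(v, p i)}) (J i) with hHdef
    have hvp : ∀ i, v ≠ p i := fun i h => hvN (h ▸ hpN i)
    have hst : ∀ i, s(v, p i) ∈ T1 := fun i => (hp _).2 ⟨i, rfl⟩
    have mem1 : ∀ i, ∀ e ∈ T1, e ≠ s(v, p i) → e ∈ H i := by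
      intro i e he hne
      have h2 : e ∉ J i := fun h => Finset.disjoint_left.1 hdis he (hJT i h)
      simp [hHdef, Finset.mem_symmDiff, he, hne, h2]
    have mem2 : ∀ i, ∀ e ∈ J i, e ∈ H i := by
      intro i e he
      have h2 : e ∉ T1 := fun h => Finset.disjoint_left.1 hdis h (hJT i he)
      have h3 : e ≠ s(v, p i) := fun h => h2 (h ▸ hst i)
      simp [hHdef, Finset.mem_symmDiff, he, h2, h3]
    have hHsub : ∀ i, H i ⊆ T1 ∪ T2 := fun i =>
      symm_sub (symm_sub Finset.subset_union_left (by
        intro e he; rw [Finset.mem_singleton.1 he]; exact Finset.mem_union_left _ (hst i)))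
        ((hJT i).trans Finset.subset_union_right)
    have hHp : ∀ i x, par (H i).val x = par T1.val x + D x := by
      intro i x
      rw [hHdef, hJdef]
      simp only [par_symm]
      rw [par_dl (hvp i), hJp, hLp]
      have e1 : D x = dl v x + (if x ∈ N then D x else 0) := by
        by_cases hx : x ∈ N
        · have : x ≠ v := fun h => hvN (h ▸ hx)
          simp [dl, hx, this]
        · by_cases hxv : x = v
          · subst hxv; simp [dl, hx, h1]
          · simp [dl, hx, hxv, hD x hx hxv]
      rw [e1]
      by_cases hx : x ∈ N
      · simp only [hx, if_true]
        have : x ≠ v := fun h => hvN (h ▸ hx)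
        have e2 : dl v x = 0 := by simp [dl, this]
        rw [e2]
        linear_combination zz (dl (p i) x) + zz (dl c x)
      · simp only [hx, if_false]
        linear_combination zz (dl (p i) x) + zz (dl c x)
    have T0H : ∀ i a b, Rch T0.val a b → Rch (H i).val a b := by
      intro i a b h
      refine h.mono' ?_
      intro e he
      obtain ⟨he1, he2⟩ := Finset.mem_filter.1 (show e ∈ T0 from he)
      refine mem1 i e he1 ?_
      rintro rfl
      exact he2 (by simp)
    have cover : ∀ s, Rch T1.val v s → s = v ∨ ∃ i, Rch T0.val (p i) s := by
      intro s h
      unfold Rch at h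
      induction h with
      | refl => exact Or.inl rfl
      | tail _ h2 ih =>
        rename_i a b _
        by_cases hbv : b = v
        · exact Or.inl hbv
        · right
          by_cases hav : a = v
          · subst hav
            obtain ⟨i, rfl⟩ := (hp b).1 h2
            exact ⟨i, Rch.rfl' _⟩
          · rcases ih with h | ⟨i, hi⟩
            · exact absurd h hav
            · refine ⟨i, hi.trans (Rch.edge ?_)⟩
              show s(a, b) ∈ T0
              refine Finset.mem_filter.2 ⟨h2, ?_⟩
              simp [Ne.symm hav, Ne.symm hbv]
    have coverN : ∀ s ∈ N, ∃ i, Rch T0.val (p i) s := by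
      intro s hs
      rcases cover s (hc1 v hvS s (hNS hs)) with h | h
      · exact absurd (h ▸ hs) hvN
      · exact h
    by_cases hgood : ∃ i j, i ≠ j ∧ Rch (H i).val (p i) (p j)
    · obtain ⟨i, j, hij, hr⟩ := hgood
      refine ⟨H i, hHsub i, ?_, hHp i⟩
      have hv' : ∀ k, k ≠ i → Rch (H i).val v (p k) := by
        intro k hk
        refine Rch.edge (mem1 i _ (hst k) ?_)
        intro h
        have : p k = p i := by
          rcases Sym2.eq_iff.1 h with ⟨_, h⟩ | ⟨h, _⟩
          · exact h
          · exact absurd h (hvp i)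
        exact hk (hpi this)
      have hv2 : ∀ k, Rch (H i).val v (p k) := by
        intro k
        by_cases hk : k = i
        · rw [hk]; exact (hv' j hij.symm).trans hr.symm
        · exact hv' k hk
      have hv3 : ∀ s ∈ S, Rch (H i).val v s := by
        intro s hs
        rcases cover s (hc1 v hvS s hs) with h | ⟨k, h⟩
        · rw [h]; exact Rch.rfl' _
        · exact (hv2 k).trans (T0H i _ _ h)
      intro a ha b hb
      exact (hv3 a ha).symm.trans (hv3 b hb)
    exfalso
    push Not at hgood
    have hBd : ∀ i j x, i ≠ j → Rch T0.val (p i) x → Rch T0.val (p j) x → False := by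
      intro i j x hij h2 h3
      exact hgood i j hij (T0H i _ _ (h2.trans h3.symm))
    have hnc : ∀ i a b, s(a, b) ∈ J i → Rch T0.val (p i) a → Rch T0.val (p i) b := by
      intro i a b hab ha
      by_contra hb
      obtain ⟨j, hj⟩ := coverN b (hw2 _ (hJT i hab) b (by simp))
      have hij : i ≠ j := by rintro rfl; exact hb hj
      exact hgood i j hij (((T0H i _ _ ha).trans (Rch.edge (mem2 i _ hab))).trans (T0H i _ _ hj).symm)
    obtain ⟨i, hi⟩ : ∃ i, ¬ Rch T0.val (p i) c := by
      by_contra hcon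
      push Not at hcon
      exact hBd 0 1 c (by decide) (hcon 0) (hcon 1)
    have hcross : ∃ a b, s(a, b) ∈ L i ∧ Rch T0.val (p i) a ∧ ¬ Rch T0.val (p i) b := by
      by_contra hcon
      push Not at hcon
      have h2 := no_cross (L := L i) (hL2.anti (Finset.val_le_iff.2 (hLT i)))
        (U := Finset.univ.filter (fun x => Rch T0.val (p i) x)) (by
          intro a b hab ha
          simp only [Finset.mem_filter, Finset.mem_univ, true_and] at ha ⊢
          exact hcon a b hab ha)
      simp only [hLp, dl, Finset.sum_add_distrib, Finset.sum_ite_eq', Finset.mem_filter,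
        Finset.mem_univ, true_and, Rch.rfl', hi, if_true, if_false] at h2
      simp at h2
    obtain ⟨a, b, hab, ha, hb⟩ := hcross
    have hJi : s(a, b) ∉ J i := fun h => hb (hnc i a b h ha)
    have hJ0m : s(a, b) ∈ J0 := by
      by_contra h
      exact hJi (Finset.mem_symmDiff.2 (Or.inr ⟨hab, h⟩))
    obtain ⟨j, hj⟩ := coverN b (hw2 _ (hLT i hab) b (by simp))
    have hij : i ≠ j := by rintro rfl; exact hb hj
    have hJj : s(a, b) ∉ J j := by
      intro h
      rw [Sym2.eq_swap] at h
      exact hBd i j a hij ha (hnc j b a h hj)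
    have hLj : s(a, b) ∈ L j := by
      by_contra h
      exact hJj (Finset.mem_symmDiff.2 (Or.inl ⟨hJ0m, h⟩))
    exact Finset.disjoint_left.1 (hLd i j hij) hab hLj

end RG

namespace RG
variable {V : Type}

noncomputable def nb (E : Finset (Sym2 V)) (C : Finset V) (q : V) : Finset V :=
  C.filter (fun y => s(q, y) ∈ E)

theorem mem_nb {E : Finset (Sym2 V)} {C : Finset V} {q y : V} :
    y ∈ nb E C q ↔ y ∈ C ∧ s(q, y) ∈ E := Finset.mem_filter

theorem card_st (a : V) (X : Finset V) : (st a X).card = X.card :=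
  Finset.card_image_of_injective _ (fun x y h => Sym2.congr_right.1 h)

theorem fe_star {E : Finset (Sym2 V)} {C : Finset V} {q : V} (hq : q ∉ C) :
    fe E C + (nb E C q).card ≤ fe E (insert q C) := by
  unfold fe
  rw [← card_st q (nb E C q), ← Finset.card_union_of_disjoint]
  · refine Finset.card_le_card ?_
    intro e he
    rcases Finset.mem_union.1 he with h | h
    · obtain ⟨h1, h2⟩ := mem_fes.1 h
      exact mem_fes.2 ⟨h1, fun a ha => Finset.mem_insert_of_mem (h2 a ha)⟩
    · obtain ⟨y, hy, rfl⟩ := mem_st.1 h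
      obtain ⟨h1, h2⟩ := mem_nb.1 hy
      refine mem_fes.2 ⟨h2, fun a ha => ?_⟩
      rcases Sym2.mem_iff.1 ha with rfl | rfl
      · exact Finset.mem_insert_self _ _
      · exact Finset.mem_insert_of_mem h1
  · rw [Finset.disjoint_left]
    intro e h h'
    obtain ⟨h1, h2⟩ := mem_fes.1 h
    obtain ⟨y, hy, rfl⟩ := mem_st.1 h'
    exact hq (h2 q (Sym2.mem_mk_left _ _))

theorem fe_star2 {E : Finset (Sym2 V)} {C : Finset V} {q q' : V} (hq : q ∉ C) (hq' : q' ∉ C)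
    (hne : q ≠ q') (h : s(q, q') ∈ E) :
    fe E C + (nb E C q).card + (nb E C q').card + 1 ≤ fe E (insert q (insert q' C)) := by
  have h1 := fe_star (E := E) hq'
  have h2 := fe_star (E := E) (C := insert q' C) (q := q) (by simp [hq, hne])
  have h3 : (nb E (insert q' C) q) = insert q' (nb E C q) := by
    ext y
    simp only [mem_nb, Finset.mem_insert]
    constructor
    · rintro ⟨rfl | h3, h4⟩
      · exact Or.inl rfl
      · exact Or.inr ⟨h3, h4⟩
    · rintro (rfl | h3)
      · exact ⟨Or.inl rfl, h⟩
      · exact ⟨Or.inr h3.1, h3.2⟩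
  rw [h3, Finset.card_insert_of_notMem (fun h => hq' (mem_nb.1 h).1)] at h2
  omega

theorem fe_mono {E F : Finset (Sym2 V)} (h : E ⊆ F) (C : Finset V) : fe E C ≤ fe F C := by
  refine Finset.card_le_card ?_
  intro e he
  obtain ⟨h1, h2⟩ := mem_fes.1 he
  exact mem_fes.2 ⟨h h1, h2⟩

theorem fe_one {E : Finset (Sym2 V)} (hL : LL E.val) {C : Finset V} (h : C.card = 1) :
    fe E C = 0 := by
  obtain ⟨a, rfl⟩ := Finset.card_eq_one.1 h
  refine Finset.card_eq_zero.2 (Finset.eq_empty_of_forall_notMem ?_)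
  intro e he
  obtain ⟨h1, h2⟩ := mem_fes.1 he
  induction e with | _ x y
  have hx := Finset.mem_singleton.1 (h2 x (Sym2.mem_mk_left _ _))
  have hy := Finset.mem_singleton.1 (h2 y (Sym2.mem_mk_right _ _))
  exact hL _ h1 (by simp [hx, hy])

theorem fes_pair {E : Finset (Sym2 V)} (hL : LL E.val) {a b : V} {e : Sym2 V}
    (he : e ∈ fes E {a, b}) : e = s(a, b) := by
  obtain ⟨h1, h2⟩ := mem_fes.1 he
  induction e with | _ x y
  have hx := h2 x (Sym2.mem_mk_left _ _)
  have hy := h2 y (Sym2.mem_mk_right _ _)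
  have hne : x ≠ y := fun h => hL _ h1 (by simp [h])
  simp only [Finset.mem_insert, Finset.mem_singleton] at hx hy
  rcases hx with rfl | rfl <;> rcases hy with rfl | rfl
  · exact absurd rfl hne
  · rfl
  · exact Sym2.eq_swap
  · exact absurd rfl hne

theorem fe_two {E : Finset (Sym2 V)} (hL : LL E.val) {C : Finset V} (h : C.card = 2) :
    fe E C ≤ 1 := by
  obtain ⟨a, b, hab, rfl⟩ := Finset.card_eq_two.1 h
  refine (Finset.card_le_card (t := {s(a, b)}) ?_).trans (by simp)
  intro e he
  exact Finset.mem_singleton.2 (fes_pair hL he)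

theorem deg_nb {E : Finset (Sym2 V)} {S : Finset V} (hw : ∀ e ∈ E, ∀ a ∈ e, a ∈ S) (x : V) :
    degIn E.val x = (nb E S x).card := by
  rw [← card_st x]
  unfold degIn
  change (E.filter (fun e => x ∈ e)).card = _
  congr 1
  ext e
  rw [Finset.mem_filter, mem_st]
  constructor
  · rintro ⟨h1, h2⟩
    obtain ⟨y, rfl⟩ := Sym2.mem_iff_exists.1 h2
    exact ⟨y, mem_nb.2 ⟨hw _ h1 y (Sym2.mem_mk_right _ _), h1⟩, rfl⟩
  · rintro ⟨y, hy, rfl⟩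
    exact ⟨(mem_nb.1 hy).2, Sym2.mem_mk_left _ _⟩

theorem sum_deg {E : Finset (Sym2 V)} {S : Finset V} (hw : ∀ e ∈ E, ∀ a ∈ e, a ∈ S)
    (hL : LL E.val) : ∑ x ∈ S, degIn E.val x = 2 * E.card := by
  have h1 : ∀ x, degIn E.val x = ∑ e ∈ E, if x ∈ e then 1 else 0 := by
    intro x
    rw [← Finset.card_filter]; rfl
  simp only [h1]
  rw [Finset.sum_comm]
  rw [Finset.sum_congr rfl (g := fun _ => 2)]
  · simp [mul_comm]
  · intro e he
    rw [← Finset.card_filter]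
    have := hw e he
    have h2 := hL e he
    induction e with | _ a b
    have hab : a ≠ b := by simpa using h2
    rw [← Finset.card_pair hab]
    congr 1
    ext y
    simp only [Finset.mem_filter, Sym2.mem_iff, Finset.mem_insert, Finset.mem_singleton]
    constructor
    · exact fun h => h.2
    · intro h; exact ⟨this y (Sym2.mem_iff.2 h), h⟩

theorem par_congr {A B : Finset (Sym2 V)} {x : V} (h : ∀ e, x ∈ e → (e ∈ A ↔ e ∈ B)) :
    par A.val x = par B.val x := by
  unfold par degIn
  congr 1
  change (A.filter (fun e => x ∈ e)).card = (B.filter (fun e => x ∈ e)).card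
  congr 1
  ext e
  simp only [Finset.mem_filter]
  constructor
  · rintro ⟨h1, h2⟩; exact ⟨(h e h2).1 h1, h2⟩
  · rintro ⟨h1, h2⟩; exact ⟨(h e h2).2 h1, h2⟩

theorem par_split {A B E : Finset (Sym2 V)} {x : V} (hd : Disjoint A B)
    (h : ∀ e, x ∈ e → (e ∈ E ↔ e ∈ A ∨ e ∈ B)) :
    par E.val x = par A.val x + par B.val x := by
  rw [par_congr (A := E) (B := A ∪ B) (fun e he => by rw [h e he, Finset.mem_union]),
    par_sum, Finset.sum_union hd, ← par_sum, ← par_sum]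

theorem trees [Fintype V] {E : Finset (Sym2 V)} {S Q : Finset V} {v : V}
    (hw : ∀ e ∈ E, ∀ a ∈ e, a ∈ S) (hL : LL E.val) (hcard : E.card + 4 = 2 * S.card)
    (b3 : ∀ L ⊆ S, L ≠ S → 3 ≤ L.card → fe E L + 4 ≤ 2 * L.card)
    (b4 : ∀ L ⊆ S, L ≠ S → 4 ≤ L.card → fe E L + 5 ≤ 2 * L.card)
    (hv : v ∈ S) (hX3 : (nb E S v).card = 3) (hQS : Q ⊆ S) (hvQ : v ∉ Q) (hQ0 : Q.Nonempty)
    (hQ2 : Q.card ≤ 2) (hQX : Disjoint (nb E S v) Q)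
    (hQE : ∀ q ∈ Q, ∀ q' ∈ Q, q ≠ q' → s(q, q') ∈ E)
    (hXq : ∀ q ∈ Q, (nb E S v ∩ nb E S q).card ≤ 1) :
    ∃ T1 T2 : Finset (Sym2 V), T1 ∪ T2 ⊆ E ∧ Disjoint T1 T2 ∧
      (∀ e ∈ T2, ∀ a ∈ e, a ∈ (S \ Q).erase v) ∧
      (∀ e ∈ E, v ∈ e → e ∈ T1) ∧ (∀ q ∈ Q, ∀ e ∈ E, q ∈ e → (e ∈ T1 ↔ e ∉ fes E Q)) ∧
      (∀ a ∈ S, ∀ b ∈ S, Rch T1.val a b) ∧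
      (∀ a ∈ (S \ Q).erase v, ∀ b ∈ (S \ Q).erase v, Rch T2.val a b) := by
  set N := (S \ Q).erase v with hN
  have memN : ∀ x, x ∈ N ↔ x ≠ v ∧ x ∈ S ∧ x ∉ Q := by intro x; simp [hN]
  have hNS : N ⊆ S := fun x hx => ((memN x).1 hx).2.1
  have hvN : v ∉ N := by simp [memN]
  have hQN : Disjoint N Q := by
    rw [Finset.disjoint_left]; intro x hx; exact ((memN x).1 hx).2.2
  have hqN : ∀ q ∈ Q, q ∉ N := fun q hq hn => ((memN q).1 hn).2.2 hq
  have hX : nb E S v ⊆ N := by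
    intro x hx
    refine (memN x).2 ⟨?_, (mem_nb.1 hx).1, fun h => Finset.disjoint_left.1 hQX hx h⟩
    rintro rfl
    exact hL _ (mem_nb.1 hx).2 (by simp)
  have hNc : N.card + 1 + Q.card = S.card := by
    have h1 : (S \ Q).card + Q.card = S.card := Finset.card_sdiff_add_card_eq_card hQS
    have h2 : N.card + 1 = (S \ Q).card :=
      Finset.card_erase_add_one (Finset.mem_sdiff.2 ⟨hv, hvQ⟩)
    omega
  have hN3 : 3 ≤ N.card := hX3 ▸ Finset.card_le_card hX
  have hpr : ∀ L : Finset V, v ∉ L → L ≠ S := by rintro L h rfl; exact h hv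
  have hnbC : ∀ C ⊆ N, ∀ q, C ∩ nb E N q = nb E C q := by
    intro C hC q
    ext y
    simp only [Finset.mem_inter, mem_nb]
    exact ⟨fun h => ⟨h.1, h.2.2⟩, fun h => ⟨h.1, hC h.1, h.2⟩⟩
  set EN := fes E N with hEN
  have hENm : ∀ e ∈ EN, ∀ a ∈ e, a ∈ N := fun e he => (mem_fes.1 he).2
  have hENE : EN ⊆ E := fun e he => (mem_fes.1 he).1
  have hdisj : ∀ q ∈ Q, ∀ q' ∈ Q, q ≠ q' → Disjoint (nb E N q) (nb E N q') := by
    intro q hq q' hq' hne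
    rw [Finset.disjoint_left]
    intro y hy hy'
    obtain ⟨h1, h2⟩ := mem_nb.1 hy
    obtain ⟨_, h3⟩ := mem_nb.1 hy'
    have hy1 := (memN y).1 h1
    have hqy : q ∉ ({y} : Finset V) := by simp; rintro rfl; exact hqN q hq h1
    have hqy' : q' ∉ ({y} : Finset V) := by simp; rintro rfl; exact hqN q' hq' h1
    have h5 := fe_star2 (E := E) hqy hqy' hne (hQE q hq q' hq' hne)
    have h6 : 1 ≤ (nb E {y} q).card :=
      Finset.card_pos.2 ⟨y, mem_nb.2 ⟨by simp, h2⟩⟩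
    have h7 : 1 ≤ (nb E {y} q').card :=
      Finset.card_pos.2 ⟨y, mem_nb.2 ⟨by simp, h3⟩⟩
    have h8 : (insert q (insert q' ({y} : Finset V))).card = 3 := by
      rw [Finset.card_insert_of_notMem (by simp at hqy ⊢; exact ⟨hne, hqy⟩),
        Finset.card_insert_of_notMem hqy', Finset.card_singleton]
    have h9 := b3 (insert q (insert q' ({y} : Finset V))) (by
      intro x hx
      simp only [Finset.mem_insert, Finset.mem_singleton] at hx
      rcases hx with rfl | rfl | rfl
      · exact hQS hq
      · exact hQS hq'
      · exact hy1.2.1) (hpr _ (by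
        simp only [Finset.mem_insert, Finset.mem_singleton]
        rintro (rfl | rfl | rfl)
        · exact hvQ hq
        · exact hvQ hq'
        · exact hy1.1 rfl)) (by omega)
    omega
  -- general facts on C
  have one : ∀ C ⊆ N, ∀ q ∈ Q, fe EN C + (nb E C q).card ≤ fe E (insert q C) ∧
      (insert q C).card = C.card + 1 ∧ insert q C ⊆ S ∧ insert q C ≠ S := by
    intro C hC q hq
    have hqC : q ∉ C := fun h => hqN q hq (hC h)
    refine ⟨(Nat.add_le_add_right (fe_mono hENE C) _).trans (fe_star hqC),
      Finset.card_insert_of_notMem hqC, ?_, hpr _ ?_⟩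
    · exact Finset.insert_subset (hQS hq) (hC.trans hNS)
    · rw [Finset.mem_insert]; rintro (rfl | h)
      · exact hvQ hq
      · exact hvN (hC h)
  have two : ∀ C ⊆ N, ∀ q ∈ Q, ∀ q' ∈ Q, q ≠ q' → 2 ≤ C.card →
      fe EN C + (nb E C q).card + (nb E C q').card + 2 ≤ 2 * C.card := by
    intro C hC q hq q' hq' hne h2
    have hqC : q ∉ C := fun h => hqN q hq (hC h)
    have hqC' : q' ∉ C := fun h => hqN q' hq' (hC h)
    have h3 := fe_star2 (E := E) hqC hqC' hne (hQE q hq q' hq' hne)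
    have h4 := fe_mono hENE C
    have h5 : (insert q (insert q' C)).card = C.card + 2 := by
      rw [Finset.card_insert_of_notMem (by simp [hqC, hne]), Finset.card_insert_of_notMem hqC']
    have h6 := b4 (insert q (insert q' C))
      (Finset.insert_subset (hQS hq) (Finset.insert_subset (hQS hq') (hC.trans hNS)))
      (hpr _ (by
        simp only [Finset.mem_insert]
        rintro (rfl | rfl | h)
        · exact hvQ hq
        · exact hvQ hq'
        · exact hvN (hC h))) (by omega)
    omega
  have zero : ∀ C ⊆ N, 1 ≤ C.card → fe EN C + 2 ≤ 2 * C.card ∧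
      (C.card ≤ 2 → fe EN C + 1 ≤ C.card) ∧ (3 ≤ C.card → fe EN C + 4 ≤ 2 * C.card) := by
    intro C hC h1
    have h4 := fe_mono hENE C
    rcases Nat.lt_or_ge C.card 3 with h | h
    · have : C.card = 1 ∨ C.card = 2 := by omega
      rcases this with h5 | h5
      · have := fe_one hL h5; omega
      · have := fe_two hL h5; omega
    · have := b3 C (hC.trans hNS) (hpr _ (fun h => hvN (hC h))) h
      omega
  have one' : ∀ C ⊆ N, 1 ≤ C.card → ∀ q ∈ Q, fe EN C + (nb E C q).card + 1 ≤ 2 * C.card ∧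
      (3 ≤ C.card → fe EN C + (nb E C q).card + 3 ≤ 2 * C.card) := by
    intro C hC h1 q hq
    obtain ⟨k1, k2, k3, k4⟩ := one C hC q hq
    rcases Nat.lt_or_ge C.card 3 with h | h
    · have : C.card = 1 ∨ C.card = 2 := by omega
      rcases this with h5 | h5
      · have := fe_two hL (C := insert q C) (by omega)
        omega
      · have := b3 _ k3 k4 (by omega)
        omega
    · have := b4 _ k3 k4 (by omega)
      omega
  have ttq : ∀ C ⊆ N, ∀ q ∈ Q, ∀ q' ∈ Q, q ≠ q' →
      tt Q (nb E N) C = (nb E C q).card + (nb E C q').card := by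
    intro C hC q hq q' hq' hne
    have : Q = {q, q'} := by
      symm
      refine Finset.eq_of_subset_of_card_le ?_ (by rw [Finset.card_pair hne]; exact hQ2)
      intro x hx
      simp only [Finset.mem_insert, Finset.mem_singleton] at hx
      rcases hx with rfl | rfl <;> assumption
    unfold tt
    rw [this, Finset.sum_pair hne, hnbC C hC, hnbC C hC]
  have ttone : ∀ C ⊆ N, (∀ q ∈ Q, ∀ q' ∈ Q, q ≠ q' → (C ∩ nb E N q).Nonempty →
      (C ∩ nb E N q').Nonempty → False) → ∃ q ∈ Q, tt Q (nb E N) C = (nb E C q).card := by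
    intro C hC h
    by_cases h0 : ∃ q ∈ Q, (C ∩ nb E N q).Nonempty
    · obtain ⟨q, hq, hne⟩ := h0
      refine ⟨q, hq, ?_⟩
      unfold tt
      rw [Finset.sum_eq_single_of_mem q hq, hnbC C hC]
      intro q' hq' hqq
      by_contra h1
      exact h q hq q' hq' (Ne.symm hqq) hne
        (Finset.card_pos.1 (Nat.pos_of_ne_zero h1))
    · push Not at h0
      obtain ⟨q, hq⟩ := hQ0
      refine ⟨q, hq, ?_⟩
      unfold tt
      rw [Finset.sum_eq_zero, ← hnbC C hC, h0 q hq, Finset.card_empty]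
      intro q' hq'
      rw [h0 q' hq', Finset.card_empty]
  have hd : ∀ C ⊆ N, ∀ q ∈ Q, ∀ q' ∈ Q, q ≠ q' → (C ∩ nb E N q).Nonempty →
      (C ∩ nb E N q').Nonempty →
      fe EN C + tt Q (nb E N) C + 1 + (if tt Q (nb E N) C = 0 then 1 else 0) + 1 ≤ 2 * C.card := by
    intro C hC q hq q' hq' hne h1 h2
    have h3 : 2 ≤ C.card := by
      obtain ⟨a, ha⟩ := h1
      obtain ⟨b, hb⟩ := h2
      have hab : a ≠ b := by
        rintro rfl
        exact Finset.disjoint_left.1 (hdisj q hq q' hq' hne) (Finset.mem_inter.1 ha).2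
          (Finset.mem_inter.1 hb).2
      rw [← Finset.card_pair hab]
      refine Finset.card_le_card ?_
      intro x hx
      simp only [Finset.mem_insert, Finset.mem_singleton] at hx
      rcases hx with rfl | rfl
      · exact (Finset.mem_inter.1 ha).1
      · exact (Finset.mem_inter.1 hb).1
    have h4 := two C hC q hq q' hq' hne h3
    rw [hnbC C hC] at h1
    have := Finset.card_pos.2 h1
    rw [ttq C hC q hq q' hq' hne, if_neg (by omega)]
    omega
  have hcond := fun (A : Finset (Sym2 V)) (hA : A ⊆ EN) =>
    cond (Nb := nb E N) (Q := Q) (v := v) (X := nb E S v) hENm hX hX3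
      (fun q _ => Finset.filter_subset _ _) hvN hvQ hQN hdisj
      (fun q hq => (Finset.card_le_card (Finset.inter_subset_inter_left (by
        intro y hy
        exact mem_nb.2 ⟨hNS (mem_nb.1 hy).1, (mem_nb.1 hy).2⟩))).trans (hXq q hq)) hQ2
      (fun C hC h0 h2 => (zero C hC (Finset.card_pos.2 h0)).2.1 h2)
      (by
        intro C hC h0
        by_cases h : ∀ q ∈ Q, ∀ q' ∈ Q, q ≠ q' → (C ∩ nb E N q).Nonempty →
            (C ∩ nb E N q').Nonempty → False
        · obtain ⟨q, hq, h1⟩ := ttone C hC h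
          have h2 := (zero C hC (Finset.card_pos.2 h0)).1
          have h3 := (one' C hC (Finset.card_pos.2 h0) q hq).1
          rw [h1]
          split_ifs <;> omega
        · push Not at h
          obtain ⟨q, hq, q', hq', h1, h2, h3, _⟩ := h
          have := hd C hC q hq q' hq' h1 h2 h3
          omega)
      (by
        intro C hC h0 h
        obtain ⟨q, hq, h1⟩ := ttone C hC h
        have h2 := (zero C hC (by omega)).2.2 h0
        have h3 := (one' C hC (by omega) q hq).2 h0
        rw [h1]
        split_ifs <;> omega)
      hd hA
  have hIm : ∀ e, e ∈ II v (nb E S v) Q (nb E N) → e ∈ E ∧ (v ∈ e ∨ ∃ q ∈ Q, q ∈ e ∧ e ∉ fes E Q) := by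
    intro e he
    unfold II at he
    rcases Finset.mem_union.1 he with h | h
    · obtain ⟨y, hy, rfl⟩ := mem_st.1 h
      exact ⟨(mem_nb.1 hy).2, Or.inl (Sym2.mem_mk_left _ _)⟩
    · obtain ⟨q, hq, h⟩ := Finset.mem_biUnion.1 h
      obtain ⟨y, hy, rfl⟩ := mem_st.1 h
      refine ⟨(mem_nb.1 hy).2, Or.inr ⟨q, hq, Sym2.mem_mk_left _ _, fun h => ?_⟩⟩
      exact hqN y ((mem_fes.1 h).2 y (Sym2.mem_mk_right _ _)) (mem_nb.1 hy).1
  set I1 := II v (nb E S v) Q (nb E N) with hI1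
  have hvI : ∀ e ∈ E, v ∈ e → e ∈ I1 := by
    intro e he hve
    obtain ⟨y, rfl⟩ := Sym2.mem_iff_exists.1 hve
    exact Finset.mem_union_left _ (mem_st.2 ⟨y, mem_nb.2 ⟨hw _ he y (Sym2.mem_mk_right _ _), he⟩, rfl⟩)
  have hqI : ∀ q ∈ Q, ∀ e ∈ E, q ∈ e → e ∉ fes E Q → e ∈ I1 := by
    intro q hq e he hqe hn
    by_cases hve : v ∈ e
    · exact hvI e he hve
    obtain ⟨y, rfl⟩ := Sym2.mem_iff_exists.1 hqe
    refine Finset.mem_union_right _ (Finset.mem_biUnion.2 ⟨q, hq, mem_st.2 ⟨y, mem_nb.2 ⟨?_, he⟩, rfl⟩⟩)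
    refine (memN y).2 ⟨?_, hw _ he y (Sym2.mem_mk_right _ _), ?_⟩
    · rintro rfl; exact hve (Sym2.mem_mk_right _ _)
    · intro hy
      refine hn (mem_fes.2 ⟨he, fun a ha => ?_⟩)
      rcases Sym2.mem_iff.1 ha with rfl | rfl <;> assumption
  have hdI : Disjoint EN I1 := by
    rw [Finset.disjoint_left]
    intro e h1 h2
    rcases (hIm e h2).2 with h | ⟨q, hq, h, _⟩
    · exact hvN (hENm e h1 v h)
    · exact hqN q hq (hENm e h1 q h)
  have hIQ : Disjoint I1 (fes E Q) := by
    rw [Finset.disjoint_left]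
    intro e h1 h2
    rcases (hIm e h1).2 with h | ⟨q, hq, h, hn⟩
    · exact hvQ ((mem_fes.1 h2).2 v h)
    · exact hn h2
  have hcov : E ⊆ (I1 ∪ EN) ∪ fes E Q := by
    intro e he
    by_cases h1 : e ∈ fes E Q
    · exact Finset.mem_union_right _ h1
    · refine Finset.mem_union_left _ ?_
      by_cases h2 : e ∈ EN
      · exact Finset.mem_union_right _ h2
      · refine Finset.mem_union_left _ ?_
        have : ∃ a ∈ e, a ∉ N := by
          by_contra h
          push Not at h
          exact h2 (mem_fes.2 ⟨he, h⟩)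
        obtain ⟨a, ha, haN⟩ := this
        by_cases hav : a = v
        · exact hvI e he (hav ▸ ha)
        · have : a ∈ Q := by
            by_contra h
            exact haN ((memN a).2 ⟨hav, hw e he a ha, h⟩)
          exact hqI a this e he ha h1
  have hfeQ : fe E Q + 1 ≤ Q.card := by
    have h1 := Finset.card_pos.2 hQ0
    have : Q.card = 1 ∨ Q.card = 2 := by omega
    rcases this with h5 | h5
    · have := fe_one hL h5; omega
    · have := fe_two hL h5; omega
  have hcE : E.card ≤ I1.card + EN.card + fe E Q :=
    (Finset.card_le_card hcov).trans ((Finset.card_union_le _ _).trans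
      (Nat.add_le_add_right (Finset.card_union_le _ _) _))
  obtain ⟨U1, U2, hU, hUd, hm1, hm2⟩ := matroid_union EN I1 ∅ hdI (Finset.disjoint_empty_right _) (by
    intro A hA
    have := hcond A hA
    simpa using this)
  rw [Finset.empty_union] at hm2
  have hU1 : U1 ⊆ EN := hU ▸ Finset.subset_union_left
  have hU2 : U2 ⊆ EN := hU ▸ Finset.subset_union_right
  have hT1E : I1 ∪ U1 ⊆ E := Finset.union_subset (fun e he => (hIm e he).1) (hU1.trans hENE)
  have w1 : ∀ x y, s(x, y) ∈ I1 ∪ U1 → x ∈ S ∧ y ∈ S := fun x y h =>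
    ⟨hw _ (hT1E h) x (Sym2.mem_mk_left _ _), hw _ (hT1E h) y (Sym2.mem_mk_right _ _)⟩
  have w2 : ∀ x y, s(x, y) ∈ U2 → x ∈ N ∧ y ∈ N := fun x y h =>
    ⟨hENm _ (hU2 h) x (Sym2.mem_mk_left _ _), hENm _ (hU2 h) y (Sym2.mem_mk_right _ _)⟩
  have k1 := kk_one ⟨v, hv⟩ w1
  have k2 := kk_one (Finset.card_pos.1 (by omega)) w2
  have c1 : (I1 ∪ U1).card = I1.card + U1.card :=
    Finset.card_union_of_disjoint (Finset.disjoint_of_subset_left hU1 hdI).symm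
  have c2 : U1.card + U2.card = EN.card := by rw [← hU, Finset.card_union_of_disjoint hUd]
  have hdT : Disjoint (I1 ∪ U1) U2 :=
    Finset.disjoint_union_left.2 ⟨(Finset.disjoint_of_subset_left hU2 hdI).symm, hUd⟩
  refine ⟨I1 ∪ U1, U2, Finset.union_subset hT1E (hU2.trans hENE), hdT,
    fun e he => hENm e (hU2 he), fun e he hv => Finset.mem_union_left _ (hvI e he hv), ?_, ?_, ?_⟩
  · intro q hq e he hqe
    constructor
    · intro h
      rcases Finset.mem_union.1 h with h | h
      · exact Finset.disjoint_left.1 hIQ h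
      · exact absurd (hENm e (hU1 h) q hqe) (hqN q hq)
    · intro h
      exact Finset.mem_union_left _ (hqI q hq e he hqe h)
  · exact kk_conn w1 (by omega)
  · exact kk_conn w2 (by omega)

end RG

namespace RG
variable {V : Type}

theorem core_one [Fintype V] {E : Finset (Sym2 V)} {S Q : Finset V} {v : V}
    (hw : ∀ e ∈ E, ∀ a ∈ e, a ∈ S) (hL : LL E.val) (hcard : E.card + 4 = 2 * S.card)
    (b3 : ∀ L ⊆ S, L ≠ S → 3 ≤ L.card → fe E L + 4 ≤ 2 * L.card)
    (b4 : ∀ L ⊆ S, L ≠ S → 4 ≤ L.card → fe E L + 5 ≤ 2 * L.card)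
    (hv : v ∈ S) (hX3 : (nb E S v).card = 3) (hQS : Q ⊆ S) (hvQ : v ∉ Q) (hQ0 : Q.Nonempty)
    (hQ2 : Q.card ≤ 2) (hQX : Disjoint (nb E S v) Q)
    (hQE : ∀ q ∈ Q, ∀ q' ∈ Q, q ≠ q' → s(q, q') ∈ E)
    (hXq : ∀ q ∈ Q, (nb E S v ∩ nb E S q).card ≤ 1)
    {ρ : V → ZMod 2} (hρ : ∑ x ∈ S, ρ x = 0)
    (hpar : ∀ q ∈ Q, par E.val q = par (fes E Q).val q + ρ q) :
    ∃ E' ≤ E.val, ConnOn (S : Set V) E' ∧ ∀ x ∈ S, par E' x = ρ x := by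
  obtain ⟨T1, T2, hTE, hdis, hT2, hTv, hTq, hc1, hc2⟩ :=
    trees hw hL hcard b3 b4 hv hX3 hQS hvQ hQ0 hQ2 hQX hQE hXq
  set N := (S \ Q).erase v with hN
  have memN : ∀ x, x ∈ N ↔ x ≠ v ∧ x ∈ S ∧ x ∉ Q := by intro x; simp [hN]
  have hvN : v ∉ N := by simp [memN]
  have hNS : N ⊆ S := fun x hx => ((memN x).1 hx).2.1
  have hT1E : T1 ⊆ E := Finset.subset_union_left.trans hTE
  have hT2E : T2 ⊆ E := Finset.subset_union_right.trans hTE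
  have hL1 : LL T1.val := fun e he => hL e (hT1E he)
  have hL2 : LL T2.val := fun e he => hL e (hT2E he)
  have hpT : ∀ q ∈ Q, par T1.val q = ρ q := by
    intro q hq
    have h1 := par_split (A := T1 \ fes E Q) (B := fes E Q) (E := E) (x := q)
      Finset.sdiff_disjoint (by
        intro e he
        constructor
        · intro h
          by_cases h2 : e ∈ fes E Q
          · exact Or.inr h2
          · exact Or.inl (Finset.mem_sdiff.2 ⟨(hTq q hq e h he).2 h2, h2⟩)
        · rintro (h | h)
          · exact hT1E (Finset.mem_sdiff.1 h).1
          · exact (mem_fes.1 h).1)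
    have h2 : par (T1 \ fes E Q).val q = par T1.val q := par_congr (by
      intro e he
      rw [Finset.mem_sdiff]
      refine ⟨fun h => h.1, fun h => ⟨h, (hTq q hq e (hT1E h) he).1 h⟩⟩)
    rw [h2, hpar q hq] at h1
    linear_combination -h1
  let D : V → ZMod 2 := fun x => if x ∈ S then ρ x + par T1.val x else 0
  have eqv : (nb E S v).card = Fintype.card (Fin 3) := by simpa using hX3
  obtain ⟨p, hpi, hpr⟩ : ∃ p : Fin 3 → V, Function.Injective p ∧ ∀ y, y ∈ nb E S v ↔ ∃ i, y = p i := by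
    let f := Finset.equivFinOfCardEq hX3
    refine ⟨fun i => (f.symm i).1, fun i j h => f.symm.injective (Subtype.ext h), fun y => ?_⟩
    constructor
    · intro hy
      exact ⟨f ⟨y, hy⟩, by simp⟩
    · rintro ⟨i, rfl⟩
      exact (f.symm i).2
  have hXN : ∀ x ∈ nb E S v, x ∈ N := by
    intro x hx
    refine (memN x).2 ⟨?_, (mem_nb.1 hx).1, fun h => Finset.disjoint_left.1 hQX hx h⟩
    rintro rfl
    exact hL _ (mem_nb.1 hx).2 (by simp)
  have hDS : ∀ x ∈ S, D x = ρ x + par T1.val x := fun x hx => by simp [D, hx]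
  have hD : ∀ x, x ∉ N → x ≠ v → D x = 0 := by
    intro x hx hxv
    by_cases hxS : x ∈ S
    · have hxQ : x ∈ Q := by
        by_contra h
        exact hx ((memN x).2 ⟨hxv, hxS, h⟩)
      rw [hDS x hxS, hpT x hxQ]
      exact zz _
    · simp [D, hxS]
  have hsum : ∑ x ∈ S, D x = 0 := by
    rw [Finset.sum_congr rfl hDS, Finset.sum_add_distrib, hρ,
      handshake hL1 (fun e he a ha => hw e (hT1E he) a ha), add_zero]
  have hs : D v + ∑ x ∈ N, D x = 0 := by
    rw [← hsum, ← Finset.sum_insert hvN]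
    refine Finset.sum_subset (Finset.insert_subset hv hNS) ?_
    intro x _ hx
    rw [Finset.mem_insert, not_or] at hx
    exact hD x hx.2 hx.1
  obtain ⟨H, hH, hHc, hHp⟩ := solve hL1 hL2 hdis hT2 hc1 hc2 hNS hv hvN (p := p) (by
    intro y
    rw [← hpr, mem_nb]
    constructor
    · intro h
      exact ⟨hw _ (hT1E h) y (Sym2.mem_mk_right _ _), hT1E h⟩
    · intro h
      exact hTv _ h.2 (Sym2.mem_mk_left _ _)) hpi (fun i => hXN _ ((hpr _).2 ⟨i, rfl⟩)) hD hs
  refine ⟨H.val, Finset.val_le_iff.2 (hH.trans hTE), ⟨⟨v, hv⟩, ?_, hHc⟩, ?_⟩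
  · intro e he a ha
    exact hw e (hTE (hH he)) a ha
  · intro x hx
    rw [hHp, hDS x hx]
    linear_combination zz (par T1.val x)

theorem core [Fintype V] {E : Finset (Sym2 V)} {S : Finset V} (hS : S.Nonempty)
    (hw : ∀ e ∈ E, ∀ a ∈ e, a ∈ S) (hL : LL E.val) (hcard : E.card + 4 = 2 * S.card)
    (hδ : ∀ x ∈ S, 3 ≤ degIn E.val x)
    (b3 : ∀ L ⊆ S, L ≠ S → 3 ≤ L.card → fe E L + 4 ≤ 2 * L.card)
    (b4 : ∀ L ⊆ S, L ≠ S → 4 ≤ L.card → fe E L + 5 ≤ 2 * L.card) : Col E.val S := by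
  have hsd := sum_deg hw hL
  have hlow : S.card * 3 ≤ 2 * E.card := by
    rw [← hsd]
    simpa using Finset.card_nsmul_le_sum S _ 3 hδ
  have hS8 : 8 ≤ S.card := by omega
  obtain ⟨v, hv, hv3⟩ : ∃ v ∈ S, degIn E.val v < 4 := by
    by_contra h
    push Not at h
    have := Finset.card_nsmul_le_sum S _ 4 h
    rw [hsd] at this
    simp at this
    omega
  have hX3 : (nb E S v).card = 3 := by
    rw [← deg_nb hw]
    have := hδ v hv
    omega
  have hadj : ∀ a b, s(a, b) ∈ E → s(b, a) ∈ E := fun a b h => by rwa [Sym2.eq_swap]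
  have hirr : ∀ a, s(a, a) ∉ E := fun a h => hL _ h (by simp)
  -- common neighbours of `v` and another vertex
  have hXq : ∀ q ∈ S, q ≠ v → (nb E S v ∩ nb E S q).card ≤ 1 := by
    intro q hq hqv
    by_contra h
    push Not at h
    obtain ⟨C, hC, hC2⟩ := Finset.exists_subset_card_eq h
    have hCS : C ⊆ S := fun x hx => (mem_nb.1 (Finset.mem_inter.1 (hC hx)).1).1
    have hvC : v ∉ C := fun h => hirr v (mem_nb.1 (Finset.mem_inter.1 (hC h)).1).2
    have hqC : q ∉ C := fun h => hirr q (mem_nb.1 (Finset.mem_inter.1 (hC h)).2).2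
    have h1 := fe_star (E := E) hvC
    have h2 := fe_star (E := E) (C := insert v C) (q := q) (by simp [hqC, hqv])
    have h3 : C ⊆ nb E C v := fun x hx =>
      mem_nb.2 ⟨hx, (mem_nb.1 (Finset.mem_inter.1 (hC hx)).1).2⟩
    have h4 : C ⊆ nb E (insert v C) q := fun x hx =>
      mem_nb.2 ⟨Finset.mem_insert_of_mem hx, (mem_nb.1 (Finset.mem_inter.1 (hC hx)).2).2⟩
    have h5 := Finset.card_le_card h3
    have h6 := Finset.card_le_card h4
    have h7 : (insert q (insert v C)).card = 4 := by
      rw [Finset.card_insert_of_notMem (by simp [hqC, hqv]), Finset.card_insert_of_notMem hvC, hC2]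
    have := b4 _ (Finset.insert_subset hq (Finset.insert_subset hv hCS))
      (by intro h; rw [h] at h7; omega) (by omega)
    omega
  have hvX : v ∉ nb E S v := fun h => hirr v (mem_nb.1 h).2
  obtain ⟨q, hqS, hqn⟩ : ∃ q ∈ S, q ∉ insert v (nb E S v) := by
    by_contra h
    push Not at h
    have := Finset.card_le_card (show S ⊆ insert v (nb E S v) from h)
    rw [Finset.card_insert_of_notMem hvX] at this
    omega
  rw [Finset.mem_insert, not_or] at hqn
  obtain ⟨hqv, hqX⟩ := hqn
  obtain ⟨q', hq'n, hq'X⟩ : ∃ q' ∈ nb E S q, q' ∉ nb E S v := by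
    by_contra h
    push Not at h
    have h1 : nb E S q ⊆ nb E S v ∩ nb E S q := fun x hx => Finset.mem_inter.2 ⟨h x hx, hx⟩
    have h2 := Finset.card_le_card h1
    have h3 := hXq q hqS hqv
    have h4 := hδ q hqS
    rw [deg_nb hw] at h4
    omega
  obtain ⟨hq'S, hqq'⟩ := mem_nb.1 hq'n
  have hq'v : q' ≠ v := by
    rintro rfl
    exact hqX (mem_nb.2 ⟨hqS, hadj _ _ hqq'⟩)
  have hne : q ≠ q' := by rintro rfl; exact hirr _ hqq'
  refine ⟨hS, fun ρ hρ => ?_⟩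
  have single : ∀ a ∈ S, a ≠ v → a ∉ nb E S v → par E.val a = ρ a →
      ∃ E' ≤ E.val, ConnOn (S : Set V) E' ∧ ∀ x ∈ S, par E' x = ρ x := by
    intro a ha hav haX hp
    refine core_one (Q := {a}) hw hL hcard b3 b4 hv hX3 (by simpa using ha) (by simpa using hav.symm)
      (by simp) (by simp) (by simpa using haX) ?_ ?_ hρ ?_
    · intro x hx y hy hxy
      rw [Finset.mem_singleton] at hx hy
      exact absurd (hx.trans hy.symm) hxy
    · intro x hx
      rw [Finset.mem_singleton] at hx
      subst hx
      exact hXq x ha hav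
    · intro x hx
      rw [Finset.mem_singleton] at hx
      subst hx
      have : fes E {x} = ∅ := Finset.card_eq_zero.1 (fe_one hL (C := {x}) (by simp))
      rw [this, hp]
      simp
  by_cases h1 : par E.val q = ρ q
  · exact single q hqS hqv hqX h1
  by_cases h2 : par E.val q' = ρ q'
  · exact single q' hq'S hq'v hq'X h2
  have flip : ∀ a b : ZMod 2, a ≠ b → a = 1 + b := by decide
  refine core_one (Q := {q, q'}) hw hL hcard b3 b4 hv hX3 ?_ ?_ (by simp)
    (Finset.card_le_two) ?_ ?_ ?_ hρ ?_
  · intro x hx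
    simp only [Finset.mem_insert, Finset.mem_singleton] at hx
    rcases hx with rfl | rfl <;> assumption
  · simp [Ne.symm hqv, Ne.symm hq'v]
  · rw [Finset.disjoint_right]
    intro x hx
    simp only [Finset.mem_insert, Finset.mem_singleton] at hx
    rcases hx with rfl | rfl <;> assumption
  · intro x hx y hy hxy
    simp only [Finset.mem_insert, Finset.mem_singleton] at hx hy
    rcases hx with rfl | rfl <;> rcases hy with rfl | rfl
    · exact absurd rfl hxy
    · exact hqq'
    · exact hadj _ _ hqq'
    · exact absurd rfl hxy
  · intro x hx
    simp only [Finset.mem_insert, Finset.mem_singleton] at hx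
    rcases hx with rfl | rfl
    · exact hXq _ hqS hqv
    · exact hXq _ hq'S hq'v
  · have hf : fes E {q, q'} = {s(q, q')} := by
      ext e
      rw [Finset.mem_singleton]
      constructor
      · exact fes_pair hL
      · rintro rfl
        refine mem_fes.2 ⟨hqq', fun a ha => ?_⟩
        rcases Sym2.mem_iff.1 ha with rfl | rfl <;> simp
    intro x hx
    have hp1 : par (fes E {q, q'}).val x = 1 := by
      rw [hf, Finset.singleton_val, par_single, if_pos]
      simp only [Finset.mem_insert, Finset.mem_singleton] at hx
      exact Sym2.mem_iff.2 hx
    rw [hp1]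
    simp only [Finset.mem_insert, Finset.mem_singleton] at hx
    rcases hx with rfl | rfl
    · exact flip _ _ h1
    · exact flip _ _ h2

end RG

namespace RG
variable {V : Type}

theorem c4_le {E : Multiset (Sym2 V)} {a b c d : V} (hd : D4 a b c d)
    (h1 : s(a, b) ∈ E) (h2 : s(b, c) ∈ E) (h3 : s(c, d) ∈ E) (h4 : s(d, a) ∈ E) :
    C4 a b c d ≤ E := by
  obtain ⟨d1, d2, d3, d4, d5, d6⟩ := hd
  rw [Multiset.le_iff_subset]
  · intro e he
    simp only [C4, Multiset.insert_eq_cons, Multiset.mem_cons, Multiset.mem_singleton] at he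
    rcases he with rfl | rfl | rfl | rfl <;> assumption
  · simp only [C4, Multiset.insert_eq_cons, Multiset.nodup_cons, Multiset.mem_cons,
      Multiset.mem_singleton, Multiset.nodup_singleton, Sym2.eq_iff]
    grind

theorem k2_c4 {S : Finset V} {E : Multiset (Sym2 V)} (h : IsK2t S E) (hS : 4 ≤ S.card) :
    ∃ a b c d, D4 a b c d ∧ C4 a b c d ≤ E := by
  obtain ⟨a, b, h1, h2, h3, h4, h5⟩ := h
  have hc : 2 ≤ ((S.erase a).erase b).card := by
    rw [Finset.card_erase_of_mem (by simp [h2, h3.symm]), Finset.card_erase_of_mem h1]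
    omega
  obtain ⟨x, hx, y, hy, hxy⟩ := Finset.one_lt_card.1 hc
  simp only [Finset.mem_erase] at hx hy
  have hd : D4 a x b y := ⟨Ne.symm hx.2.1, h3, Ne.symm hy.2.1, hx.1, hxy, Ne.symm hy.1⟩
  refine ⟨a, x, b, y, hd, c4_le hd ?_ ?_ ?_ ?_⟩
  · exact (h5 _).2 ⟨x, hx.2.2, hx.2.1, hx.1, Or.inl rfl⟩
  · exact (h5 _).2 ⟨x, hx.2.2, hx.2.1, hx.1, Or.inr Sym2.eq_swap⟩
  · exact (h5 _).2 ⟨y, hy.2.2, hy.2.1, hy.1, Or.inr rfl⟩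
  · exact (h5 _).2 ⟨y, hy.2.2, hy.2.1, hy.1, Or.inl Sym2.eq_swap⟩

theorem thmA_exact [Fintype V] {S : Finset V} {E : Multiset (Sym2 V)} (hA : HA V S.card)
    (hw : Within (S : Set V) E) (hE : LL E) (hr : RedE E) (hS : 3 ≤ S.card)
    (hcard : E.card + 4 = 2 * S.card) : IsK2t S E := by
  by_cases h3 : S.card = 3
  · exact k2_three hE hr h3 hw (by omega)
  by_cases hlow : ∃ x ∈ S, degIn E x ≤ 2
  · obtain ⟨x, hx, hdx⟩ := hlow
    have hce : (S.erase x).card + 1 = S.card := Finset.card_erase_add_one hx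
    have hcf : degIn E x + (E.filter (fun e => x ∉ e)).card = E.card := by
      unfold degIn
      rw [← Multiset.card_add, Multiset.filter_add_not]
    have hle : E.filter (fun e => x ∉ e) ≤ E := Multiset.filter_le _ _
    have hk : IsK2t (S.erase x) (E.filter (fun e => x ∉ e)) := by
      refine hA _ _ (by omega) ?_ (hE.anti hle) (hr.anti hle) (by omega) (by omega)
      intro e he a ha
      obtain ⟨h1, h2⟩ := Multiset.mem_filter.1 he
      have h4 : a ∈ S := hw e h1 a ha
      have : a ≠ x := by rintro rfl; exact h2 ha
      simp [h4, this]
    have h5 := hk.card_le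
    have := k2_extend hk (Finset.notMem_erase x S) hE hr (by omega)
      (by rw [Finset.insert_erase hx]; exact hw) (by omega)
    rwa [Finset.insert_erase hx] at this
  push Not at hlow
  have hδ : ∀ x ∈ S, 3 ≤ degIn E x := fun x hx => hlow x hx
  by_cases hc4 : ∃ a b c d, D4 a b c d ∧ C4 a b c d ≤ E
  · obtain ⟨a, b, c, d, hd, hC⟩ := hc4
    exact (lemPi hw hE hr hδ (by omega) hd hC hA).elim
  exfalso
  have hnd := hr.nodup hE
  set F : Finset (Sym2 V) := ⟨E, hnd⟩ with hF
  have hfe : ∀ L, fe F L = (ind E L).card := by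
    intro L
    unfold fe ind
    rfl
  have hlt : ∀ L ⊆ S, L ≠ S → L.card < S.card := fun L h1 h2 =>
    Finset.card_lt_card (h1.ssubset_of_ne h2)
  have hcol : Col F.val S := by
    refine core (Finset.card_pos.1 (by omega)) (fun e he a ha => hw e he a ha) hE hcard hδ ?_ ?_
    · intro L h1 h2 h4
      rw [hfe]
      exact hA.ind_bound hE hr (hlt L h1 h2) h4
    · intro L h1 h2 h4
      rw [hfe]
      have h5 := hA.ind_bound hE hr (hlt L h1 h2) (by omega)
      by_contra h6
      have hle := ind_le E L
      have h7 := hA L (ind E L) (hlt L h1 h2) (ind_within E L) (hE.anti hle) (hr.anti hle)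
        (by omega) (by omega)
      obtain ⟨a, b, c, d, hd, hC⟩ := k2_c4 h7 h4
      exact hc4 ⟨a, b, c, d, hd, hC.trans hle⟩
  have := hr S hcol
  omega

theorem thmA [Fintype V] : ∀ n, HA V n := by
  intro n
  induction n with
  | zero => intro S E h; omega
  | succ n ih =>
    intro S E hlt hw hE hr hS hcard
    by_cases h : S.card < n
    · exact ih S E h hw hE hr hS hcard
    have hn : S.card = n := by omega
    obtain ⟨E', hle, hc⟩ : ∃ E' ≤ E, E'.card = 2 * S.card - 4 := by
      obtain ⟨E', h1⟩ := Multiset.exists_mem_of_ne_zero (s := E.powersetCard (2 * S.card - 4)) (by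
        rw [← Multiset.card_pos, Multiset.card_powersetCard]
        exact Nat.choose_pos (by omega))
      exact ⟨E', Multiset.mem_powersetCard.1 h1⟩
    have hk := thmA_exact (hn ▸ ih) (fun e he => hw e (Multiset.mem_of_le hle he)) (hE.anti hle)
      (hr.anti hle) hS (by omega)
    rw [k2_max hk hle hE hr hS hw]
    exact hk

theorem final [Fintype V] (G : Multigraph V)
    (hred : G.Reduced) (hF : G.FVal = 3) (hδ : ∀ x : V, 3 ≤ G.deg x) : ¬ G.HasFourCycle := by
  rintro ⟨a, b, c, d, h1, h2, h3, h4, h5, h6, e1, e2, e3, e4⟩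
  have hr := redE_of_reduced G hred
  have hE : LL G.edges := G.loopless
  have hd : D4 a b c d := ⟨h1, h2, h3, h4, h5, h6⟩
  have hmem := Nat.sInf_mem (s := {k : ℕ | ∃ Eadd : Multiset (Sym2 V), (∀ e ∈ Eadd, ¬ e.IsDiag) ∧
    Multiset.card Eadd = k ∧ HasTwoDisjointSpanningTrees (G.edges + Eadd)}) (by
      rw [Set.nonempty_iff_ne_empty]
      intro h
      unfold FVal at hF
      rw [h] at hF
      simp at hF)
  change G.FVal ∈ _ at hmem
  rw [hF] at hmem
  obtain ⟨Ea, _, hEa, T1, T2, hT, ht1, ht2⟩ := hmem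
  have hcc := Multiset.card_le_card hT
  rw [Multiset.card_add, Multiset.card_add, ht1.2, ht2.2, hEa] at hcc
  refine lemPi (S := Finset.univ) (E := G.edges) (by intro e he x hx; simp) hE hr
    (fun x _ => hδ x) ?_ hd (c4_le hd e1 e2 e3 e4) (thmA _)
  rw [Finset.card_univ]
  omega

end RG

end

/-- Theorem 3.1. Let `G` be a connected reduced graph with `F(G) = 3` and
minimum degree at least 3.  If `G` is not supereulerian, then `G` has no 4-cycles. -/
theorem statement2 {V : Type} [Fintype V] (G : Multigraph V)
    (hconn : G.Connected) (hred : G.Reduced) (hF : G.FVal = 3)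
    (hδ : ∀ x : V, 3 ≤ G.deg x) (hns : ¬ G.Supereulerian) :
    ¬ G.HasFourCycle := by
  exact RG.final G hred hF hδ
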